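/- Let η(t) = t² e^{−t²/2}. Let x ≥ 1, δ ∈ ℝ, and let χ be a primitive Dirichlet character mod q, q ≥ 1. Assume all nontrivial zeros ρ of L(s,χ) with |Im(ρ)| ≤ T₀ lie on the critical line, where T₀ ≥ max(4π²|δ|, 100). Then ∑_{n=1}^∞ Λ(n) χ(n) e(δn/x) η(n/x) equals η̂(−δ)x + O*(err)·x if q = 1, and O*(err)·x if q > 1, where err = T₀ log(qT₀/2π)·(3.5 e^{−0.1598 T₀} + 0.64 e^{−0.1065 T₀²/(πδ)²}) + (1.22 √T₀ log(qT₀) + 5.053 √T₀ + 1.423 log q + 37.19) x^{−1/2} + (3 + 11|δ|) x^{−1} + (log q + 6)(1 + 6|δ|) x^{−3/2}. -/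

import Mathlib

open MeasureTheory Set

/-- `e(t) = e^{2πit}`. -/
noncomputable def e2pi (t : ℝ) : ℂ := Complex.exp (2 * Real.pi * Complex.I * t)

/-- `η(t) = t² e^{-t²/2}`. -/
noncomputable def etaSq (t : ℝ) : ℝ := t^2 * Real.exp (-t^2 / 2)


section
open MeasureTheory Set Filter Topology

lemma hd_factor1 (F : ℂ → ℂ) (hF : Differentiable ℂ F) (hne : ∀ z, analyticOrderAt F z ≠ ⊤) (a : ℂ) :
    ∃ g : ℂ → ℂ, Differentiable ℂ g ∧ (∀ z, F z = (z - a) ^ (analyticOrderNatAt F a) * g z) ∧ g a ≠ 0 := by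
  obtain ⟨g, hg, hga, hFg⟩ := (AnalyticAt.analyticOrderAt_ne_top (hF.analyticAt a)).1 (hne a)
  set n := analyticOrderNatAt F a
  classical
  let G : ℂ → ℂ := fun z => if z = a then g a else F z / (z - a) ^ n
  have hGg : G =ᶠ[𝓝 a] g := by
    filter_upwards [hFg] with z hz
    by_cases h : z = a
    · simp [G, h]
    · have h' : (z - a) ^ n ≠ 0 := pow_ne_zero _ (sub_ne_zero.2 h)
      simp only [G, h, if_false, hz, smul_eq_mul]
      field_simp
  refine ⟨G, ?_, ?_, by simp [G, hga]⟩
  · intro z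
    by_cases h : z = a
    · subst h
      exact (hg.differentiableAt).congr_of_eventuallyEq hGg
    · have : G =ᶠ[𝓝 z] fun z => F z / (z - a) ^ n := by
        filter_upwards [isOpen_ne.mem_nhds h] with w hw
        simp [G, show w ≠ a from hw]
      refine DifferentiableAt.congr_of_eventuallyEq ?_ this
      exact (hF z).div (by fun_prop) (pow_ne_zero _ (sub_ne_zero.2 h))
  · intro z
    by_cases h : z = a
    · subst h
      have := hFg.self_of_nhds
      simpa [G] using this
    · have h' : (z - a) ^ n ≠ 0 := pow_ne_zero _ (sub_ne_zero.2 h)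
      simp only [G, h, if_false]
      field_simp

lemma hd_order_ne_top (F : ℂ → ℂ) (hF : Differentiable ℂ F) (c : ℂ) (hc : F c ≠ 0) (z : ℂ) :
    analyticOrderAt F z ≠ ⊤ := by
  have h : AnalyticOnNhd ℂ F univ := fun z _ => hF.analyticAt z
  refine h.analyticOrderAt_ne_top_of_isPreconnected isPreconnected_univ (mem_univ c) (mem_univ z) ?_
  rw [((hF.analyticAt c).analyticOrderAt_eq_zero).2 hc]
  simp

lemma hd_factor (F : ℂ → ℂ) (hF : Differentiable ℂ F) (c : ℂ) (hc : F c ≠ 0) (s : Finset ℂ) :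
    ∃ g : ℂ → ℂ, Differentiable ℂ g ∧
      (∀ z, F z = (∏ ρ ∈ s, (z - ρ) ^ (analyticOrderNatAt F ρ)) * g z) ∧ ∀ ρ ∈ s, g ρ ≠ 0 := by
  classical
  induction s using Finset.induction_on with
  | empty => exact ⟨F, hF, by simp, by simp⟩
  | insert a s ha ih =>
    obtain ⟨g, hg, hFg, hgs⟩ := ih
    have hgc : g c ≠ 0 := fun h => hc (by rw [hFg, h, mul_zero])
    have hgt := hd_order_ne_top g hg c hgc
    obtain ⟨k, hk, hgk, hka⟩ := hd_factor1 g hg hgt a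
    have hord : analyticOrderNatAt F a = analyticOrderNatAt g a := by
      have h1 : F = (fun z => ∏ ρ ∈ s, (z - ρ) ^ (analyticOrderNatAt F ρ)) * g := by
        ext z; exact hFg z
      have hP : Differentiable ℂ (fun z => ∏ ρ ∈ s, (z - ρ) ^ (analyticOrderNatAt F ρ)) := by
        fun_prop
      have h2 : analyticOrderAt (fun z => ∏ ρ ∈ s, (z - ρ) ^ (analyticOrderNatAt F ρ)) a = 0 := by
        rw [(hP.analyticAt a).analyticOrderAt_eq_zero]
        exact Finset.prod_ne_zero_iff.2 fun ρ hρ => pow_ne_zero _ (sub_ne_zero.2 (by rintro rfl; exact ha hρ))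
      have h3 : analyticOrderAt F a = analyticOrderAt g a := by
        conv_lhs => rw [h1]
        rw [analyticOrderAt_mul (hP.analyticAt a) (hg.analyticAt a), h2, zero_add]
      simp only [analyticOrderNatAt, h3]
    refine ⟨k, hk, ?_, ?_⟩
    · intro z
      rw [Finset.prod_insert ha, hFg z, hgk z, hord]; ring
    · intro ρ hρ
      rcases Finset.mem_insert.1 hρ with rfl | hρ
      · exact hka
      · intro h
        exact hgs ρ hρ (by rw [hgk, h, mul_zero])

lemma hd_finite (F : ℂ → ℂ) (hF : Differentiable ℂ F) (c : ℂ) (hc : F c ≠ 0) (R : ℝ) :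
    {ρ : ℂ | F ρ = 0 ∧ ρ ∈ Metric.closedBall c R}.Finite := by
  by_contra hinf
  obtain ⟨x, -, hx⟩ := Set.Infinite.exists_accPt_of_subset_isCompact (K := Metric.closedBall c R) hinf
    (isCompact_closedBall c R) (fun z hz => hz.2)
  have h : AnalyticOnNhd ℂ F univ := fun z _ => hF.analyticAt z
  have h2 := h.eqOn_zero_of_preconnected_of_frequently_eq_zero isPreconnected_univ (mem_univ x) ?_
  · exact hc (h2 (mem_univ c))
  · rw [accPt_iff_frequently_nhdsNE] at hx
    exact hx.mono fun z hz => hz.1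

noncomputable def hdZ (F : ℂ → ℂ) (c : ℂ) (R : ℝ) : Finset ℂ := by
  classical
  exact if h : {ρ : ℂ | F ρ = 0 ∧ ρ ∈ Metric.closedBall c R}.Finite then h.toFinset else ∅

lemma hd_mem (F : ℂ → ℂ) (hF : Differentiable ℂ F) (c : ℂ) (hc : F c ≠ 0) (R : ℝ) (ρ : ℂ) :
    ρ ∈ hdZ F c R ↔ F ρ = 0 ∧ ‖ρ - c‖ ≤ R := by
  have h := hd_finite F hF c hc R
  rw [hdZ, dif_pos h]
  simp [dist_eq_norm]

-- bound for a nonvanishing function on a ball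
lemma hd_nonvan (g : ℂ → ℂ) (hg : Differentiable ℂ g) (c : ℂ) (R M : ℝ) (hR : 0 < R) (hM : 0 < M)
    (hnv : ∀ z ∈ Metric.ball c R, g z ≠ 0)
    (hb : ∀ z ∈ Metric.ball c R, ‖g z‖ ≤ ‖g c‖ * Real.exp M) (z z0 : ℂ)
    (hz : z ∈ Metric.ball c (R/8)) (hz0 : z0 ∈ Metric.ball c (R/8)) :
    ‖logDeriv g z - logDeriv g z0‖ ≤ 64 * M / R^2 * ‖z - z0‖ := by
  have hcmem : c ∈ Metric.ball c R := Metric.mem_ball_self hR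
  have hgc := hnv c hcmem
  have hld : DifferentiableOn ℂ (logDeriv g) (Metric.ball c R) := by
    have hd : Differentiable ℂ (deriv g) := hg.deriv
    intro w hw
    exact ((hd w).div (hg w) (hnv w hw)).differentiableWithinAt
  obtain ⟨u0, hu0⟩ := hld.isExactOn_ball
  set u : ℂ → ℂ := fun w => u0 w - u0 c with hu
  have hu' : ∀ w ∈ Metric.ball c R, HasDerivAt u (logDeriv g w) w := fun w hw => (hu0 w hw).sub_const _
  have huc : u c = 0 := by simp [hu]
  have hexp : ∀ w ∈ Metric.ball c R, g w = g c * Complex.exp (u w) := by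
    have hconst : ∀ w ∈ Metric.ball c R, HasDerivAt (fun w => g w * Complex.exp (- u w)) 0 w := by
      intro w hw
      have h1 := ((hg w).hasDerivAt).mul ((hu' w hw).neg.cexp)
      have h0 := hnv w hw
      have h2 : deriv g w * Complex.exp ((-u) w) + g w * (Complex.exp ((-u) w) * -logDeriv g w) = 0 := by
        rw [logDeriv_apply]
        field_simp
        ring
      rw [h2] at h1
      exact h1
    intro w hw
    have := (convex_ball c R).is_const_of_fderivWithin_eq_zero (𝕜 := ℂ) (f := fun w => g w * Complex.exp (- u w))
      (fun w hw => (hconst w hw).differentiableAt.differentiableWithinAt)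
      (fun w hw => by
        rw [fderivWithin_of_isOpen Metric.isOpen_ball hw]
        have := (hconst w hw).hasFDerivAt.fderiv
        rw [this]; ext; simp) hw hcmem
    simp only [huc, neg_zero, Complex.exp_zero, mul_one] at this
    rw [← this, mul_assoc, ← Complex.exp_add]; simp
  have hre : ∀ w ∈ Metric.ball c R, (u w).re ≤ M := by
    intro w hw
    have h1 := hb w hw
    rw [hexp w hw, norm_mul, Complex.norm_exp] at h1
    have h2 := le_of_mul_le_mul_left h1 (norm_pos_iff.2 hgc)
    exact Real.exp_le_exp.1 h2
  have hBC : ∀ w ∈ Metric.closedBall c (R/2), ‖u w‖ ≤ 2 * M := by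
    intro w hw
    have hmem : ∀ y ∈ Metric.ball (0:ℂ) R, c + y ∈ Metric.ball c R := by
      intro y hy; simpa [dist_eq_norm] using hy
    have hw' : ‖w - c‖ ≤ R / 2 := by simpa [dist_eq_norm] using hw
    have h := Complex.borelCaratheodory_zero (f := fun y => u (c + y)) (M := M) (R := R) (z := w - c) hM
      (fun y hy => by
        have h1 := (hu' (c + y) (hmem y hy))
        exact ((h1.comp_const_add c y).differentiableAt).differentiableWithinAt)
      (fun y hy => hre _ (hmem y hy)) hR (by simp; linarith) (by simp [huc])
    simp only [add_sub_cancel] at h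
    refine h.trans ?_
    rw [div_le_iff₀ (by linarith)]
    nlinarith
  have hsub : ∀ w r r', r + r' < R → w ∈ Metric.closedBall c r → Metric.closedBall w r' ⊆ Metric.ball c R := by
    intro w r r' h hw y hy
    rw [Metric.mem_closedBall] at hw hy
    rw [Metric.mem_ball]
    linarith [dist_triangle y w c]
  have hd1 : ∀ w ∈ Metric.closedBall c (R/4), ‖logDeriv g w‖ ≤ 8 * M / R := by
    intro w hw
    have h := Complex.norm_deriv_le_of_forall_mem_sphere_norm_le (f := u) (c := w) (R := R/4) (C := 2 * M) (by linarith)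
      (DifferentiableOn.diffContOnCl_ball (U := Metric.ball c R)
        (fun y hy => (hu' y hy).differentiableAt.differentiableWithinAt)
        (hsub w (R/4) (R/4) (by linarith) hw))
      (fun y hy => hBC y (by
        rw [Metric.mem_closedBall] at hw ⊢
        rw [Metric.mem_sphere] at hy
        linarith [dist_triangle y w c]))
    rw [(hu' w (Metric.closedBall_subset_ball (by linarith) hw)).deriv] at h
    refine h.trans (le_of_eq ?_)
    field_simp; ring
  have hd2 : ∀ w ∈ Metric.ball c (R/8), ‖deriv (logDeriv g) w‖ ≤ 64 * M / R^2 := by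
    intro w hw
    have h := Complex.norm_deriv_le_of_forall_mem_sphere_norm_le (f := logDeriv g) (c := w) (R := R/8)
      (C := 8 * M / R) (by linarith)
      (DifferentiableOn.diffContOnCl_ball (U := Metric.ball c R) hld
        (hsub w (R/8) (R/8) (by linarith) (Metric.ball_subset_closedBall hw)))
      (fun y hy => hd1 y (by
        rw [Metric.mem_ball] at hw 
        rw [Metric.mem_closedBall]
        rw [Metric.mem_sphere] at hy
        linarith [dist_triangle y w c]))
    refine h.trans (le_of_eq ?_)
    field_simp; ring
  exact (convex_ball c (R/8)).norm_image_sub_le_of_norm_deriv_le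
    (fun w hw => (hld.differentiableAt (Metric.isOpen_ball.mem_nhds
      (Metric.ball_subset_ball (by linarith) hw)))) hd2 hz0 hz

lemma hd_step (F : ℂ → ℂ) (hF : Differentiable ℂ F) (c : ℂ) (hc : F c ≠ 0) (R M : ℝ) (hR : 0 < R) (hM : 0 < M)
    (hb : ∀ z, ‖z - c‖ = 2 * R → ‖F z‖ ≤ ‖F c‖ * Real.exp M) (z z0 : ℂ) (hz : F z ≠ 0) (hz0 : F z0 ≠ 0)
    (hzR : ‖z - c‖ < R / 8) (hz0R : ‖z0 - c‖ < R / 8) :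
    ‖(logDeriv F z - logDeriv F z0) -
      ∑ ρ ∈ hdZ F c R, (analyticOrderNatAt F ρ : ℂ) * (1 / (z - ρ) - 1 / (z0 - ρ))‖
      ≤ 64 * M / R^2 * ‖z - z0‖ := by
  set s := hdZ F c R with hs
  have hmem : ∀ ρ, ρ ∈ s ↔ F ρ = 0 ∧ ‖ρ - c‖ ≤ R := hd_mem F hF c hc R
  obtain ⟨g, hg, hFg, hgs⟩ := hd_factor F hF c hc s
  set P : ℂ → ℂ := fun z => ∏ ρ ∈ s, (z - ρ) ^ (analyticOrderNatAt F ρ) with hP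
  have hPd : Differentiable ℂ P := by simp only [hP]; fun_prop
  have hne : ∀ w, F w ≠ 0 → ∀ ρ ∈ s, w - ρ ≠ 0 := by
    intro w hw ρ hρ h
    rw [sub_eq_zero] at h
    exact hw (h ▸ ((hmem ρ).1 hρ).1)
  have hPne : ∀ w, F w ≠ 0 → P w ≠ 0 := fun w hw =>
    Finset.prod_ne_zero_iff.2 fun ρ hρ => pow_ne_zero _ (hne w hw ρ hρ)
  have hgne : ∀ w, F w ≠ 0 → g w ≠ 0 := fun w hw h => hw (by rw [hFg, h, mul_zero])
  have hlog : ∀ w, F w ≠ 0 → logDeriv F w =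
      (∑ ρ ∈ s, (analyticOrderNatAt F ρ : ℂ) * (1 / (w - ρ))) + logDeriv g w := by
    intro w hw
    have h1 : F = fun z => P z * g z := by ext z; exact hFg z
    conv_lhs => rw [h1]
    rw [logDeriv_mul w (hPne w hw) (hgne w hw) (hPd w) (hg w)]
    congr 1
    simp only [hP]
    rw [logDeriv_prod (f := fun ρ z => (z - ρ) ^ (analyticOrderNatAt F ρ)) (fun ρ hρ => pow_ne_zero _ (hne w hw ρ hρ)) (fun ρ _ => by fun_prop)]
    refine Finset.sum_congr rfl fun ρ hρ => ?_
    rw [logDeriv_fun_pow (by fun_prop)]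
    congr 1
    rw [logDeriv_apply]
    simp
  have key : ‖logDeriv g z - logDeriv g z0‖ ≤ 64 * M / R^2 * ‖z - z0‖ := by
    have hgnv : ∀ w ∈ Metric.ball c R, g w ≠ 0 := by
      intro w hw h
      have hw0 : F w = 0 := by rw [hFg, h, mul_zero]
      have hw1 : ‖w - c‖ ≤ R := by
        rw [Metric.mem_ball, dist_eq_norm] at hw; exact hw.le
      exact hgs w ((hmem w).2 ⟨hw0, hw1⟩) h
    refine hd_nonvan g hg c R M hR hM hgnv ?_ z z0 (by simpa [dist_eq_norm] using hzR) (by simpa [dist_eq_norm] using hz0R)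
    have hfr : ∀ w ∈ frontier (Metric.ball c (2*R)), ‖g w‖ ≤ ‖g c‖ * Real.exp M := by
      intro w hw
      rw [frontier_ball c (by linarith), mem_sphere_iff_norm] at hw
      have h1 := hb w hw
      rw [hFg w, hFg c, norm_mul, norm_mul] at h1
      change ‖P w‖ * _ ≤ ‖P c‖ * _ * _ at h1
      have hle : ‖P c‖ ≤ ‖P w‖ := by
        simp only [hP, norm_prod, norm_pow]
        refine Finset.prod_le_prod (fun _ _ => by positivity) fun ρ hρ => ?_
        refine pow_le_pow_left₀ (norm_nonneg _) ?_ _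
        have h2 := ((hmem ρ).1 hρ).2
        have h3 : ‖w - c‖ ≤ ‖w - ρ‖ + ‖ρ - c‖ := by
          have := norm_add_le (w - ρ) (ρ - c); simpa using this
        rw [norm_sub_rev c ρ]; linarith
      have hpos : 0 < ‖P c‖ := norm_pos_iff.2 (hPne c hc)
      have h4 : ‖P c‖ * ‖g w‖ ≤ ‖P c‖ * (‖g c‖ * Real.exp M) := by
        calc _ ≤ ‖P w‖ * ‖g w‖ := by gcongr
          _ ≤ _ := by rw [← mul_assoc]; exact h1
      exact le_of_mul_le_mul_left h4 hpos
    intro w hw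
    refine Complex.norm_le_of_forall_mem_frontier_norm_le Metric.isBounded_ball
      (hg.diffContOnCl) hfr (subset_closure (Metric.ball_subset_ball (by linarith) hw))
  convert key using 2
  rw [hlog z hz, hlog z0 hz0]
  simp only [mul_sub, Finset.sum_sub_distrib]
  ring

theorem hd_tendsto (F : ℂ → ℂ) (hF : Differentiable ℂ F) (c : ℂ) (hc : F c ≠ 0) (C : ℝ) (hC : 0 < C)
    (hb : ∀ z, ‖F z‖ ≤ Real.exp (C * (1 + ‖z - c‖) ^ (3/2 : ℝ))) (z z0 : ℂ) (hz : F z ≠ 0) (hz0 : F z0 ≠ 0) :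
    Tendsto (fun R : ℕ => ∑ ρ ∈ hdZ F c R, (analyticOrderNatAt F ρ : ℂ) * (1 / (z - ρ) - 1 / (z0 - ρ)))
      atTop (𝓝 (logDeriv F z - logDeriv F z0)) := by
  rw [tendsto_iff_norm_sub_tendsto_zero]
  set D := max 0 (-Real.log ‖F c‖) with hD
  have hD0 : 0 ≤ D := le_max_left _ _
  have hlim : Tendsto (fun R : ℕ => 64 * (C * (1 + 2 * (R:ℝ)) ^ (3/2:ℝ) + D) / (R:ℝ)^2 * ‖z - z0‖) atTop (𝓝 0) := by
    have hl : Tendsto (fun R : ℕ => 64 * (C * 3 ^ (3/2:ℝ) * (R:ℝ) ^ (-(1/2):ℝ) + D * (R:ℝ)^(-2:ℝ)) * ‖z - z0‖) atTop (𝓝 0) := by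
      have h1 : Tendsto (fun R : ℕ => (R:ℝ) ^ (-(1/2):ℝ)) atTop (𝓝 0) :=
        (tendsto_rpow_neg_atTop (by norm_num)).comp tendsto_natCast_atTop_atTop
      have h2 : Tendsto (fun R : ℕ => (R:ℝ) ^ (-2:ℝ)) atTop (𝓝 0) :=
        (tendsto_rpow_neg_atTop (by norm_num)).comp tendsto_natCast_atTop_atTop
      have := (((h1.const_mul (C * 3 ^ (3/2:ℝ))).add (h2.const_mul D)).const_mul 64).mul_const ‖z - z0‖
      simpa using this
    refine squeeze_zero' (Eventually.of_forall fun R => by positivity) ?_ hl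
    filter_upwards [eventually_ge_atTop 1] with R hR
    have hR1 : (1:ℝ) ≤ R := by exact_mod_cast hR
    have hR0 : (0:ℝ) < R := by linarith
    refine mul_le_mul_of_nonneg_right ?_ (norm_nonneg _)
    rw [mul_div_assoc]
    refine mul_le_mul_of_nonneg_left ?_ (by norm_num)
    have e1 : (1 + 2 * (R:ℝ)) ^ (3/2:ℝ) ≤ 3 ^ (3/2:ℝ) * (R:ℝ) ^ (3/2:ℝ) := by
      rw [← Real.mul_rpow (by norm_num) hR0.le]
      exact Real.rpow_le_rpow (by positivity) (by linarith) (by norm_num)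
    have e2 : (R:ℝ) ^ (3/2:ℝ) = (R:ℝ) ^ (-(1/2):ℝ) * (R:ℝ)^2 := by
      rw [← Real.rpow_natCast, ← Real.rpow_add hR0]; norm_num
    have e3 : (R:ℝ) ^ (-2:ℝ) * (R:ℝ)^2 = 1 := by
      rw [← Real.rpow_natCast, ← Real.rpow_add hR0]; norm_num
    rw [div_le_iff₀ (by positivity)]
    calc C * (1 + 2 * (R:ℝ)) ^ (3/2:ℝ) + D ≤ C * (3 ^ (3/2:ℝ) * (R:ℝ) ^ (3/2:ℝ)) + D * 1 := by
          rw [mul_one]; gcongr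
      _ = _ := by rw [e2]; linear_combination (-D) * e3
  refine squeeze_zero' (Eventually.of_forall fun _ => norm_nonneg _) ?_ hlim
  obtain ⟨N, hN⟩ := exists_nat_gt (8 * (‖z - c‖ + ‖z0 - c‖) + 1)
  filter_upwards [eventually_ge_atTop N] with R hR
  have hR' : (N:ℝ) ≤ R := by exact_mod_cast hR
  have n1 := norm_nonneg (z - c)
  have n2 := norm_nonneg (z0 - c)
  have hR0 : (0:ℝ) < R := by linarith
  rw [norm_sub_rev]
  refine hd_step F hF c hc R _ hR0 (by positivity) ?_ z z0 hz hz0 (by linarith) (by linarith)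
  intro w hw
  refine (hb w).trans ?_
  rw [hw, Real.exp_add]
  have h1 : 1 ≤ ‖F c‖ * Real.exp D := by
    have hp : 0 < ‖F c‖ := norm_pos_iff.2 hc
    have : Real.exp (- Real.log ‖F c‖) ≤ Real.exp D := Real.exp_le_exp.2 (le_max_right _ _)
    rw [Real.exp_neg, Real.exp_log hp] at this
    calc 1 = ‖F c‖ * ‖F c‖⁻¹ := by field_simp
      _ ≤ _ := by gcongr
  have h2 := Real.exp_pos (C * (1 + 2 * (R:ℝ)) ^ (3/2:ℝ))
  nlinarith
end

section
open MeasureTheory Set Filter Topology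
open scoped ComplexConjugate

structure XiLike (F : ℂ → ℂ) : Prop where
  diff : Differentiable ℂ F
  growth : ∃ C : ℝ, 0 < C ∧ ∀ z, ‖F z‖ ≤ Real.exp (C * (1 + ‖z - 2‖) ^ (3/2 : ℝ))
  strip : ∀ z, F z = 0 → 0 < z.re ∧ z.re < 1
  sym : ∃ κ : ℂ, κ ≠ 0 ∧ ∀ z, F (1 - conj z) = κ * conj (F z)

noncomputable abbrev mul' (F : ℂ → ℂ) (ρ : ℂ) : ℝ := (analyticOrderNatAt F ρ : ℝ)

namespace XiLike
variable {F : ℂ → ℂ}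

lemma ne_of_one_le (h : XiLike F) {z : ℂ} (hz : 1 ≤ z.re) : F z ≠ 0 := fun h0 => by
  have := (h.strip z h0).2; linarith

lemma ne_two (h : XiLike F) : F 2 ≠ 0 := h.ne_of_one_le (by norm_num)

lemma zero_of_mul (ρ : ℂ) (hm : mul' F ρ ≠ 0) : F ρ = 0 :=
  apply_eq_zero_of_analyticOrderNatAt_ne_zero (by exact_mod_cast hm)

lemma mul_pos (h : XiLike F) (ρ : ℂ) (hρ : F ρ = 0) : 1 ≤ mul' F ρ := by
  have h1 := hd_order_ne_top F h.diff 2 h.ne_two ρ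
  have h2 := ((h.diff.analyticAt ρ).analyticOrderAt_ne_zero).2 hρ
  have h3 : analyticOrderNatAt F ρ ≠ 0 := by
    intro h0
    apply h2
    rw [← Nat.cast_analyticOrderNatAt h1, h0]; simp
  have : 1 ≤ analyticOrderNatAt F ρ := Nat.one_le_iff_ne_zero.2 h3
  exact_mod_cast this

lemma tendsto_fin (h : XiLike F) {E : Type*} [NormedAddCommGroup E] (a : ℂ → E) (ha : ∀ ρ, F ρ ≠ 0 → a ρ = 0)
    (S : E) (hs : HasSum a S) :
    Tendsto (fun R : ℕ => ∑ ρ ∈ hdZ F 2 R, a ρ) atTop (𝓝 S) := by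
  classical
  have h1 : HasSum (a ∘ ((↑) : {ρ | F ρ = 0} → ℂ)) S :=
    (hasSum_subtype_iff_of_support_subset (fun ρ hρ => by
      by_contra h0; exact hρ (ha ρ h0))).2 hs
  have h2 : Tendsto (fun R : ℕ => (hdZ F 2 R).subtype (fun ρ => ρ ∈ {ρ | F ρ = 0})) atTop atTop := by
    refine tendsto_atTop_finset_of_monotone ?_ ?_
    · intro R R' hR ρ hρ
      simp only [Finset.mem_subtype, hd_mem F h.diff 2 h.ne_two] at hρ ⊢
      exact ⟨hρ.1, hρ.2.trans (by exact_mod_cast hR)⟩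
    · intro ρ
      obtain ⟨N, hN⟩ := exists_nat_ge ‖(ρ:ℂ) - 2‖
      exact ⟨N, by simp only [Finset.mem_subtype, hd_mem F h.diff 2 h.ne_two]; exact ⟨ρ.2, hN⟩⟩
  refine (h1.comp h2).congr fun R => ?_
  simp only [Function.comp_apply]
  rw [Finset.sum_subtype_eq_sum_filter (f := a)]
  congr 1
  refine Finset.filter_true_of_mem fun ρ hρ => ?_
  exact ((hd_mem F h.diff 2 h.ne_two R ρ).1 hρ).1

lemma hasSum_of_nonneg (h : XiLike F) (a : ℂ → ℝ) (ha : ∀ ρ, F ρ ≠ 0 → a ρ = 0) (h0 : ∀ ρ, 0 ≤ a ρ)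
    (S : ℝ) (hs : Tendsto (fun R : ℕ => ∑ ρ ∈ hdZ F 2 R, a ρ) atTop (𝓝 S)) : HasSum a S := by
  classical
  have hmono : Monotone (fun R : ℕ => ∑ ρ ∈ hdZ F 2 R, a ρ) := by
    intro R R' hR
    refine Finset.sum_le_sum_of_subset_of_nonneg ?_ (fun ρ _ _ => h0 ρ)
    intro ρ hρ
    rw [hd_mem F h.diff 2 h.ne_two] at hρ ⊢
    exact ⟨hρ.1, hρ.2.trans (by exact_mod_cast hR)⟩
  have hsum : Summable a := by
    refine summable_of_sum_le h0 (c := S) fun u => ?_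
    obtain ⟨N, hN⟩ : ∃ N : ℕ, ∀ ρ ∈ u, ‖ρ - 2‖ ≤ N := by
      obtain ⟨N, hN⟩ := exists_nat_ge (∑ ρ ∈ u, ‖ρ - 2‖)
      exact ⟨N, fun ρ hρ => (Finset.single_le_sum (f := fun ρ => ‖ρ - 2‖) (fun _ _ => norm_nonneg _) hρ).trans hN⟩
    refine le_trans ?_ (hmono.ge_of_tendsto hs N)
    rw [← Finset.sum_filter_add_sum_filter_not u (fun ρ => F ρ = 0)]
    rw [Finset.sum_eq_zero (s := u.filter (fun ρ => ¬ F ρ = 0)) (fun ρ hρ => ha ρ (Finset.mem_filter.1 hρ).2), add_zero]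
    refine Finset.sum_le_sum_of_subset_of_nonneg ?_ (fun ρ _ _ => h0 ρ)
    intro ρ hρ
    rw [hd_mem F h.diff 2 h.ne_two]
    exact ⟨(Finset.mem_filter.1 hρ).2, hN ρ (Finset.mem_filter.1 hρ).1⟩
  have := tendsto_nhds_unique (h.tendsto_fin a ha _ hsum.hasSum) hs
  rw [← this]; exact hsum.hasSum

lemma logDeriv_sym (h : XiLike F) (z : ℂ) : logDeriv F (1 - conj z) = - conj (logDeriv F z) := by
  obtain ⟨κ, hκ, hs⟩ := h.sym
  have h1 : HasDerivAt F (deriv F z) z := (h.diff z).hasDerivAt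
  have h2 : HasDerivAt (conj ∘ F ∘ conj) (conj (deriv F z)) (conj z) := by
    have := h1.conj_conj
    exact this
  have h3 : F = fun w => κ * (conj ∘ F ∘ conj) (1 - w) := by
    ext w
    have := hs (1 - conj w)
    simp only [map_sub, map_one, Complex.conj_conj, sub_sub_cancel] at this
    simp [Function.comp, this]
  have h4 : HasDerivAt (fun w => κ * (conj ∘ F ∘ conj) (1 - w)) (κ * (-(conj (deriv F z)))) (1 - conj z) := by
    refine HasDerivAt.const_mul κ ?_
    have h5 : HasDerivAt (conj ∘ F ∘ conj) (conj (deriv F z)) (1 - (1 - conj z)) := by simpa using h2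
    exact h5.comp_const_sub 1 (1 - conj z)
  rw [← h3] at h4
  rw [logDeriv_apply, logDeriv_apply, h4.deriv, hs z, map_div₀]
  field_simp

lemma zero_sym (h : XiLike F) (ρ : ℂ) : F (1 - conj ρ) = 0 ↔ F ρ = 0 := by
  obtain ⟨κ, hκ, hs⟩ := h.sym
  rw [hs]; simp [hκ]

lemma mul_sym_le (h : XiLike F) (ρ : ℂ) : analyticOrderNatAt F (1 - conj ρ) = analyticOrderNatAt F ρ := by
  obtain ⟨κ, hκ, hs⟩ := h.sym
  obtain ⟨g, hg, hFg, hga⟩ := hd_factor1 F h.diff (hd_order_ne_top F h.diff 2 h.ne_two) ρ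
  set n := analyticOrderNatAt F ρ
  have hord : analyticOrderAt F (1 - conj ρ) = n := by
    rw [(h.diff.analyticAt _).analyticOrderAt_eq_natCast]
    have hgd : Differentiable ℂ (fun w => conj (g (conj w))) := fun w => by
      have := (hg (conj w)).hasDerivAt.conj_conj
      simp only [Complex.conj_conj] at this
      exact this.differentiableAt
    refine ⟨fun w => κ * (-1) ^ n * conj (g (conj (1 - w))), ?_, ?_, ?_⟩
    · refine Differentiable.analyticAt ?_ _
      refine Differentiable.const_mul ?_ _
      exact hgd.comp (by fun_prop : Differentiable ℂ fun w : ℂ => 1 - w)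
    · simp [hκ, hga]
    · refine Eventually.of_forall fun w => ?_
      have := hs (1 - conj w)
      simp only [map_sub, map_one, Complex.conj_conj, sub_sub_cancel] at this
      rw [this, hFg (1 - conj w)]
      simp only [map_mul, map_pow, map_sub, map_one, Complex.conj_conj, smul_eq_mul]
      have : (1 - w - conj ρ) ^ n = (-1) ^ n * (w - (1 - conj ρ)) ^ n := by
        rw [← mul_pow]; congr 1; ring
      rw [this]; ring
  simp [analyticOrderNatAt, hord]

lemma mul_sym (h : XiLike F) (ρ : ℂ) : mul' F (1 - conj ρ) = mul' F ρ := by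
  simp only [mul', h.mul_sym_le]

/-- kernel -/
noncomputable def ker (s ρ : ℂ) : ℝ := (1 / (s - ρ)).re + (1 / (s - (1 - conj ρ))).re

lemma inv_re (w : ℂ) : (1 / w).re = w.re / ‖w‖ ^ 2 := by
  rw [one_div, Complex.inv_re, Complex.normSq_eq_norm_sq]

lemma ker_term_nonneg (s ρ : ℂ) (hs : 1 ≤ s.re) (hρ : 0 < ρ.re ∧ ρ.re < 1) :
    0 ≤ (1 / (s - ρ)).re ∧ 0 ≤ (1 / (s - (1 - conj ρ))).re := by
  rw [inv_re, inv_re]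
  constructor
  · exact div_nonneg (by simp; linarith) (by positivity)
  · exact div_nonneg (by simp; linarith) (by positivity)

theorem hasSum_W (h : XiLike F) (s : ℂ) (hs : 1 < s.re) :
    HasSum (fun ρ => mul' F ρ * ker s ρ) (2 * (logDeriv F s).re) := by
  obtain ⟨C, hC, hb⟩ := h.growth
  refine h.hasSum_of_nonneg _ (fun ρ hρ => ?_) (fun ρ => ?_) _ ?_
  · by_cases hm : mul' F ρ = 0
    · simp only [hm, zero_mul]
    · exact absurd (zero_of_mul ρ hm) hρ
  · by_cases hm : mul' F ρ = 0
    · simp only [hm, zero_mul, le_refl]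
    · have := ker_term_nonneg s ρ hs.le (h.strip ρ (zero_of_mul ρ hm))
      exact mul_nonneg (by positivity) (add_nonneg this.1 this.2)
  · have hz0 : F (1 - conj s) ≠ 0 := by
      rw [Ne, h.zero_sym]; exact h.ne_of_one_le hs.le
    have := hd_tendsto F h.diff 2 h.ne_two C hC hb s (1 - conj s) (h.ne_of_one_le hs.le) hz0
    rw [h.logDeriv_sym] at this
    have h2 := (Complex.continuous_re.tendsto _).comp this
    convert h2 using 2 with R
    · simp only [Function.comp_apply, Complex.re_sum]
      refine Finset.sum_congr rfl fun ρ _ => ?_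
      simp only [mul', ker]
      have e : 1 - conj s - ρ = - conj (s - (1 - conj ρ)) := by simp; ring
      rw [e]
      have e2 : (1:ℂ) / (- conj (s - (1 - conj ρ))) = - conj (1 / (s - (1 - conj ρ))) := by
        rw [map_div₀, map_one, div_neg]
      rw [e2, sub_neg_eq_add, ← Complex.ofReal_natCast, Complex.re_ofReal_mul, Complex.add_re, Complex.conj_re]
    · simp; ring

lemma ker_two_ge (ρ : ℂ) (hρ : 0 < ρ.re ∧ ρ.re < 1) : 1 / ‖2 - ρ‖ ^ 2 ≤ ker 2 ρ := by
  have := ker_term_nonneg 2 ρ (by norm_num) hρ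
  have h2 : 1 / ‖2 - ρ‖ ^ 2 ≤ (1 / (2 - ρ)).re := by
    rw [inv_re]
    gcongr
    simp; linarith
  unfold ker; linarith

lemma summable_sq (h : XiLike F) : Summable (fun ρ => mul' F ρ / ‖2 - ρ‖ ^ 2) := by
  refine Summable.of_nonneg_of_le (fun ρ => by positivity) (fun ρ => ?_) (h.hasSum_W 2 (by norm_num)).summable
  by_cases hm : mul' F ρ = 0
  · simp only [hm, zero_mul, zero_div, le_refl]
  · have := ker_two_ge ρ (h.strip ρ (zero_of_mul ρ hm))
    rw [div_eq_mul_one_div]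
    gcongr

lemma tsum_sq_le (h : XiLike F) : ∑' ρ, mul' F ρ / ‖2 - ρ‖ ^ 2 ≤ 2 * (logDeriv F 2).re := by
  rw [← (h.hasSum_W 2 (by norm_num)).tsum_eq]
  refine h.summable_sq.tsum_le_tsum (fun ρ => ?_) (h.hasSum_W 2 (by norm_num)).summable
  by_cases hm : mul' F ρ = 0
  · simp only [hm, zero_mul, zero_div, le_refl]
  · have := ker_two_ge ρ (h.strip ρ (zero_of_mul ρ hm))
    rw [div_eq_mul_one_div]
    gcongr

lemma two_line (t : ℝ) (ρ : ℂ) (hρ : ρ.re < 1) : ‖2 - ρ‖ ≤ (1 + |t|) * ‖2 + t * Complex.I - ρ‖ := by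
  have h1 : (1:ℝ) ≤ ‖2 + t * Complex.I - ρ‖ := by
    refine le_trans ?_ (Complex.re_le_norm _)
    simp; linarith
  have h2 : ‖2 - ρ‖ ≤ ‖2 + t * Complex.I - ρ‖ + |t| := by
    have := norm_sub_le (2 + t * Complex.I - ρ) (t * Complex.I)
    have e : 2 + t * Complex.I - ρ - t * Complex.I = 2 - ρ := by ring
    rw [e] at this
    simpa using this
  nlinarith [abs_nonneg t]

lemma diff_bound (t : ℝ) (ρ : ℂ) (hρ : ρ.re < 1) :
    ‖1 / (2 + t * Complex.I - ρ) - 1 / (2 - ρ)‖ ≤ |t| * (1 + |t|) / ‖2 - ρ‖ ^ 2 := by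
  have h1 := two_line t ρ hρ
  have h2 : 0 < ‖2 - ρ‖ := by
    refine lt_of_lt_of_le ?_ (Complex.re_le_norm _)
    simp; linarith
  have h3 : 0 < ‖2 + t * Complex.I - ρ‖ := by
    refine lt_of_lt_of_le ?_ (Complex.re_le_norm _)
    simp; linarith
  have n2 : 2 - ρ ≠ 0 := norm_pos_iff.1 h2
  have n3 : 2 + t * Complex.I - ρ ≠ 0 := norm_pos_iff.1 h3
  have e : 1 / (2 + t * Complex.I - ρ) - 1 / (2 - ρ) = - (t * Complex.I) / ((2 + t * Complex.I - ρ) * (2 - ρ)) := by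
    field_simp; ring
  rw [e, norm_div, norm_mul, norm_neg]
  simp only [norm_mul, Complex.norm_I, mul_one, Complex.norm_real, Real.norm_eq_abs]
  rw [div_le_div_iff₀ (by positivity) (by positivity)]
  nlinarith [mul_nonneg (mul_nonneg (abs_nonneg t) h2.le) (sub_nonneg.2 h1)]

theorem hasSum_diff (h : XiLike F) (t : ℝ) :
    HasSum (fun ρ => (mul' F ρ : ℂ) * (1 / (2 + t * Complex.I - ρ) - 1 / (2 - ρ)))
      (logDeriv F (2 + t * Complex.I) - logDeriv F 2) := by
  have hsum : Summable (fun ρ => (mul' F ρ : ℂ) * (1 / (2 + t * Complex.I - ρ) - 1 / (2 - ρ))) := by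
    refine Summable.of_norm_bounded (h.summable_sq.mul_left (|t| * (1 + |t|))) fun ρ => ?_
    by_cases hm : mul' F ρ = 0
    · simp only [hm]; simp
    · have := diff_bound t ρ (h.strip ρ (zero_of_mul ρ hm)).2
      rw [norm_mul, Complex.norm_real, Real.norm_of_nonneg (by positivity)]
      calc _ ≤ mul' F ρ * (|t| * (1 + |t|) / ‖2 - ρ‖ ^ 2) := by gcongr
        _ = _ := by ring
  obtain ⟨C, hC, hb⟩ := h.growth
  have h1 := hd_tendsto F h.diff 2 h.ne_two C hC hb (2 + t * Complex.I) 2 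
    (h.ne_of_one_le (by simp)) h.ne_two
  have h2 := h.tendsto_fin _ (fun ρ hρ => by
    by_cases hm : mul' F ρ = 0
    · simp only [hm]; simp
    · exact absurd (zero_of_mul ρ hm) hρ) _ hsum.hasSum
  have h3 := tendsto_nhds_unique h2 (h1.congr fun R => by simp [mul'])
  rw [← h3]; exact hsum.hasSum

end XiLike
end

section
open MeasureTheory Set Filter Topology
open scoped ComplexConjugate

def GB (f : ℂ → ℂ) (S : Set ℂ) : Prop :=
  ∃ C : ℝ, 0 < C ∧ ∀ z ∈ S, ‖f z‖ ≤ Real.exp (C * (1 + ‖z - 2‖) ^ (3/2 : ℝ))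

lemma GB_one_le (z : ℂ) : 1 ≤ (1 + ‖z - 2‖) ^ (3/2 : ℝ) :=
  Real.one_le_rpow (by linarith [norm_nonneg (z - 2)]) (by norm_num)

lemma GB_le (z : ℂ) : 1 + ‖z - 2‖ ≤ (1 + ‖z - 2‖) ^ (3/2 : ℝ) := by
  conv_lhs => rw [← Real.rpow_one (1 + ‖z - 2‖)]
  exact Real.rpow_le_rpow_of_exponent_le (by linarith [norm_nonneg (z - 2)]) (by norm_num)

lemma GB.mul {f g : ℂ → ℂ} {S : Set ℂ} (hf : GB f S) (hg : GB g S) : GB (fun z => f z * g z) S := by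
  obtain ⟨C, hC, h⟩ := hf
  obtain ⟨D, hD, k⟩ := hg
  refine ⟨C + D, by positivity, fun z hz => ?_⟩
  rw [norm_mul, add_mul, Real.exp_add]
  exact mul_le_mul (h z hz) (k z hz) (norm_nonneg _) (Real.exp_pos _).le

lemma GB.of_exp {f : ℂ → ℂ} {S : Set ℂ} (C : ℝ) (h : ∀ z ∈ S, ‖f z‖ ≤ Real.exp (C * (1 + ‖z - 2‖))) : GB f S := by
  refine ⟨|C| + 1, by positivity, fun z hz => (h z hz).trans (Real.exp_le_exp.2 ?_)⟩
  have h1 := GB_le z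
  have h2 : 0 ≤ 1 + ‖z - 2‖ := by positivity
  nlinarith [le_abs_self C, abs_nonneg C]

lemma GB.of_bdd {f : ℂ → ℂ} {S : Set ℂ} (B : ℝ) (h : ∀ z ∈ S, ‖f z‖ ≤ B) : GB f S := by
  refine GB.of_exp (|B|) fun z hz => (h z hz).trans ?_
  have h2 : 0 ≤ ‖z - 2‖ := by positivity
  have h3 := Real.add_one_le_exp (|B| * (1 + ‖z - 2‖))
  nlinarith [le_abs_self B, abs_nonneg B]

lemma GB.add_one {f : ℂ → ℂ} {S : Set ℂ} (hf : GB f S) : GB (fun z => f z + 1) S := by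
  obtain ⟨C, hC, h⟩ := hf
  refine ⟨C + 1, by positivity, fun z hz => (norm_add_le _ _).trans ?_⟩
  have h1 := h z hz
  have h2 := GB_one_le z
  rw [add_mul, Real.exp_add, one_mul, norm_one]
  have h3 : 1 ≤ Real.exp (C * (1 + ‖z - 2‖) ^ (3/2 : ℝ)) := Real.one_le_exp (by positivity)
  have h4 : 2 ≤ Real.exp ((1 + ‖z - 2‖) ^ (3/2 : ℝ)) := by
    linarith [Real.add_one_le_exp ((1 + ‖z - 2‖) ^ (3/2 : ℝ))]
  nlinarith

lemma GB.union {f : ℂ → ℂ} {S T : Set ℂ} (hf : GB f S) (hg : GB f T) : GB f (S ∪ T) := by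
  obtain ⟨C, hC, h⟩ := hf
  obtain ⟨D, hD, k⟩ := hg
  refine ⟨C + D, by positivity, fun z hz => ?_⟩
  have := GB_one_le z
  rcases hz with hz | hz
  · exact (h z hz).trans (Real.exp_le_exp.2 (by nlinarith))
  · exact (k z hz).trans (Real.exp_le_exp.2 (by nlinarith))

lemma GB.id : GB (fun z => z) univ := by
  refine GB.of_exp 2 fun z _ => ?_
  have h1 : ‖z‖ ≤ ‖z - 2‖ + 2 := by
    have := norm_add_le (z - 2) 2; simpa using this
  linarith [Real.add_one_le_exp (2 * (1 + ‖z - 2‖)), norm_nonneg (z-2)]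

lemma GB.sub_one : GB (fun z => z - 1) univ := by
  refine GB.of_exp 2 fun z _ => ?_
  have h1 : ‖z - 1‖ ≤ ‖z - 2‖ + 1 := by
    have := norm_add_le (z - 2) 1; simp only [norm_one] at this
    rwa [show z - 2 + 1 = z - 1 by ring] at this
  linarith [Real.add_one_le_exp (2 * (1 + ‖z - 2‖)), norm_nonneg (z-2)]

lemma GB.mono {f : ℂ → ℂ} {S T : Set ℂ} (hf : GB f S) (h : T ⊆ S) : GB f T := by
  obtain ⟨C, hC, k⟩ := hf
  exact ⟨C, hC, fun z hz => k z (h hz)⟩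

lemma Gamma_le_rpow (n : ℕ) : ∀ x : ℝ, 1 ≤ x → x ≤ n + 2 → Real.Gamma x ≤ x ^ x := by
  induction n with
  | zero =>
    intro x h1 h2
    have h3 : Real.Gamma x ≤ 1 := by
      have hc := Real.convexOn_Gamma
      have := hc.le_max_of_mem_Icc (x := 1) (y := 2) (z := x) (by simp) (by simp) ⟨h1, by simpa using h2⟩
      simpa [Real.Gamma_two] using this
    exact h3.trans (Real.one_le_rpow h1 (by linarith))
  | succ n ih =>
    intro x h1 h2
    by_cases hx : x ≤ 2
    · exact ih x h1 (by have : (0:ℝ) ≤ n := by positivity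
                        linarith)
    · push Not at hx
      have h3 := ih (x - 1) (by linarith) (by push_cast at h2; linarith)
      have h4 : Real.Gamma x = (x - 1) * Real.Gamma (x - 1) := by
        have := Real.Gamma_add_one (s := x - 1) (by linarith)
        simpa using this
      rw [h4]
      calc (x - 1) * Real.Gamma (x - 1) ≤ x * (x - 1) ^ (x - 1) := by
            gcongr; linarith
        _ ≤ x * x ^ (x - 1) := by
            gcongr; linarith
        _ = x ^ x := by
            rw [Real.rpow_sub_one (by linarith)]; field_simp

lemma Gamma_le_exp (x : ℝ) (hx : 1 ≤ x) : Real.Gamma x ≤ Real.exp (2 * x ^ (3/2:ℝ)) := by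
  obtain ⟨n, hn⟩ := exists_nat_ge x
  refine (Gamma_le_rpow n x hx (by linarith)).trans ?_
  rw [Real.rpow_def_of_pos (by linarith)]
  refine Real.exp_le_exp.2 ?_
  have h1 : Real.log x ≤ x ^ (1/2:ℝ) / (1/2) := Real.log_le_rpow_div (by linarith) (by norm_num)
  have h2 : x ^ (3/2:ℝ) = x * x ^ (1/2:ℝ) := by
    conv_rhs => rw [← Real.rpow_one_add' (by linarith) (by norm_num)]
    norm_num
  rw [h2]; nlinarith

lemma norm_Gamma_le (s : ℂ) (hs : 0 < s.re) : ‖Complex.Gamma s‖ ≤ Real.Gamma s.re := by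
  rw [Complex.Gamma_eq_integral hs, Real.Gamma_eq_integral hs, Complex.GammaIntegral]
  refine (norm_integral_le_integral_norm _).trans (le_of_eq ?_)
  refine setIntegral_congr_fun measurableSet_Ioi fun t ht => ?_
  have ht0 : 0 < t := ht
  simp only [norm_mul, Complex.norm_real, Complex.norm_cpow_eq_rpow_re_of_pos ht0]
  simp [abs_of_pos (Real.exp_pos _)]

lemma GB_Gamma (a : ℝ) (ha0 : 0 ≤ a) (ha : a ≤ 1) : GB (fun s => Complex.Gamma ((s + a) / 2)) {s | 2 ≤ s.re} := by
  refine ⟨2 * 2 ^ (3/2:ℝ), by positivity, fun s hs => ?_⟩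
  have hs' : 2 ≤ s.re := hs
  have hre : ((s + a) / 2).re = (s.re + a) / 2 := by simp
  refine (norm_Gamma_le _ (by rw [hre]; linarith)).trans ?_
  rw [hre]
  refine (Gamma_le_exp _ (by linarith)).trans (Real.exp_le_exp.2 ?_)
  have h1 : s.re - 2 ≤ ‖s - 2‖ := by
    have := Complex.re_le_norm (s - 2); simpa using this
  have h2 : (s.re + a) / 2 ≤ 2 * (1 + ‖s - 2‖) := by linarith [norm_nonneg (s-2)]
  have h3 := Real.rpow_le_rpow (by linarith) h2 (by norm_num : (0:ℝ) ≤ 3/2)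
  rw [Real.mul_rpow (by norm_num) (by positivity)] at h3
  linarith

lemma GB_cpow (b : ℝ) (hb : 0 < b) (k : ℝ) (S : Set ℂ) : GB (fun s => (b:ℂ) ^ (k * s)) S := by
  refine GB.of_exp (|Real.log b| * (2 * |k|)) fun z _ => ?_
  rw [Complex.norm_cpow_eq_rpow_re_of_pos hb, Real.rpow_def_of_pos hb]
  refine Real.exp_le_exp.2 ?_
  have h1 : |z.re| ≤ 2 * (1 + ‖z - 2‖) := by
    have h3 := Complex.abs_re_le_norm (z - 2)
    simp only [Complex.sub_re, Complex.re_ofNat] at h3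
    have := abs_add_le (z.re - 2) 2
    simp at this
    linarith [norm_nonneg (z-2)]
  have h2 : Real.log b * (↑k * z).re ≤ |Real.log b| * (|k| * |z.re|) := by
    refine (le_abs_self _).trans ?_
    simp [abs_mul]
  refine h2.trans ?_
  rw [mul_assoc]
  refine mul_le_mul_of_nonneg_left ?_ (abs_nonneg _)
  nlinarith [abs_nonneg k]

lemma mellin_strip (f : ℝ → ℂ) (h : ∀ s, MellinConvergent f s) (a b : ℝ) :
    ∃ B, ∀ s : ℂ, a ≤ s.re → s.re ≤ b → ‖mellin f s‖ ≤ B := by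
  have hi : ∀ a : ℝ, IntegrableOn (fun t : ℝ => t ^ (a - 1) * ‖f t‖) (Ioi 0) := by
    intro a
    have := (h a).norm
    refine IntegrableOn.congr_fun this (fun t ht => ?_) measurableSet_Ioi
    have ht0 : 0 < t := ht
    simp [norm_smul, Complex.norm_cpow_eq_rpow_re_of_pos ht0]
  refine ⟨∫ t in Ioi (0:ℝ), (t ^ (a - 1) * ‖f t‖ + t ^ (b - 1) * ‖f t‖), fun s h1 h2 => ?_⟩
  rw [mellin]
  refine (norm_integral_le_integral_norm _).trans ?_
  refine setIntegral_mono_on (h s).norm ((hi a).add (hi b)) measurableSet_Ioi fun t ht => ?_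
  have ht0 : 0 < t := ht
  rw [norm_smul, Complex.norm_cpow_eq_rpow_re_of_pos ht0, ← add_mul]
  refine mul_le_mul_of_nonneg_right ?_ (norm_nonneg _)
  simp only [Complex.sub_re, Complex.one_re]
  rcases le_total t 1 with ht1 | ht1
  · have := Real.rpow_le_rpow_of_exponent_ge ht0 ht1 (show a - 1 ≤ s.re - 1 by linarith)
    linarith [Real.rpow_nonneg ht0.le (b - 1)]
  · have := Real.rpow_le_rpow_of_exponent_le ht1 (show s.re - 1 ≤ b - 1 by linarith)
    linarith [Real.rpow_nonneg ht0.le (a - 1)]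

lemma even0_strip (x : UnitAddCircle) (a b : ℝ) :
    ∃ B, ∀ s : ℂ, a ≤ s.re → s.re ≤ b → ‖HurwitzZeta.completedHurwitzZetaEven₀ x s‖ ≤ B := by
  obtain ⟨B, hB⟩ := mellin_strip (HurwitzZeta.hurwitzEvenFEPair x).f_modif
    (fun s => ((HurwitzZeta.hurwitzEvenFEPair x).isStrongFEPair_toStrongFEPair.hasMellin s).1) (a/2) (b/2)
  refine ⟨B / 2, fun s h1 h2 => ?_⟩
  have := hB (s/2) (by simp; linarith) (by simp; linarith)
  rw [HurwitzZeta.completedHurwitzZetaEven₀, norm_div, WeakFEPair.Λ₀]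
  simp only [Complex.norm_ofNat]
  linarith

lemma odd_strip (x : UnitAddCircle) (a b : ℝ) :
    ∃ B, ∀ s : ℂ, a ≤ s.re → s.re ≤ b → ‖HurwitzZeta.completedHurwitzZetaOdd x s‖ ≤ B := by
  obtain ⟨B, hB⟩ := mellin_strip (HurwitzZeta.hurwitzOddFEPair x).f
    (fun s => ((HurwitzZeta.isStrong_hurwitzOddFEPair x).hasMellin s).1) ((a+1)/2) ((b+1)/2)
  refine ⟨B / 2, fun s h1 h2 => ?_⟩
  have := hB ((s+1)/2) (by simp; linarith) (by simp; linarith)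
  rw [HurwitzZeta.completedHurwitzZetaOdd, norm_div, (HurwitzZeta.isStrong_hurwitzOddFEPair x).Λ_eq]
  simp only [Complex.norm_ofNat]
  linarith

lemma sum_strip {ι : Type*} [Fintype ι] (c : ι → ℂ) (f : ι → ℂ → ℂ) (a b : ℝ)
    (h : ∀ i, ∃ B, ∀ s : ℂ, a ≤ s.re → s.re ≤ b → ‖f i s‖ ≤ B) :
    ∃ B, ∀ s : ℂ, a ≤ s.re → s.re ≤ b → ‖∑ i, c i * f i s‖ ≤ B := by
  choose B hB using h
  refine ⟨∑ i, ‖c i‖ * B i, fun s h1 h2 => (norm_sum_le _ _).trans (Finset.sum_le_sum fun i _ => ?_)⟩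
  rw [norm_mul]
  exact mul_le_mul_of_nonneg_left (hB i s h1 h2) (norm_nonneg _)

lemma L0_strip (q : ℕ) [NeZero q] (Φ : ZMod q → ℂ) (a b : ℝ) :
    ∃ B, ∀ s : ℂ, a ≤ s.re → s.re ≤ b → ‖ZMod.completedLFunction₀ Φ s‖ ≤ B := by
  obtain ⟨B1, h1⟩ := sum_strip Φ (fun j s => HurwitzZeta.completedHurwitzZetaEven₀ (ZMod.toAddCircle j) s) a b
    (fun j => even0_strip _ a b)
  obtain ⟨B2, h2⟩ := sum_strip Φ (fun j s => HurwitzZeta.completedHurwitzZetaOdd (ZMod.toAddCircle j) s) a b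
    (fun j => odd_strip _ a b)
  have hq : (1:ℝ) ≤ q := by exact_mod_cast NeZero.one_le
  refine ⟨(q:ℝ)^(-a) * (B1 + B2), fun s ha hb => ?_⟩
  have e1 := h1 s ha hb
  have e2 := h2 s ha hb
  rw [ZMod.completedLFunction₀, ← mul_add, norm_mul]
  refine mul_le_mul ?_ ((norm_add_le _ _).trans (add_le_add e1 e2)) (norm_nonneg _) (by positivity)
  rw [← Complex.ofReal_natCast, Complex.norm_cpow_eq_rpow_re_of_pos (by linarith)]
  exact Real.rpow_le_rpow_of_exponent_le hq (by simpa using ha)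
end

section
open MeasureTheory Set Filter Topology
open scoped ComplexConjugate
set_option linter.unusedSectionVars false
set_option linter.unusedSimpArgs false

noncomputable def Xi {q : ℕ} [NeZero q] (χ : DirichletCharacter ℂ q) (s : ℂ) : ℂ :=
  if q = 1 then s * (s - 1) * ZMod.completedLFunction₀ χ s + 1
  else ((q:ℝ):ℂ) ^ (((1/2:ℝ):ℂ) * s) * ZMod.completedLFunction₀ χ s

section
variable {q : ℕ} [NeZero q] {χ : DirichletCharacter ℂ q}

lemma Xi_diff : Differentiable ℂ (Xi χ) := by
  have h0 := ZMod.differentiable_completedLFunction₀ (N := q) χ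
  have hq : ((q:ℝ):ℂ) ≠ 0 := by exact_mod_cast NeZero.ne q
  unfold Xi
  by_cases h : q = 1
  · simp only [h, if_true]; fun_prop
  · simp only [h, if_false]
    refine Differentiable.mul ?_ h0
    intro s
    exact ((differentiableAt_id.const_mul _).const_cpow (Or.inl hq))

lemma Xi_eq_ne (hq : q ≠ 1) (hχ : χ ≠ 1) (s : ℂ) :
    Xi χ s = ((q:ℝ):ℂ) ^ (((1/2:ℝ):ℂ) * s) * χ.completedLFunction s := by
  rw [Xi, if_neg hq, DirichletCharacter.completedLFunction, ZMod.completedLFunction_eq,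
    χ.map_zero' hq, χ.sum_eq_zero_of_ne_one hχ]
  simp

lemma Xi_eq (hχ : q ≠ 1 → χ ≠ 1) (s : ℂ) (h0 : s ≠ 0) (h1 : s ≠ 1) :
    Xi χ s = (if q = 1 then s * (s - 1) else 1) *
      (((q:ℝ):ℂ) ^ (((1/2:ℝ):ℂ) * s) * χ.completedLFunction s) := by
  by_cases hq : q = 1
  · subst hq
    have hs1 : (1 - s) ≠ 0 := sub_ne_zero.2 (Ne.symm h1)
    rw [Xi, if_pos rfl, if_pos rfl, DirichletCharacter.completedLFunction, ZMod.completedLFunction_eq]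
    have e1 : χ (0 : ZMod 1) = 1 := by
      rw [Subsingleton.elim (0 : ZMod 1) 1, map_one]
    have e2 : ∑ j : ZMod 1, χ j = 1 := by
      rw [Fintype.sum_subsingleton _ (0 : ZMod 1), e1]
    rw [e1, e2]
    simp only [Nat.cast_one, Complex.ofReal_one, Complex.one_cpow, one_mul]
    field_simp
    ring
  · rw [Xi_eq_ne hq (hχ hq), if_neg hq, one_mul]

lemma prim_ne_one (hχ : χ.IsPrimitive) (hq : q ≠ 1) : χ ≠ 1 := by
  rintro rfl
  rw [DirichletCharacter.isPrimitive_def, DirichletCharacter.conductor_one] at hχ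
  exact hq hχ.symm

lemma completed_eq (s : ℂ) (hs : 0 < s.re) :
    χ.completedLFunction s = χ.LFunction s * χ.gammaFactor s ∧ χ.gammaFactor s ≠ 0 := by
  have h0 : s ≠ 0 := by rintro rfl; simp at hs
  have hg : χ.gammaFactor s ≠ 0 := by
    rcases χ.even_or_odd with h | h
    · rw [h.gammaFactor_def]; exact Complex.Gammaℝ_ne_zero_of_re_pos hs
    · rw [h.gammaFactor_def]; exact Complex.Gammaℝ_ne_zero_of_re_pos (by simp; linarith)
  refine ⟨?_, hg⟩
  rw [DirichletCharacter.LFunction_eq_completed_div_gammaFactor χ s (Or.inl h0)]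
  field_simp

lemma Gammaℝ_conj (s : ℂ) : Complex.Gammaℝ (conj s) = conj (Complex.Gammaℝ s) := by
  rw [Complex.Gammaℝ_def, Complex.Gammaℝ_def, map_mul, ← Complex.Gamma_conj]
  have h1 : conj (s / 2) = conj s / 2 := by simp [map_ofNat]
  have h2 : conj (-s / 2) = - conj s / 2 := by simp [map_ofNat]
  rw [h1, ← h2, Complex.cpow_conj _ _ (by rw [Complex.arg_ofReal_of_nonneg Real.pi_pos.le]; exact Real.pi_pos.ne)]
  simp

lemma gammaFactor_conj (s : ℂ) : χ⁻¹.gammaFactor (conj s) = conj (χ.gammaFactor s) := by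
  rcases χ.even_or_odd with h | h
  · have h' : χ⁻¹.Even := by
      simp only [DirichletCharacter.Even] at h ⊢
      rw [MulChar.inv_apply_eq_inv, h]; simp
    rw [h.gammaFactor_def, h'.gammaFactor_def, Gammaℝ_conj]
  · have h' : χ⁻¹.Odd := by
      simp only [DirichletCharacter.Odd] at h ⊢
      rw [MulChar.inv_apply_eq_inv, h]; simp
    rw [h.gammaFactor_def, h'.gammaFactor_def, ← Gammaℝ_conj]; simp

lemma L_conj (s : ℂ) (hs : 1 < s.re) : χ⁻¹.LFunction (conj s) = conj (χ.LFunction s) := by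
  rw [DirichletCharacter.LFunction_eq_LSeries _ (by simpa using hs), DirichletCharacter.LFunction_eq_LSeries _ hs]
  rw [LSeries, LSeries, Complex.conj_tsum]
  refine tsum_congr fun n => ?_
  rcases eq_or_ne n 0 with rfl | hn
  · simp
  · rw [LSeries.term_of_ne_zero hn, LSeries.term_of_ne_zero hn, map_div₀]
    congr 1
    · rw [MulChar.inv_apply_eq_inv]
      by_cases hu : IsUnit (n : ZMod q)
      · have h1 := DirichletCharacter.unit_norm_eq_one χ hu.unit
        rw [IsUnit.unit_spec] at h1
        rw [Ring.inverse_eq_inv', Complex.inv_eq_conj h1]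
      · rw [χ.map_nonunit hu]; simp
    · rw [Complex.cpow_conj _ _ (by rw [Complex.natCast_arg]; exact Real.pi_pos.ne)]
      simp

lemma cpow_conj_pos (s : ℂ) : conj (((q:ℝ):ℂ) ^ (((1/2:ℝ):ℂ) * s)) = ((q:ℝ):ℂ) ^ (((1/2:ℝ):ℂ) * conj s) := by
  have : (((1/2:ℝ):ℂ) * conj s) = conj (((1/2:ℝ):ℂ) * s) := by rw [map_mul, Complex.conj_ofReal]
  rw [this, Complex.cpow_conj _ _ (by rw [Complex.arg_ofReal_of_nonneg (by positivity)]; exact Real.pi_pos.ne)]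
  simp

lemma inv_ne_one_of (hχ : q ≠ 1 → χ ≠ 1) : q ≠ 1 → χ⁻¹ ≠ 1 := fun hq h => hχ hq (inv_eq_one.1 h)

lemma Xi_conj (hχ : q ≠ 1 → χ ≠ 1) (s : ℂ) : Xi χ⁻¹ (conj s) = conj (Xi χ s) := by
  have h1 : AnalyticOnNhd ℂ (fun s => conj (Xi χ (conj s))) univ := by
    intro s _
    refine Differentiable.analyticAt (fun w => ?_) s
    have := (Xi_diff (χ := χ) (conj w)).hasDerivAt.conj_conj
    simp only [Complex.conj_conj] at this
    exact this.differentiableAt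
  have h2 : AnalyticOnNhd ℂ (Xi χ⁻¹) univ := fun s _ => Xi_diff.analyticAt s
  have h3 := h2.eq_of_eventuallyEq h1 (z₀ := 2) (by
    have : {s : ℂ | 1 < s.re} ∈ 𝓝 (2:ℂ) := (isOpen_lt continuous_const Complex.continuous_re).mem_nhds (by simp)
    filter_upwards [this] with s hs
    have hs' : 1 < s.re := hs
    have a0 : s ≠ 0 := by rintro rfl; simp at hs'; linarith
    have a1 : s ≠ 1 := by rintro rfl; simp at hs'
    have b0 : conj s ≠ 0 := by simpa using a0
    have b1 : conj s ≠ 1 := by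
      intro h; apply a1; have := congrArg conj h; simpa using this
    have hs2 : 1 < (conj s).re := by simpa using hs'
    rw [Xi_eq (inv_ne_one_of hχ) s a0 a1, Xi_eq hχ (conj s) b0 b1, (completed_eq s (by linarith)).1,
      (completed_eq (conj s) (by linarith)).1, map_mul, map_mul, map_mul, cpow_conj_pos, ← L_conj _ hs2,
      ← gammaFactor_conj, Complex.conj_conj]
    congr 1
    split_ifs <;> simp)
  have := congrFun h3 (conj s)
  simpa using this

lemma Xi_fe (hχ : χ.IsPrimitive) (s : ℂ) : Xi χ (1 - s) = χ.rootNumber * Xi χ⁻¹ s := by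
  have hne := prim_ne_one hχ
  have h1 : AnalyticOnNhd ℂ (fun s => Xi χ (1 - s)) univ := fun s _ =>
    (Xi_diff.comp (by fun_prop : Differentiable ℂ fun w : ℂ => 1 - w)).analyticAt s
  have h2 : AnalyticOnNhd ℂ (fun s => χ.rootNumber * Xi χ⁻¹ s) univ := fun s _ =>
    (Xi_diff.const_mul _).analyticAt s
  have h3 := h1.eq_of_eventuallyEq h2 (z₀ := 2) (by
    have : {s : ℂ | 1 < s.re} ∈ 𝓝 (2:ℂ) := (isOpen_lt continuous_const Complex.continuous_re).mem_nhds (by simp)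
    filter_upwards [this] with s hs
    have hs' : 1 < s.re := hs
    have a0 : s ≠ 0 := by rintro rfl; simp at hs'; linarith
    have a1 : s ≠ 1 := by rintro rfl; simp at hs'
    have b0 : 1 - s ≠ 0 := sub_ne_zero.2 (Ne.symm a1)
    have b1 : 1 - s ≠ 1 := by simpa using a0
    have hq : ((q:ℝ):ℂ) ≠ 0 := by exact_mod_cast NeZero.ne q
    rw [Xi_eq hne _ b0 b1, Xi_eq (inv_ne_one_of hne) s a0 a1, hχ.completedLFunction_one_sub]
    have e : ((q:ℝ):ℂ) ^ (((1/2:ℝ):ℂ) * (1 - s)) * (q:ℂ) ^ (s - 1/2) = ((q:ℝ):ℂ) ^ (((1/2:ℝ):ℂ) * s) := by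
      have : (q:ℂ) = ((q:ℝ):ℂ) := by simp
      rw [this, ← Complex.cpow_add _ _ hq]
      congr 1; push_cast; ring
    have e2 : (if q = 1 then (1 - s) * (1 - s - 1) else 1) = (if q = 1 then s * (s - 1) else (1:ℂ)) := by
      split_ifs <;> ring
    rw [e2, ← e]; ring)
  exact congrFun h3 s

lemma Xi_ne_of_one_le (hχ : χ.IsPrimitive) (s : ℂ) (hs : 1 ≤ s.re) : Xi χ s ≠ 0 := by
  have hq : ((q:ℝ):ℂ) ≠ 0 := by exact_mod_cast NeZero.ne q
  have hqs : ((q:ℝ):ℂ) ^ (((1/2:ℝ):ℂ) * s) ≠ 0 := by simp [Complex.cpow_eq_zero_iff]; intro h; exact absurd h (NeZero.ne q)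
  have hc := completed_eq (χ := χ) s (by linarith)
  by_cases h1 : s = 1
  · by_cases hq1 : q = 1
    · rw [Xi, if_pos hq1, h1]; simp
    · rw [Xi_eq_ne hq1 (prim_ne_one hχ hq1), hc.1]
      exact mul_ne_zero hqs (mul_ne_zero
        (DirichletCharacter.LFunction_ne_zero_of_one_le_re χ (Or.inl (prim_ne_one hχ hq1)) hs) hc.2)
  · have h0 : s ≠ 0 := by rintro rfl; simp at hs; linarith
    rw [Xi_eq (prim_ne_one hχ) s h0 h1, hc.1]
    refine mul_ne_zero ?_ (mul_ne_zero hqs (mul_ne_zero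
        (DirichletCharacter.LFunction_ne_zero_of_one_le_re χ (Or.inr h1) hs) hc.2))
    split_ifs
    · exact mul_ne_zero h0 (sub_ne_zero.2 h1)
    · exact one_ne_zero

lemma Xi_sym (hχ : χ.IsPrimitive) (z : ℂ) : Xi χ (1 - conj z) = χ.rootNumber * conj (Xi χ z) := by
  rw [Xi_fe hχ, Xi_conj (prim_ne_one hχ)]

lemma root_ne (hχ : χ.IsPrimitive) : χ.rootNumber ≠ 0 := by
  intro h
  have := Xi_sym hχ (1 - conj 2)
  rw [h, zero_mul] at this
  simp only [map_sub, map_one, Complex.conj_conj, sub_sub_cancel] at this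
  exact Xi_ne_of_one_le hχ 2 (by norm_num) this

lemma Xi_zero_L (hχ : χ.IsPrimitive) (ρ : ℂ) (h : Xi χ ρ = 0) : 0 < ρ.re ∧ ρ.re < 1 ∧ χ.LFunction ρ = 0 := by
  have h1 : ρ.re < 1 := by
    by_contra h2
    exact Xi_ne_of_one_le hχ ρ (by linarith) h
  have h0 : 0 < ρ.re := by
    by_contra h2
    refine Xi_ne_of_one_le hχ (1 - conj ρ) (by simp; linarith) ?_
    rw [Xi_sym hχ, h]; simp
  refine ⟨h0, h1, ?_⟩
  have hqs : ((q:ℝ):ℂ) ^ (((1/2:ℝ):ℂ) * ρ) ≠ 0 := by simp [Complex.cpow_eq_zero_iff]; intro h; exact absurd h (NeZero.ne q)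
  have a0 : ρ ≠ 0 := by rintro rfl; simp at h0
  have a1 : ρ ≠ 1 := by rintro rfl; simp at h1
  rw [Xi_eq (prim_ne_one hχ) ρ a0 a1, (completed_eq ρ h0).1] at h
  have hE : (if q = 1 then ρ * (ρ - 1) else 1) ≠ 0 := by
    split_ifs
    · exact mul_ne_zero a0 (sub_ne_zero.2 a1)
    · exact one_ne_zero
  by_contra hL
  exact (mul_ne_zero hE (mul_ne_zero hqs (mul_ne_zero hL (completed_eq ρ h0).2))) h

end
end

section
open MeasureTheory Set Filter Topology
open scoped ComplexConjugate

set_option linter.unusedSectionVars false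
set_option linter.unusedSimpArgs false
section
variable {q : ℕ} [NeZero q] {χ : DirichletCharacter ℂ q}

lemma L_bdd (s : ℂ) (hs : 2 ≤ s.re) : ‖χ.LFunction s‖ ≤ ∑' n : ℕ, 1 / (n:ℝ) ^ 2 := by
  rw [DirichletCharacter.LFunction_eq_LSeries _ (by linarith), LSeries]
  have hsum : Summable (fun n : ℕ => 1 / (n:ℝ) ^ 2) := Real.summable_one_div_nat_pow.2 (by norm_num)
  refine tsum_of_norm_bounded hsum.hasSum fun n => ?_
  rcases eq_or_ne n 0 with rfl | hn
  · simp
  · rw [LSeries.term_of_ne_zero hn, norm_div, Complex.norm_natCast_cpow_of_pos (Nat.pos_of_ne_zero hn)]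
    have h1 : (1:ℝ) ≤ n := by exact_mod_cast Nat.one_le_iff_ne_zero.2 hn
    gcongr
    · exact DirichletCharacter.norm_le_one χ _
    · rw [← Real.rpow_natCast]
      exact Real.rpow_le_rpow_of_exponent_le h1 (by simpa using hs)

/-- parity exponent -/
noncomputable def kap (χ : DirichletCharacter ℂ q) : ℝ := by
  classical exact if χ.Even then 0 else 1

lemma kap_cases : kap χ = 0 ∨ kap χ = 1 := by
  unfold kap; split_ifs <;> simp

lemma gammaFactor_eq (s : ℂ) : χ.gammaFactor s = (Real.pi : ℂ) ^ (-(s + kap χ) / 2) * Complex.Gamma ((s + kap χ) / 2) := by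
  classical
  rw [← Complex.Gammaℝ_def, DirichletCharacter.gammaFactor, kap]
  split_ifs <;> simp

lemma GB_gammaFactor : GB χ.gammaFactor {s | 2 ≤ s.re} := by
  have h : χ.gammaFactor = fun s : ℂ => (Real.pi : ℂ) ^ (-(s + kap χ) / 2) * Complex.Gamma ((s + kap χ) / 2) := by
    ext s; exact gammaFactor_eq s
  have hk : 0 ≤ kap χ ∧ kap χ ≤ 1 := by rcases kap_cases (χ := χ) with h | h <;> rw [h] <;> norm_num
  rw [h]
  refine GB.mul (GB.of_bdd 1 fun s hs => ?_) (GB_Gamma _ hk.1 hk.2)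
  have hs' : 2 ≤ s.re := hs
  rw [Complex.norm_cpow_eq_rpow_re_of_pos Real.pi_pos]
  refine Real.rpow_le_one_of_one_le_of_nonpos (by linarith [Real.pi_gt_three]) ?_
  simp; linarith

lemma GB_E (S : Set ℂ) : GB (fun s => if q = 1 then s * (s - 1) else 1) S := by
  by_cases h : q = 1
  · simp only [h, if_true]; exact (GB.id.mul GB.sub_one).mono (subset_univ _)
  · simp only [h, if_false]; exact GB.of_bdd 1 (by simp)

lemma GB.congr {f g : ℂ → ℂ} {S : Set ℂ} (hf : GB f S) (h : ∀ z ∈ S, g z = f z) : GB g S := by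
  obtain ⟨C, hC, k⟩ := hf
  exact ⟨C, hC, fun z hz => by rw [h z hz]; exact k z hz⟩

lemma Xi_GB (hχ : χ.IsPrimitive) : GB (Xi χ) univ := by
  have hq0 : (0:ℝ) < q := by exact_mod_cast Nat.pos_of_ne_zero (NeZero.ne q)
  have hA : GB (Xi χ) {s | 2 ≤ s.re} := by
    refine ((GB_E (q := q) {s | 2 ≤ s.re}).mul ((GB_cpow q hq0 (1/2) _).mul
      ((GB.of_bdd (f := χ.LFunction) _ (fun s hs => L_bdd (χ := χ) s hs)).mul (GB_gammaFactor (χ := χ))))).congr fun s hs => ?_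
    have hs' : 2 ≤ s.re := hs
    rw [Xi_eq (prim_ne_one hχ) s (by rintro rfl; simp at hs' <;> linarith)
      (by rintro rfl; simp at hs' <;> linarith), (completed_eq s (by linarith)).1]
  have hB : GB (Xi χ) {s | -1 ≤ s.re ∧ s.re ≤ 2} := by
    obtain ⟨B, hB⟩ := L0_strip q χ (-1) 2
    have hL : GB (fun s => ZMod.completedLFunction₀ χ s) {s | -1 ≤ s.re ∧ s.re ≤ 2} := 
      GB.of_bdd B fun s hs => hB s hs.1 hs.2
    by_cases h : q = 1
    · refine (((GB.id.mul GB.sub_one).mono (subset_univ _)).mul hL).add_one.congr fun s _ => ?_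
      rw [Xi, if_pos h]
    · refine ((GB_cpow q hq0 (1/2) _).mul hL).congr fun s _ => ?_
      rw [Xi, if_neg h]
  have hC : GB (Xi χ) {s | s.re ≤ -1} := by
    obtain ⟨C, hC, k⟩ := hA
    have : GB (fun s => χ.rootNumber * conj (Xi χ (1 - conj s))) {s | s.re ≤ -1} := by
      refine (GB.of_bdd ‖χ.rootNumber‖ (fun _ _ => le_rfl)).mul ⟨C * 4 ^ (3/2:ℝ), by positivity, fun s hs => ?_⟩
      have hs' : s.re ≤ -1 := hs
      rw [Complex.norm_conj]
      refine (k _ (by simp; linarith)).trans (Real.exp_le_exp.2 ?_)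
      have h1 : ‖1 - conj s - 2‖ ≤ ‖s - 2‖ + 3 := by
        have e : 1 - conj s - 2 = - conj (s - 2) - 3 := by simp [map_ofNat]; ring
        rw [e]
        refine (norm_sub_le _ _).trans ?_
        simp only [norm_neg, Complex.norm_conj, Complex.norm_ofNat, le_refl]
      rw [mul_assoc, ← Real.mul_rpow (by norm_num) (by positivity)]
      gcongr
      linarith [norm_nonneg (s-2)]
    refine this.congr fun s _ => ?_
    have := Xi_sym hχ (1 - conj s)
    simpa using this
  refine ((hA.union hB).union hC).mono fun s _ => ?_
  simp only [mem_union, mem_ofPred_eq]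
  by_cases h1 : 2 ≤ s.re
  · exact Or.inl (Or.inl h1)
  · by_cases h2 : -1 ≤ s.re
    · exact Or.inl (Or.inr ⟨h2, by linarith⟩)
    · exact Or.inr (by linarith)

theorem Xi_XiLike (hχ : χ.IsPrimitive) : XiLike (Xi χ) where
  diff := Xi_diff
  growth := by
    obtain ⟨C, hC, h⟩ := Xi_GB hχ
    exact ⟨C, hC, fun z => h z (mem_univ z)⟩
  strip := fun z hz => ⟨(Xi_zero_L hχ z hz).1, (Xi_zero_L hχ z hz).2.1⟩
  sym := ⟨_, root_ne hχ, Xi_sym hχ⟩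

theorem Xi_logDeriv (hχ : χ.IsPrimitive) (s : ℂ) (hs : 1 < s.re) :
    logDeriv (Xi χ) s = ((Real.log (q / Real.pi) / 2 : ℝ) : ℂ) + Complex.digamma ((s + kap χ) / 2) / 2
      + logDeriv χ.LFunction s + (if q = 1 then 1 / s + 1 / (s - 1) else 0) := by
  have hq0 : (0:ℝ) < q := by exact_mod_cast Nat.pos_of_ne_zero (NeZero.ne q)
  have hqc : ((q:ℝ):ℂ) ≠ 0 := by exact_mod_cast hq0.ne'
  have hk : 0 ≤ kap χ ∧ kap χ ≤ 1 := by rcases kap_cases (χ := χ) with h | h <;> rw [h] <;> norm_num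
  have hpi : (Real.pi : ℂ) ≠ 0 := by exact_mod_cast Real.pi_ne_zero
  have a0 : s ≠ 0 := by rintro rfl; simp at hs; linarith
  have a1 : s ≠ 1 := by rintro rfl; simp at hs
  set E : ℂ → ℂ := fun s => if q = 1 then s * (s - 1) else 1 with hE
  set A : ℂ → ℂ := fun s => ((q:ℝ):ℂ) ^ (((1/2:ℝ):ℂ) * s) with hA
  set B : ℂ → ℂ := fun s => (Real.pi : ℂ) ^ (-(s + kap χ) / 2) with hB
  set G : ℂ → ℂ := fun s => Complex.Gamma ((s + kap χ) / 2) with hG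
  have hEq : Xi χ =ᶠ[𝓝 s] fun s => E s * (A s * (χ.LFunction s * (B s * G s))) := by
    have : {s : ℂ | 1 < s.re} ∈ 𝓝 s := (isOpen_lt continuous_const Complex.continuous_re).mem_nhds hs
    filter_upwards [this] with w hw
    have hw' : 1 < w.re := hw
    rw [Xi_eq (prim_ne_one hχ) w (by rintro rfl; simp at hw'; linarith)
      (by rintro rfl; simp at hw'), (completed_eq w (by linarith)).1, gammaFactor_eq]
  have hre : 0 < ((s + kap χ) / 2).re := by simp; linarith
  have hΓd : DifferentiableAt ℂ Complex.Gamma ((s + kap χ) / 2) := by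
    refine Complex.differentiableAt_Gamma _ fun m h => ?_
    rw [h] at hre; simp at hre
    have : (0:ℝ) ≤ m := by positivity
    linarith
  have hEd : DifferentiableAt ℂ E s := by
    simp only [hE]; split_ifs <;> fun_prop
  have hE0 : E s ≠ 0 := by
    simp only [hE]; split_ifs
    · exact mul_ne_zero a0 (sub_ne_zero.2 a1)
    · exact one_ne_zero
  have hAd : HasDerivAt A (A s * Complex.log ((q:ℝ):ℂ) * ((1/2:ℝ):ℂ)) s := by
    have := ((hasDerivAt_id s).const_mul ((1/2:ℝ):ℂ)).const_cpow (c := ((q:ℝ):ℂ)) (Or.inl hqc)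
    simpa [hA] using this
  have hA0 : A s ≠ 0 := by simp [hA, Complex.cpow_eq_zero_iff, hqc, NeZero.ne q]
  have hBd : HasDerivAt B (B s * Complex.log (Real.pi:ℂ) * (-(1/2))) s := by
    have h1 : HasDerivAt (fun s : ℂ => -(s + kap χ) / 2) (-(1/2)) s := by
      have := (((hasDerivAt_id s).add_const (kap χ : ℂ)).neg.div_const 2)
      exact this.congr_deriv (by ring)
    exact h1.const_cpow (Or.inl hpi)
  have hB0 : B s ≠ 0 := by simp [hB, Complex.cpow_eq_zero_iff, hpi]
  have hGd : HasDerivAt G (deriv Complex.Gamma ((s + kap χ) / 2) * (1/2)) s := by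
    have h1 : HasDerivAt (fun s : ℂ => (s + kap χ) / 2) (1/2) s := by
      exact (((hasDerivAt_id s).add_const (kap χ : ℂ)).div_const 2)
    exact hΓd.hasDerivAt.comp s h1
  have hG0 : G s ≠ 0 := Complex.Gamma_ne_zero_of_re_pos hre
  have hLd : DifferentiableAt ℂ χ.LFunction s := DirichletCharacter.differentiableAt_LFunction χ s (Or.inl a1)
  have hL0 : χ.LFunction s ≠ 0 := DirichletCharacter.LFunction_ne_zero_of_one_le_re χ (Or.inr a1) hs.le
  have e1 : logDeriv (Xi χ) s = logDeriv (fun s => E s * (A s * (χ.LFunction s * (B s * G s)))) s := by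
    rw [logDeriv_apply, logDeriv_apply, hEq.deriv_eq, hEq.self_of_nhds]
  have hAd' := hAd.differentiableAt
  have hBd' := hBd.differentiableAt
  have hGd' := hGd.differentiableAt
  rw [e1, logDeriv_mul s hE0 (by positivity) hEd (by fun_prop), logDeriv_mul s hA0 (by positivity) hAd' (by fun_prop),
    logDeriv_mul s hL0 (by positivity) hLd (by fun_prop), logDeriv_mul s hB0 hG0 hBd' hGd']
  have f1 : logDeriv E s = (if q = 1 then 1 / s + 1 / (s - 1) else 0) := by
    by_cases h : q = 1
    · simp only [hE, h, if_true]
      rw [logDeriv_mul (f := fun s : ℂ => s) (g := fun s : ℂ => s - 1) s a0 (sub_ne_zero.2 a1) (by fun_prop) (by fun_prop)]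
      simp [logDeriv_apply]
    · simp only [hE, h, if_false]; simp [logDeriv_apply]
  have f2 : logDeriv A s = Complex.log ((q:ℝ):ℂ) / 2 := by
    rw [logDeriv_apply, hAd.deriv]; field_simp; push_cast; ring
  have f3 : logDeriv B s = - Complex.log (Real.pi:ℂ) / 2 := by
    rw [logDeriv_apply, hBd.deriv]; field_simp
  have f4 : logDeriv G s = Complex.digamma ((s + kap χ) / 2) / 2 := by
    rw [logDeriv_apply, hGd.deriv, Complex.digamma, logDeriv_apply]; simp only [hG]; ring
  rw [f1, f2, f3, f4, Real.log_div hq0.ne' Real.pi_ne_zero]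
  push_cast [Complex.ofReal_log hq0.le, Complex.ofReal_log Real.pi_pos.le]
  ring
end
end

section
open MeasureTheory Set Filter Topology
open scoped ComplexConjugate
set_option linter.unusedSectionVars false
set_option linter.unusedSimpArgs false

noncomputable def gE (n : ℕ) (x : ℝ) : ℝ := Real.exp (-x) - (Ioc (0:ℝ) n).indicator (fun x => (1 - x / n) ^ n) x

lemma gE_nonneg (n : ℕ) (x : ℝ) : 0 ≤ gE n x := by
  unfold gE
  by_cases h : x ∈ Ioc (0:ℝ) n
  · rw [indicator_of_mem h]; linarith [Real.one_sub_div_pow_le_exp_neg h.2]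
  · rw [indicator_of_notMem h]; simp [Real.exp_nonneg]

lemma gE_int {s : ℂ} (hs : 0 < s.re) (n : ℕ) (hn : n ≠ 0) :
    IntegrableOn (fun x : ℝ => (gE n x : ℂ) * (x:ℂ) ^ (s - 1)) (Ioi 0) ∧
    ∫ x in Ioi (0:ℝ), (gE n x : ℂ) * (x:ℂ) ^ (s - 1) = Complex.Gamma s - Complex.GammaSeq s n := by
  have h1 : IntegrableOn (fun x : ℝ => (Real.exp (-x) : ℂ) * (x:ℂ) ^ (s - 1)) (Ioi 0) := 
    Complex.GammaIntegral_convergent hs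
  have h2' : IntegrableOn (fun x : ℝ => (((1 - x / n) ^ n : ℝ) : ℂ) * (x:ℂ) ^ (s - 1)) (Ioc 0 n) := by
    rw [← intervalIntegrable_iff_integrableOn_Ioc_of_le (by positivity : (0 : ℝ) ≤ n)]
    apply IntervalIntegrable.continuousOn_mul
    · refine intervalIntegral.intervalIntegrable_cpow' ?_
      simp; linarith
    · fun_prop
  have h2 : IntegrableOn (fun x : ℝ => (Ioc (0:ℝ) n).indicator (fun x => (((1 - x / n) ^ n : ℝ) : ℂ) * (x:ℂ) ^ (s - 1)) x) (Ioi 0) := by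
    exact ((integrable_indicator_iff measurableSet_Ioc).2 h2').integrableOn
  have he : (fun x : ℝ => (gE n x : ℂ) * (x:ℂ) ^ (s - 1)) = fun x : ℝ => (Real.exp (-x) : ℂ) * (x:ℂ) ^ (s - 1)
     - (Ioc (0:ℝ) n).indicator (fun x => (((1 - x / n) ^ n : ℝ) : ℂ) * (x:ℂ) ^ (s - 1)) x := by
    ext x
    unfold gE
    by_cases h : x ∈ Ioc (0:ℝ) n
    · rw [indicator_of_mem h, indicator_of_mem h]; push_cast; ring
    · rw [indicator_of_notMem h, indicator_of_notMem h]; push_cast; ring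
  rw [he]
  refine ⟨h1.sub h2, ?_⟩
  rw [integral_sub h1 h2, Complex.GammaSeq_eq_approx_Gamma_integral hs hn, Complex.Gamma_eq_integral hs, Complex.GammaIntegral,
    intervalIntegral.integral_of_le (by positivity), setIntegral_indicator measurableSet_Ioc,
    inter_eq_self_of_subset_right Ioc_subset_Ioi_self]

lemma gamma_diff_le {s : ℂ} {a b : ℝ} (ha : 0 < a) (h1 : a ≤ s.re) (h2 : s.re ≤ b) (n : ℕ) (hn : n ≠ 0) :
    ‖Complex.Gamma s - Complex.GammaSeq s n‖ ≤ ‖Complex.Gamma a - Complex.GammaSeq a n‖ + ‖Complex.Gamma b - Complex.GammaSeq b n‖ := by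
  have key : ∀ c : ℝ, 0 < c → IntegrableOn (fun x : ℝ => gE n x * x ^ (c - 1)) (Ioi 0) ∧
      ∫ x in Ioi (0:ℝ), gE n x * x ^ (c - 1) ≤ ‖Complex.Gamma c - Complex.GammaSeq c n‖ := by
    intro c hc
    obtain ⟨i1, i2⟩ := gE_int (s := c) (by simpa using hc) n hn
    have e : EqOn (fun x : ℝ => (gE n x : ℂ) * (x:ℂ) ^ ((c:ℂ) - 1)) (fun x : ℝ => ((gE n x * x ^ (c - 1) : ℝ) : ℂ)) (Ioi 0) := by
      intro x hx
      have hx : 0 < x := hx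
      simp only
      rw [Complex.ofReal_mul, Complex.ofReal_cpow hx.le]; simp
    rw [integrableOn_congr_fun e measurableSet_Ioi] at i1
    rw [setIntegral_congr_fun measurableSet_Ioi e, integral_complex_ofReal] at i2
    refine ⟨by unfold IntegrableOn; simpa using i1.re, ?_⟩
    rw [← i2, Complex.norm_real]; exact le_abs_self _
  obtain ⟨ia, ja⟩ := key a ha
  obtain ⟨ib, jb⟩ := key b (by linarith)
  rw [← (gE_int (s := s) (by linarith) n hn).2]
  refine (norm_integral_le_of_norm_le (ia.add ib) ?_).trans ?_
  · refine (ae_restrict_iff' measurableSet_Ioi).2 (ae_of_all _ fun x hx => ?_)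
    have hx : 0 < x := hx
    simp only [Pi.add_apply]
    rw [norm_mul, Complex.norm_real, Real.norm_of_nonneg (gE_nonneg n x), Complex.norm_cpow_eq_rpow_re_of_pos hx, ← mul_add]
    refine mul_le_mul_of_nonneg_left ?_ (gE_nonneg n x)
    have pa : 0 ≤ x ^ (a-1) := by positivity
    have pb : 0 ≤ x ^ (b-1) := by positivity
    rcases le_total x 1 with h | h
    · have := Real.rpow_le_rpow_of_exponent_ge hx h (show a - 1 ≤ (s-1).re by simpa using h1); linarith
    · have := Real.rpow_le_rpow_of_exponent_le h (show (s-1).re ≤ b - 1 by simpa using h2); linarith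
  · simp only [Pi.add_apply]
    rw [integral_add ia ib]; linarith

lemma gammaSeq_lu : TendstoLocallyUniformlyOn (fun n s => Complex.GammaSeq s n) Complex.Gamma atTop {s | 0 < s.re} := by
  rw [Metric.tendstoLocallyUniformlyOn_iff]
  intro ε hε s hs
  have hs : 0 < s.re := hs
  refine ⟨{w | s.re / 2 < w.re ∧ w.re < s.re + 1}, mem_nhdsWithin_of_mem_nhds ?_, ?_⟩
  · refine (IsOpen.inter (isOpen_lt continuous_const Complex.continuous_re) (isOpen_lt Complex.continuous_re continuous_const)).mem_nhds ⟨?_, ?_⟩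
    · show s.re / 2 < s.re; linarith
    · show s.re < s.re + 1; linarith
  · have t1 : ∀ c : ℝ, Tendsto (fun n => ‖Complex.Gamma c - Complex.GammaSeq c n‖) atTop (𝓝 0) := by
      intro c
      have := (tendsto_const_nhds (x := Complex.Gamma c)).sub (Complex.GammaSeq_tendsto_Gamma c)
      simpa using this.norm
    have t2 := (t1 (s.re/2)).add (t1 (s.re+1))
    rw [add_zero] at t2
    filter_upwards [t2.eventually_lt_const hε, eventually_ne_atTop 0] with n hn hn0 w hw
    rw [dist_eq_norm]
    exact (gamma_diff_le (by linarith) hw.1.le hw.2.le n hn0).trans_lt hn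

theorem digamma_lim {s : ℂ} (hs : 0 < s.re) :
    Tendsto (fun n : ℕ => (Real.log n : ℂ) - ∑ j ∈ Finset.range (n+1), 1 / (s + j)) atTop (𝓝 (Complex.digamma s)) := by
  have ho : IsOpen {s : ℂ | 0 < s.re} := isOpen_lt continuous_const Complex.continuous_re
  have hne : ∀ w : ℂ, 0 < w.re → ∀ j : ℕ, w + j ≠ 0 := by
    intro w hw j h
    have := congrArg Complex.re h
    simp at this
    have : (0:ℝ) ≤ j := by positivity
    linarith
  have hd : ∀ n : ℕ, n ≠ 0 → ∀ w : ℂ, 0 < w.re → DifferentiableAt ℂ (fun s => Complex.GammaSeq s n) w := by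
    intro n hn w hw
    unfold Complex.GammaSeq
    have hn' : (n:ℂ) ≠ 0 := by exact_mod_cast hn
    refine DifferentiableAt.div ?_ (by fun_prop) (Finset.prod_ne_zero_iff.2 fun j _ => hne w hw j)
    exact (DifferentiableAt.const_cpow (by fun_prop) (Or.inl hn')).mul_const _
  have := Complex.logDeriv_tendsto (x := s) ho hs gammaSeq_lu (by
    filter_upwards [eventually_ne_atTop 0] with n hn w hw
    exact (hd n hn w hw).differentiableWithinAt) (Complex.Gamma_ne_zero_of_re_pos hs)
  refine this.congr' ?_
  filter_upwards [eventually_ne_atTop 0] with n hn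
  have hn' : (n:ℂ) ≠ 0 := by exact_mod_cast hn
  have hf : ((n.factorial : ℕ) : ℂ) ≠ 0 := by exact_mod_cast n.factorial_ne_zero
  unfold Complex.GammaSeq
  have hcp : HasDerivAt (fun s : ℂ => (n:ℂ) ^ s) ((n:ℂ)^s * Complex.log n * 1) s := 
    (hasDerivAt_id s).const_cpow (Or.inl hn')
  have hc0 : (n:ℂ)^s ≠ 0 := by simp [Complex.cpow_eq_zero_iff, hn']
  rw [logDeriv_div (f := fun s : ℂ => (n:ℂ)^s * (n.factorial:ℂ)) (g := fun s : ℂ => ∏ j ∈ Finset.range (n + 1), (s + j)) s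
    (mul_ne_zero hc0 hf) (Finset.prod_ne_zero_iff.2 fun j _ => hne s hs j)
    (hcp.differentiableAt.mul_const _) (by fun_prop), logDeriv_mul_const _ _ hf]
  congr 1
  · rw [logDeriv_apply, hcp.deriv, mul_one, mul_div_cancel_left₀ _ hc0]; simp
  · rw [logDeriv_prod (fun j _ => hne s hs j) (fun j _ => by fun_prop)]
    refine Finset.sum_congr rfl fun j _ => ?_
    simp [logDeriv_apply]

lemma norm_add_nat_ge {s : ℂ} (hs : 0 < s.re) (j : ℕ) : min s.re 1 * (j + 1) ≤ ‖s + j‖ := by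
  refine le_trans ?_ (Complex.re_le_norm _)
  simp only [Complex.add_re, Complex.natCast_re]
  have hj : (0:ℝ) ≤ j := by positivity
  nlinarith [min_le_left s.re 1, min_le_right s.re 1]

lemma add_nat_ne {s : ℂ} (hs : 0 < s.re) (j : ℕ) : s + j ≠ 0 := by
  have h1 : 0 < min s.re 1 := lt_min hs one_pos
  have := norm_add_nat_ge hs j
  have h2 : 0 < min s.re 1 * ((j:ℝ) + 1) := by positivity
  exact norm_pos_iff.1 (h2.trans_le this)

lemma digamma_summable {s w : ℂ} (hs : 0 < s.re) (hw : 0 < w.re) :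
    Summable (fun j : ℕ => 1 / (w + j) - 1 / (s + j)) := by
  have h1 : 0 < min s.re 1 := lt_min hs one_pos
  have h2 : 0 < min w.re 1 := lt_min hw one_pos
  have : Summable (fun j : ℕ => (‖s - w‖ / (min s.re 1 * min w.re 1)) * (1 / ((j:ℝ) + 1) ^ 2)) := by
    refine Summable.mul_left _ ?_
    have := (summable_nat_add_iff 1).2 (Real.summable_one_div_nat_pow.2 (by norm_num : 1 < 2))
    simpa using this
  refine Summable.of_norm_bounded this fun j => ?_
  have e : 1 / (w + j) - 1 / (s + j) = (s - w) / ((s + j) * (w + j)) := by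
    field_simp [add_nat_ne hs j, add_nat_ne hw j]; ring
  rw [e, norm_div, norm_mul]
  have a1 := norm_add_nat_ge hs j
  have a2 := norm_add_nat_ge hw j
  calc _ ≤ ‖s - w‖ / ((min s.re 1 * (j+1)) * (min w.re 1 * (j+1))) := by gcongr
    _ = _ := by field_simp

theorem digamma_hasSum {s w : ℂ} (hs : 0 < s.re) (hw : 0 < w.re) :
    HasSum (fun j : ℕ => 1 / (w + j) - 1 / (s + j)) (Complex.digamma s - Complex.digamma w) := by
  refine (digamma_summable hs hw).hasSum_iff_tendsto_nat.2 ?_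
  rw [← tendsto_add_atTop_iff_nat 1]
  refine ((digamma_lim hs).sub (digamma_lim hw)).congr fun n => ?_
  rw [Finset.sum_sub_distrib]; ring

lemma re_inv_add (x y : ℝ) (j : ℕ) : (1 / ((x:ℂ) + y * Complex.I + j)).re = (x + j) / ((x+j)^2 + y^2) := by
  rw [one_div, Complex.inv_re]
  simp [Complex.normSq_apply]
  ring_nf

theorem digamma_re_mono {x y y' : ℝ} (hx : 0 < x) (h : |y| ≤ |y'|) :
    (Complex.digamma (x + y * Complex.I)).re ≤ (Complex.digamma (x + y' * Complex.I)).re := by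
  have h1 := digamma_hasSum (s := x + y' * Complex.I) (w := x + y * Complex.I) (by simpa) (by simpa)
  have h2 := Complex.hasSum_re h1
  have := h2.nonneg fun j => ?_
  · simpa using this
  · rw [Complex.sub_re, re_inv_add, re_inv_add]
    have : y^2 ≤ y'^2 := sq_le_sq.2 h
    have hp : 0 < x + j := by positivity
    rw [sub_nonneg]
    gcongr

theorem digamma_re_le {x y : ℝ} (hx : 1 ≤ x) (hy : 0 < y) :
    (Complex.digamma (x + y * Complex.I)).re ≤ Real.log (x^2 + y^2) / 2 + 1 / y := by
  have h0 := (Complex.continuous_re.tendsto _).comp (digamma_lim (s := x + y * Complex.I) (by simp; linarith))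
  -- comparison
  have key : ∀ n : ℕ, Real.log ((x + n)^2 + y^2) / 2 - Real.log (x^2+y^2) / 2 ≤
      ∑ j ∈ Finset.range n, (x + j) / ((x+j)^2 + y^2) + (1 / y - 1 / (y + n)) := by
    intro n
    induction n with
    | zero => simp
    | succ n ih =>
      rw [Finset.sum_range_succ]
      push_cast
      have hn : (0:ℝ) ≤ n := by positivity
      set u : ℝ := x + n with hu
      have hu1 : 1 ≤ u := by linarith
      have hD : 0 < u^2 + y^2 := by positivity
      have e1 : Real.log ((x + (n+1))^2 + y^2) ≤ Real.log (u^2+y^2) + (2*u+1)/(u^2+y^2) := by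
        have : (x + ((n:ℝ)+1))^2 + y^2 = (u^2+y^2) * (1 + (2*u+1)/(u^2+y^2)) := by
          field_simp; rw [hu]; ring
        rw [this, Real.log_mul hD.ne' (by positivity)]
        have := Real.log_le_sub_one_of_pos (show 0 < 1 + (2*u+1)/(u^2+y^2) by positivity)
        linarith
      have e2 : 1 / (2*(u^2+y^2)) ≤ 1 / (y + n) - 1 / (y + (n+1)) := by
        rw [div_sub_div _ _ (by positivity) (by positivity), div_le_div_iff₀ (by positivity) (by positivity)]
        have hun : (n:ℝ) + 1 ≤ u := by linarith
        nlinarith [sq_nonneg (u - y), mul_pos hy hy]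
      have e3 : (2*u+1)/(u^2+y^2) / 2 = u / (u^2+y^2) + 1 / (2*(u^2+y^2)) := by field_simp
      linarith
  have hlim : Tendsto (fun n : ℕ => Real.log n - Real.log ((x + (n+1:ℕ))^2+y^2)/2) atTop (𝓝 0) := by
    have t : Tendsto (fun n : ℕ => (1 + (x+1) / n)^2 + (y/n)^2) atTop (𝓝 ((1 + 0)^2 + 0^2)) := by
      refine Tendsto.add (Tendsto.pow (tendsto_const_nhds.add ?_) 2) (Tendsto.pow ?_ 2)
      · exact tendsto_const_div_atTop_nhds_zero_nat _
      · exact tendsto_const_div_atTop_nhds_zero_nat _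
    have t2 := ((Real.continuousAt_log (by norm_num)).tendsto.comp t).div_const (-2)
    simp at t2
    refine t2.congr' ?_
    filter_upwards [eventually_gt_atTop 0] with n hn
    have hn' : (0:ℝ) < n := by exact_mod_cast hn
    have : (x + (n+1:ℕ))^2+y^2 = (n:ℝ)^2 * ((1 + (x+1) / n)^2 + (y/n)^2) := by
      push_cast; field_simp; ring
    rw [this, Real.log_mul (by positivity) (by positivity), Real.log_pow]
    simp; ring
  have h1 := hlim.add_const (Real.log (x^2+y^2)/2 + 1/y)
  rw [zero_add] at h1
  refine le_of_tendsto_of_tendsto' h0 h1 fun n => ?_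
  simp only [Function.comp, Complex.sub_re, Complex.ofReal_re, Complex.re_sum, re_inv_add]
  have := key (n+1)
  have h3 : 0 ≤ 1 / (y + (n+1:ℕ)) := by positivity
  linarith

/-- `∑ Λ(n)/n²` bound -/
lemma log_sum_bound (N : ℕ) : ∑ n ∈ Finset.range N, Real.log ((n:ℝ)+4) / ((n:ℝ)+4)^2 ≤ (1 + Real.log 3) / 3 - (1 + Real.log (N+3)) / (N+3) := by
  induction N with
  | zero => simp
  | succ N ih =>
    rw [Finset.sum_range_succ]
    refine (add_le_add_left ih _).trans ?_
    push_cast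
    have hN : (0:ℝ) ≤ N := by positivity
    set m : ℝ := N + 3 with hm
    have hm3 : 3 ≤ m := by linarith
    have hlm : 1 ≤ Real.log m := by
      rw [Real.le_log_iff_exp_le (by linarith)]
      exact Real.exp_one_lt_d9.le.trans (by linarith)
    have e : (N:ℝ) + 4 = m + 1 := by rw [hm]; ring
    have e' : (N:ℝ) + 1 + 3 = m + 1 := by rw [hm]; ring
    rw [e, e']
    have hl : Real.log (m+1) ≤ Real.log m + 1 / m := by
      have : m + 1 = m * (1 + 1/m) := by field_simp
      rw [this, Real.log_mul (by positivity) (by positivity)]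
      have := Real.log_le_sub_one_of_pos (show 0 < 1 + 1/m by positivity)
      linarith
    have h1 : Real.log (m+1) / (m+1)^2 + (1 + Real.log (m+1)) / (m+1) ≤ (1 + Real.log m) / m := by
      calc _ ≤ (Real.log m + 1 / m) / (m+1)^2 + (1 + (Real.log m + 1 / m)) / (m+1) := by gcongr
        _ ≤ _ := by
          rw [div_add_div _ _ (by positivity) (by positivity), div_le_div_iff₀ (by positivity) (by positivity)]
          field_simp
          nlinarith [mul_nonneg (sub_nonneg.2 hlm) (show 0 ≤ (m+1) by positivity)]
    linarith
end

section
open MeasureTheory Set Filter Topology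
open scoped ComplexConjugate
set_option linter.unusedSectionVars false
set_option linter.unusedSimpArgs false

lemma logsq_partial (N : ℕ) : ∑ n ∈ Finset.range N, Real.log n / (n:ℝ)^2 ≤ 0.9953 := by
  have hnn : ∀ n : ℕ, 0 ≤ Real.log n / (n:ℝ)^2 := fun n => by
    have := Real.log_natCast_nonneg n; positivity
  have h1 : ∑ n ∈ Finset.range N, Real.log n / (n:ℝ)^2 ≤
      ∑ n ∈ Finset.range (N+4), Real.log n / (n:ℝ)^2 :=
    Finset.sum_le_sum_of_subset_of_nonneg (Finset.range_mono (by omega)) fun n _ _ => hnn n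
  refine h1.trans ?_
  rw [Finset.sum_range_succ', Finset.sum_range_succ', Finset.sum_range_succ', Finset.sum_range_succ']
  have h2 : ∑ n ∈ Finset.range N, Real.log ((n+1+1+1+1:ℕ):ℝ) / ((n+1+1+1+1:ℕ):ℝ)^2 =
      ∑ n ∈ Finset.range N, Real.log ((n:ℝ)+4) / ((n:ℝ)+4)^2 := by
    refine Finset.sum_congr rfl fun n _ => ?_
    push_cast
    have e : (n:ℝ)+1+1+1+1 = n + 4 := by ring
    rw [e]
  rw [h2]
  have h3 := log_sum_bound N
  have h4 : 0 ≤ (1 + Real.log (N+3)) / ((N:ℝ)+3) := by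
    have : 0 ≤ Real.log ((N:ℝ)+3) := Real.log_nonneg (by linarith [(Nat.cast_nonneg N : (0:ℝ) ≤ N)])
    positivity
  have h5 := abs_le.1 Real.log_three_near_10
  have h8 := Real.log_two_lt_d9
  norm_num at h5 h8 ⊢
  linarith

section
variable {q : ℕ} [NeZero q] {χ : DirichletCharacter ℂ q}

open ArithmeticFunction in
lemma lam_summable : Summable (fun n : ℕ => ArithmeticFunction.vonMangoldt n / (n:ℝ)^2) ∧
    ∑' n : ℕ, ArithmeticFunction.vonMangoldt n / (n:ℝ)^2 ≤ 0.61 := by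
  have hlog : Summable (fun n : ℕ => Real.log n / (n:ℝ)^2) ∧ ∑' n : ℕ, Real.log n / (n:ℝ)^2 ≤ 0.9953 := by
    have hnn : ∀ n : ℕ, 0 ≤ Real.log n / (n:ℝ)^2 := fun n => by
      have := Real.log_natCast_nonneg n; positivity
    exact ⟨summable_of_sum_range_le hnn logsq_partial, Real.tsum_le_of_sum_range_le hnn logsq_partial⟩
  have hs : Summable (fun n : ℕ => ArithmeticFunction.vonMangoldt n / (n:ℝ)^2) := by
    refine Summable.of_nonneg_of_le (fun n => ?_) (fun n => ?_) hlog.1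
    · have := @ArithmeticFunction.vonMangoldt_nonneg n; positivity
    · have := @ArithmeticFunction.vonMangoldt_le_log n; gcongr
  refine ⟨hs, ?_⟩
  have hcast : ∀ a : ℕ → ℝ, a 0 = 0 → LSeries (fun n => (a n : ℂ)) 2 = ((∑' n : ℕ, a n / (n:ℝ)^2 : ℝ) : ℂ) := by
    intro a ha
    rw [LSeries, Complex.ofReal_tsum]
    refine tsum_congr fun n => ?_
    rcases eq_or_ne n 0 with rfl | hn
    · simp [ha]
    · rw [LSeries.term_of_ne_zero hn]; push_cast
      congr 1
      exact_mod_cast Complex.cpow_natCast (n:ℂ) 2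
  have h2 : (1:ℝ) < (2:ℂ).re := by norm_num
  have hc := LSeries_convolution' (s := 2) (LSeriesSummable_vonMangoldt h2)
    (LSeriesSummable_zeta_iff.mpr h2)
  rw [convolution_vonMangoldt_zeta, LSeries_zeta_eq_riemannZeta h2, riemannZeta_two, hcast _ (by simp)] at hc
  have hl : LSeries (fun n => Complex.log n) 2 = ((∑' n : ℕ, Real.log n / (n:ℝ)^2 : ℝ) : ℂ) := by
    rw [← hcast _ (by simp)]
    congr 1; ext n; simp
  rw [hl] at hc
  have hr : ∑' n : ℕ, Real.log n / (n:ℝ)^2 = (∑' n : ℕ, ArithmeticFunction.vonMangoldt n / (n:ℝ)^2) * (Real.pi^2/6) := by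
    exact_mod_cast hc
  have hp : 1.6448 ≤ Real.pi^2/6 := by nlinarith [Real.pi_gt_d4]
  have hn : 0 ≤ ∑' n : ℕ, ArithmeticFunction.vonMangoldt n / (n:ℝ)^2 := tsum_nonneg fun n => by
    have := @ArithmeticFunction.vonMangoldt_nonneg n; positivity
  nlinarith [hlog.2]

theorem neg_logDeriv_L (s : ℂ) (hs : 1 < s.re) :
    HasSum (fun n : ℕ => (ArithmeticFunction.vonMangoldt n : ℂ) * χ (n : ZMod q) * (n:ℂ) ^ (-s)) (- logDeriv χ.LFunction s) := by
  have h1 := (DirichletCharacter.LSeriesSummable_twist_vonMangoldt χ hs).LSeriesHasSum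
  rw [LSeriesHasSum, DirichletCharacter.LSeries_twist_vonMangoldt_eq χ hs, ← DirichletCharacter.deriv_LFunction_eq_deriv_LSeries χ hs,
    ← DirichletCharacter.LFunction_eq_LSeries χ hs, neg_div, ← logDeriv_apply] at h1
  convert h1 using 2 with n
  rcases eq_or_ne n 0 with rfl | hn
  · simp
  · rw [LSeries.term_of_ne_zero hn, Complex.cpow_neg, ← div_eq_mul_inv]
    simp [mul_comm]

lemma L_term_norm (s : ℂ) (hs : 2 ≤ s.re) (n : ℕ) :
    ‖(ArithmeticFunction.vonMangoldt n : ℂ) * χ (n : ZMod q) * (n:ℂ) ^ (-s)‖ ≤ ArithmeticFunction.vonMangoldt n / (n:ℝ)^2 := by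
  rcases eq_or_ne n 0 with rfl | hn
  · simp
  rw [norm_mul, norm_mul, Complex.norm_real, Real.norm_of_nonneg ArithmeticFunction.vonMangoldt_nonneg,
    Complex.norm_natCast_cpow_of_pos (Nat.pos_of_ne_zero hn)]
  have h1 : (1:ℝ) ≤ n := by exact_mod_cast Nat.one_le_iff_ne_zero.2 hn
  have h2 : (n:ℝ) ^ (-s).re ≤ ((n:ℝ)^2)⁻¹ := by
    rw [← Real.rpow_natCast, ← Real.rpow_neg (by positivity)]
    exact Real.rpow_le_rpow_of_exponent_le h1 (by simpa using hs)
  have h3 := DirichletCharacter.norm_le_one χ (n : ZMod q)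
  have h4 := @ArithmeticFunction.vonMangoldt_nonneg n
  rw [div_eq_mul_inv]
  calc _ ≤ ArithmeticFunction.vonMangoldt n * 1 * ((n:ℝ)^2)⁻¹ := by gcongr
    _ = _ := by ring

theorem L_logDeriv_le (s : ℂ) (hs : 2 ≤ s.re) : ‖logDeriv χ.LFunction s‖ ≤ 0.61 := by
  rw [← norm_neg, ← (neg_logDeriv_L s (by linarith)).tsum_eq]
  exact (tsum_of_norm_bounded lam_summable.1.hasSum (L_term_norm s hs)).trans lam_summable.2

theorem W_le (hχ : χ.IsPrimitive) {t y : ℝ} (hy : 0 < y) (hty : |t| ≤ y) :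
    (logDeriv (Xi χ) (2 + t * Complex.I)).re ≤ Real.log (q / Real.pi) / 2 + Real.log (9/4 + y^2/4) / 4 + 1 / y + 0.61
      + (2 / (4 + t^2) + 1 / (1 + t^2)) := by
  have hk : 0 ≤ kap χ ∧ kap χ ≤ 1 := by rcases kap_cases (χ := χ) with h | h <;> rw [h] <;> norm_num
  rw [Xi_logDeriv hχ _ (by simp)]
  have e : ((2 + t * Complex.I + kap χ) / 2 : ℂ) = ((1 + kap χ / 2 : ℝ) : ℂ) + ((t/2 : ℝ) : ℂ) * Complex.I := by
    push_cast; ring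
  have h1 := digamma_re_mono (x := 1 + kap χ / 2) (y := t/2) (y' := y/2) (by linarith) (by
    rw [abs_div, abs_div, abs_of_pos hy]; gcongr)
  have h2 := digamma_re_le (x := 1 + kap χ / 2) (y := y/2) (by linarith) (by linarith)
  have h3 : Real.log ((1 + kap χ / 2)^2 + (y/2)^2) ≤ Real.log (9/4 + y^2/4) := by
    refine Real.log_le_log (by positivity) ?_
    nlinarith
  have h4 := (Complex.re_le_norm _).trans (L_logDeriv_le (χ := χ) (2 + t * Complex.I) (by simp))
  have h5 : (if q = 1 then 1 / (2 + t * Complex.I) + 1 / (2 + t * Complex.I - 1) else 0 : ℂ).re ≤ 2 / (4 + t^2) + 1 / (1 + t^2) := by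
    split_ifs
    · have a1 : (1 / (2 + t * Complex.I)).re = 2 / (4 + t^2) := by
        rw [one_div, Complex.inv_re]; simp [Complex.normSq_apply]; ring_nf
      have a2 : (1 / (2 + t * Complex.I - 1)).re = 1 / (1 + t^2) := by
        rw [one_div, Complex.inv_re]; simp [Complex.normSq_apply]; ring_nf
      rw [Complex.add_re, a1, a2]
    · simp; positivity
  rw [e]
  simp only [Complex.add_re, Complex.ofReal_re] at h5 ⊢
  have e6 : ∀ z : ℂ, (z / 2).re = z.re / 2 := fun z => by simp
  rw [e6]
  have e7 : 1 / (y/2) = 2 * (1/y) := by field_simp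
  rw [e7] at h2
  linarith

theorem W_le_clamp (hχ : χ.IsPrimitive) {t T : ℝ} (hT : 100 ≤ T) (ht : |t| ≤ T) :
    (logDeriv (Xi χ) (2 + t * Complex.I)).re ≤ Real.log (q * T) / 2 + 1 := by
  have hq0 : (0:ℝ) < q := by exact_mod_cast Nat.pos_of_ne_zero (NeZero.ne q)
  have hpi := Real.pi_gt_three
  have hl3 := abs_le.1 Real.log_three_near_10
  have hl2 := Real.log_two_gt_d9
  have hl2' := Real.log_two_lt_d9
  have hlp : 1.098 ≤ Real.log Real.pi := by
    have := Real.log_le_log (by norm_num) hpi.le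
    linarith
  rw [Real.log_mul hq0.ne' (by linarith)]
  by_cases h : |t| ≤ 4
  · have := W_le hχ (t := t) (y := 4) (by norm_num) h
    rw [Real.log_div hq0.ne' Real.pi_ne_zero] at this
    have h2 : 2 / (4 + t^2) ≤ 1/2 := by
      rw [div_le_div_iff₀ (by positivity) (by norm_num)]; nlinarith [sq_nonneg t]
    have h2' : 1 / (1 + t^2) ≤ 1 := by
      rw [div_le_iff₀ (by positivity)]; nlinarith [sq_nonneg t]
    have h3 : Real.log (9/4 + 4^2/4) ≤ Real.log 8 := Real.log_le_log (by norm_num) (by norm_num)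
    have h3' : Real.log 8 = 3 * Real.log 2 := by
      rw [show (8:ℝ) = 2^3 by norm_num, Real.log_pow]; norm_num
    have h4 : Real.log 64 ≤ Real.log T := Real.log_le_log (by norm_num) (by linarith)
    have h4' : Real.log 64 = 6 * Real.log 2 := by
      rw [show (64:ℝ) = 2^6 by norm_num, Real.log_pow]; norm_num
    linarith
  · push Not at h
    have := W_le hχ (t := t) (y := T) (by linarith) ht
    rw [Real.log_div hq0.ne' Real.pi_ne_zero] at this
    have h4 : 4^2 ≤ t^2 := by rw [← sq_abs t]; gcongr
    have h2 : 2 / (4 + t^2) ≤ 2/20 := by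
      gcongr; linarith
    have h2' : 1 / (1 + t^2) ≤ 1/17 := by
      gcongr; linarith
    have h3 : Real.log (9/4 + T^2/4) ≤ Real.log (T^2/3) := Real.log_le_log (by positivity) (by nlinarith)
    rw [Real.log_div (by positivity) (by norm_num), Real.log_pow] at h3
    have h5 : 1 / T ≤ 1/100 := by gcongr
    push_cast at h3
    linarith

theorem W_le_tail (hχ : χ.IsPrimitive) {t : ℝ} (ht : 50 ≤ |t|) :
    (logDeriv (Xi χ) (2 + t * Complex.I)).re ≤ Real.log (q * |t| / (2 * Real.pi)) / 2 + 0.64 := by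
  have hq0 : (0:ℝ) < q := by exact_mod_cast Nat.pos_of_ne_zero (NeZero.ne q)
  have hy : 0 < |t| := by linarith
  have := W_le hχ (t := t) (y := |t|) hy le_rfl
  have hlog : Real.log (9/4 + |t|^2/4) ≤ 2 * Real.log (|t|/2) + 9 / |t|^2 := by
    have e : 9/4 + |t|^2/4 = (|t|/2)^2 * (1 + 9/|t|^2) := by field_simp; ring
    rw [e, Real.log_mul (by positivity) (by positivity), Real.log_pow]
    have := Real.log_le_sub_one_of_pos (show 0 < 1 + 9/|t|^2 by positivity)
    push_cast; linarith
  have e1 : Real.log (q * |t| / (2 * Real.pi)) = Real.log (q / Real.pi) + Real.log (|t|/2) := by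
    rw [← Real.log_mul (by positivity) (by positivity)]; congr 1; field_simp
  have h1 : 1 / |t| ≤ 1 / 50 := by gcongr
  have h2 : 9 / |t|^2 ≤ 9 / 50^2 := by gcongr
  have h4 : 50^2 ≤ t^2 := by rw [← sq_abs t]; gcongr
  have h3 : 2 / (4 + t^2) ≤ 2 / 50^2 := by
    gcongr; linarith
  have h3' : 1 / (1 + t^2) ≤ 1 / 50^2 := by
    gcongr; linarith
  rw [e1]
  norm_num at *
  linarith
end
end

section
open MeasureTheory Set Filter Topology
open scoped ComplexConjugate
set_option linter.unusedSectionVars false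
set_option linter.unusedSimpArgs false

/-- the test function -/
noncomputable def gg (δ t : ℝ) : ℂ := e2pi (δ * t) * (etaSq t : ℂ)

/-- rotated exponential factor -/
noncomputable def rE (l φ t : ℝ) : ℂ :=
  Complex.exp (-(Complex.exp (2 * φ * Complex.I)) * t ^ 2 / 2 + Complex.I * l * Complex.exp (φ * Complex.I) * t)

noncomputable def rH (l : ℝ) (s : ℂ) (φ t : ℝ) : ℂ :=
  Complex.exp (φ * Complex.I * (s + 2)) * ((t : ℂ) ^ (s + 1) * rE l φ t)

lemma rE_norm (l φ t : ℝ) :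
    ‖rE l φ t‖ = Real.exp (-(Real.cos (2 * φ)) * t ^ 2 / 2 - l * Real.sin φ * t) := by
  unfold rE
  rw [Complex.norm_exp]
  congr 1
  have e1 : Complex.exp (2 * φ * Complex.I) = (Real.cos (2*φ) : ℂ) + (Real.sin (2*φ):ℂ) * Complex.I := by
    rw [Complex.exp_mul_I]; push_cast; rfl
  have e2 : Complex.exp (φ * Complex.I) = (Real.cos φ : ℂ) + (Real.sin φ:ℂ) * Complex.I := by
    rw [Complex.exp_mul_I]; push_cast; rfl
  rw [e1, e2]
  have : (-((Real.cos (2*φ) : ℂ) + (Real.sin (2*φ):ℂ) * Complex.I) * (t:ℂ) ^ 2 / 2 + Complex.I * l * ((Real.cos φ : ℂ) + (Real.sin φ:ℂ) * Complex.I) * t)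
    = ((-(Real.cos (2 * φ)) * t ^ 2 / 2 - l * Real.sin φ * t : ℝ) : ℂ) + ((-(Real.sin (2 * φ)) * t ^ 2 / 2 + l * Real.cos φ * t : ℝ) : ℂ) * Complex.I := by
    push_cast
    linear_combination ((l:ℂ) * (Complex.sin φ) * t) * Complex.I_sq
  rw [this]
  simp only [Complex.add_re, Complex.ofReal_re, Complex.mul_re, Complex.I_re, Complex.ofReal_im, Complex.I_im]
  ring

lemma rE_cont (l φ : ℝ) : Continuous (rE l φ) := by
  unfold rE; fun_prop

/-- dominating weight -/
lemma wt_int {a c L : ℝ} (ha : -1 < a) (hc : 0 < c) :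
    IntegrableOn (fun t : ℝ => t ^ a * Real.exp (-c * t ^ 2 / 2 + L * t)) (Ioi 0) := by
  have h := (integrableOn_rpow_mul_exp_neg_mul_sq (b := c/4) (by positivity) ha).const_mul (Real.exp (L^2/c))
  refine Integrable.mono' h ?_ ?_
  · apply ContinuousOn.aestronglyMeasurable _ measurableSet_Ioi
    intro t ht
    have : t ≠ 0 := ne_of_gt ht
    apply ContinuousAt.continuousWithinAt
    have := Real.continuousAt_rpow_const t a (Or.inl this)
    fun_prop
  · filter_upwards [ae_restrict_mem measurableSet_Ioi] with t ht
    have ht : 0 < t := ht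
    rw [Real.norm_of_nonneg (by positivity)]
    have : Real.exp (-c * t ^ 2 / 2 + L * t) ≤ Real.exp (L^2/c) * Real.exp (-(c/4) * t^2) := by
      rw [← Real.exp_add]
      apply Real.exp_le_exp.2
      have : L^2/c - c/4*t^2 + c*t^2/2 - L*t = (L - c*t/2)^2/c := by field_simp; ring
      have h2 : 0 ≤ (L - c*t/2)^2/c := by positivity
      nlinarith
    calc _ ≤ t ^ a * (Real.exp (L^2/c) * Real.exp (-(c/4) * t^2)) := by gcongr
      _ = _ := by ring

lemma cos_two_pos {φ : ℝ} (h : |φ| < Real.pi / 4) : 0 < Real.cos (2 * φ) := by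
  have := abs_lt.1 h
  exact Real.cos_pos_of_mem_Ioo ⟨by linarith, by linarith⟩

lemma rE_le {l φ φ0 t : ℝ} (h0 : φ0 < Real.pi / 4) (hφ : |φ| ≤ φ0) (ht : 0 ≤ t) :
    ‖rE l φ t‖ ≤ Real.exp (-(Real.cos (2 * φ0)) * t ^ 2 / 2 + |l| * t) := by
  rw [rE_norm]
  apply Real.exp_le_exp.2
  have h1 : Real.cos (2 * φ0) ≤ Real.cos (2 * φ) := by
    rw [← Real.cos_abs (2*φ), abs_mul, abs_two]
    apply Real.cos_le_cos_of_nonneg_of_le_pi <;> [positivity; linarith [Real.pi_pos]; linarith]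
  have h2 : -(l * Real.sin φ) ≤ |l| := by
    have := abs_mul l (Real.sin φ)
    have h3 := Real.abs_sin_le_one φ
    have := neg_le_abs (l * Real.sin φ)
    nlinarith [abs_nonneg l]
  nlinarith [sq_nonneg t]

lemma rH_norm (l : ℝ) (s : ℂ) (φ : ℝ) {t : ℝ} (ht : 0 < t) :
    ‖rH l s φ t‖ = Real.exp (-φ * s.im) * (t ^ (s.re + 1) * ‖rE l φ t‖) := by
  unfold rH
  rw [norm_mul, norm_mul, Complex.norm_exp, Complex.norm_cpow_eq_rpow_re_of_pos ht]
  simp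

lemma rH_meas (l : ℝ) (s : ℂ) (φ : ℝ) :
    AEStronglyMeasurable (rH l s φ) (volume.restrict (Ioi 0)) := by
  apply ContinuousOn.aestronglyMeasurable _ measurableSet_Ioi
  intro t ht
  have ht : 0 < t := ht
  apply ContinuousAt.continuousWithinAt
  unfold rH
  have h1 : ContinuousAt (fun t : ℝ => (t:ℂ) ^ (s+1)) t :=
    Complex.continuousAt_ofReal_cpow_const t (s+1) (Or.inr ht.ne')
  have := (rE_cont l φ).continuousAt (x := t)
  fun_prop

lemma rH_int (l : ℝ) {s : ℂ} (hs : -2 < s.re) {φ : ℝ} (h : |φ| < Real.pi / 4) :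
    IntegrableOn (rH l s φ) (Ioi 0) := by
  refine Integrable.mono' ((wt_int (a := s.re + 1) (c := Real.cos (2 * |φ|)) (L := |l|) (by linarith) (cos_two_pos (by simpa using h))).const_mul
    (Real.exp (-φ * s.im))) (rH_meas l s φ) ?_
  filter_upwards [ae_restrict_mem measurableSet_Ioi] with t ht
  have ht : 0 < t := ht
  rw [rH_norm l s φ ht]
  gcongr
  exact rE_le h le_rfl ht.le

lemma rE_deriv_t (l φ t : ℝ) : HasDerivAt (rE l φ)
    ((-(Complex.exp (2 * φ * Complex.I)) * t + Complex.I * l * Complex.exp (φ * Complex.I)) * rE l φ t) t := by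
  unfold rE
  have h0 : HasDerivAt (fun t : ℝ => (t:ℂ)) 1 t := Complex.ofRealCLM.hasDerivAt
  have h1 := (((h0.pow 2).const_mul (-(Complex.exp (2 * φ * Complex.I)))).div_const 2).add
    (h0.const_mul (Complex.I * l * Complex.exp (φ * Complex.I)))
  convert! h1.cexp using 1
  simp; ring

lemma rE_deriv_φ (l φ t : ℝ) : HasDerivAt (fun φ => rE l φ t)
    (Complex.I * t * (-(Complex.exp (2 * φ * Complex.I)) * t + Complex.I * l * Complex.exp (φ * Complex.I)) * rE l φ t) φ := by
  unfold rE
  have h0 : HasDerivAt (fun t : ℝ => (t:ℂ)) 1 φ := Complex.ofRealCLM.hasDerivAt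
  have h1 := ((h0.const_mul 2).mul_const Complex.I).cexp
  have h2 := (h0.mul_const Complex.I).cexp
  have h3 := ((h1.neg.mul_const ((t:ℂ)^2)).div_const 2).add
    ((h2.const_mul (Complex.I * l)).mul_const (t:ℂ))
  convert! h3.cexp using 1
  simp; ring

/-- derivative of `rH` in `φ` -/
noncomputable def rD (l : ℝ) (s : ℂ) (φ t : ℝ) : ℂ :=
  Complex.I * Complex.exp (φ * Complex.I * (s + 2)) * ((s + 2) * (t : ℂ) ^ (s + 1) * rE l φ t
    + (t : ℂ) ^ (s + 2) * ((-(Complex.exp (2 * φ * Complex.I)) * t + Complex.I * l * Complex.exp (φ * Complex.I)) * rE l φ t))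

lemma cpow_succ' {t : ℝ} (ht : 0 < t) (s : ℂ) : (t:ℂ)^(s+2) = (t:ℂ)^(s+1) * t := by
  have h : (t:ℂ) ≠ 0 := by exact_mod_cast ht.ne'
  rw [show s + 2 = s + 1 + 1 by ring, Complex.cpow_add _ _ h, Complex.cpow_one]

lemma cpow_pred' {t : ℝ} (ht : 0 < t) (s : ℂ) : (t:ℂ)^(s+1) = (t:ℂ)^(s-1) * (t:ℂ)^2 := by
  have h : (t:ℂ) ≠ 0 := by exact_mod_cast ht.ne'
  rw [show s + 1 = s - 1 + 1 + 1 by ring, Complex.cpow_add _ _ h, Complex.cpow_add _ _ h, Complex.cpow_one]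
  ring

lemma rH_deriv_φ (l : ℝ) (s : ℂ) (φ : ℝ) {t : ℝ} (ht : 0 < t) :
    HasDerivAt (fun φ => rH l s φ t) (rD l s φ t) φ := by
  unfold rH rD
  have h0 : HasDerivAt (fun t : ℝ => (t:ℂ)) 1 φ := Complex.ofRealCLM.hasDerivAt
  have h1 := (((h0.mul_const Complex.I).mul_const (s+2)).cexp).mul ((rE_deriv_φ l φ t).const_mul ((t:ℂ)^(s+1)))
  convert! h1 using 1
  rw [cpow_succ' ht]; ring

lemma rD_int_aux (l : ℝ) (s : ℂ) (φ : ℝ) {t : ℝ} (ht : 0 < t) :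
    HasDerivAt (fun t : ℝ => Complex.I * Complex.exp (φ * Complex.I * (s + 2)) * ((t:ℂ)^(s+2) * rE l φ t)) (rD l s φ t) t := by
  unfold rD
  have h1 : HasDerivAt (fun t : ℝ => (t:ℂ)^(s+2)) ((s+2)*(t:ℂ)^(s+1)) t := by
    by_cases hs : s + 2 = 0
    · simp only [hs, Complex.cpow_zero, zero_mul]; exact hasDerivAt_const _ _
    · have h := hasDerivAt_ofReal_cpow_const (r := s+2) ht.ne' hs
      rwa [show s + 2 - 1 = s + 1 by ring] at h
  have := (h1.mul (rE_deriv_t l φ t)).const_mul (Complex.I * Complex.exp (φ * Complex.I * (s + 2)))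
  convert! this using 1

lemma rD_norm (l : ℝ) (s : ℂ) {φ φ0 t : ℝ} (h0 : φ0 < Real.pi / 4) (hφ : |φ| ≤ φ0) (ht : 0 < t) :
    ‖rD l s φ t‖ ≤ Real.exp (φ0 * |s.im|) * (‖s+2‖ * (t ^ (s.re+1) * Real.exp (-(Real.cos (2 * φ0)) * t ^ 2 / 2 + |l| * t)) +
      (t ^ (s.re+3) * Real.exp (-(Real.cos (2 * φ0)) * t ^ 2 / 2 + |l| * t) + |l| * (t ^ (s.re+2) * Real.exp (-(Real.cos (2 * φ0)) * t ^ 2 / 2 + |l| * t)))) := by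
  unfold rD
  have hE := rE_le (l := l) h0 hφ ht.le
  set W := Real.exp (-(Real.cos (2 * φ0)) * t ^ 2 / 2 + |l| * t)
  have e1 : ‖Complex.exp (φ * Complex.I * (s + 2))‖ ≤ Real.exp (φ0 * |s.im|) := by
    rw [Complex.norm_exp]
    apply Real.exp_le_exp.2
    have : (φ * Complex.I * (s+2)).re = -(φ * s.im) := by simp
    rw [this]
    calc _ ≤ |φ * s.im| := neg_le_abs _
      _ = |φ| * |s.im| := abs_mul _ _
      _ ≤ _ := by gcongr
  have n1 : ‖(t:ℂ)^(s+1)‖ = t ^ (s.re+1) := by rw [Complex.norm_cpow_eq_rpow_re_of_pos ht]; simp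
  have n2 : ‖(t:ℂ)^(s+2)‖ = t ^ (s.re+2) := by rw [Complex.norm_cpow_eq_rpow_re_of_pos ht]; simp
  have n3 : t ^ (s.re+3) = t ^ (s.re+2) * t := by rw [← Real.rpow_add_one ht.ne']; ring_nf
  have e2 : ‖-(Complex.exp (2 * φ * Complex.I)) * t + Complex.I * l * Complex.exp (φ * Complex.I)‖ ≤ t + |l| := by
    refine (norm_add_le _ _).trans ?_
    have a1 : ‖Complex.exp (2 * φ * Complex.I)‖ = 1 := by
      have := Complex.norm_exp_ofReal_mul_I (2*φ); push_cast at this; exact this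
    rw [norm_mul, norm_mul, norm_mul, norm_neg, a1, Complex.norm_exp_ofReal_mul_I]
    simp [abs_of_pos ht]
  rw [norm_mul, norm_mul, Complex.norm_I, one_mul]
  refine mul_le_mul e1 ?_ (norm_nonneg _) (by positivity)
  refine (norm_add_le _ _).trans ?_
  rw [norm_mul, norm_mul, norm_mul, norm_mul, n1, n2, n3]
  have p1 : (0:ℝ) ≤ t ^ (s.re+1) := by positivity
  have p2 : (0:ℝ) ≤ t ^ (s.re+2) := by positivity
  apply add_le_add
  · rw [mul_assoc]; gcongr
  · calc _ ≤ t ^ (s.re+2) * ((t + |l|) * W) := by gcongr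
      _ = _ := by ring

lemma rD_meas (l : ℝ) (s : ℂ) (φ : ℝ) :
    AEStronglyMeasurable (rD l s φ) (volume.restrict (Ioi 0)) := by
  apply ContinuousOn.aestronglyMeasurable _ measurableSet_Ioi
  intro t ht
  have ht : 0 < t := ht
  apply ContinuousAt.continuousWithinAt
  unfold rD
  have h1 : ContinuousAt (fun t : ℝ => (t:ℂ) ^ (s+1)) t :=
    Complex.continuousAt_ofReal_cpow_const t (s+1) (Or.inr ht.ne')
  have h2 : ContinuousAt (fun t : ℝ => (t:ℂ) ^ (s+2)) t :=
    Complex.continuousAt_ofReal_cpow_const t (s+2) (Or.inr ht.ne')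
  have := (rE_cont l φ).continuousAt (x := t)
  fun_prop

lemma rD_bound_int (l : ℝ) {s : ℂ} (hs : -2 < s.re) {φ0 : ℝ} (h00 : 0 ≤ φ0) (h0 : φ0 < Real.pi / 4) :
    IntegrableOn (fun t => Real.exp (φ0 * |s.im|) * (‖s+2‖ * (t ^ (s.re+1) * Real.exp (-(Real.cos (2 * φ0)) * t ^ 2 / 2 + |l| * t)) +
      (t ^ (s.re+3) * Real.exp (-(Real.cos (2 * φ0)) * t ^ 2 / 2 + |l| * t) + |l| * (t ^ (s.re+2) * Real.exp (-(Real.cos (2 * φ0)) * t ^ 2 / 2 + |l| * t))))) (Ioi 0) := by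
  have hc : 0 < Real.cos (2 * φ0) := cos_two_pos (by rwa [abs_of_nonneg h00])
  have i1 := wt_int (a := s.re + 1) (c := Real.cos (2 * φ0)) (L := |l|) (by linarith) hc
  have i2 := wt_int (a := s.re + 2) (c := Real.cos (2 * φ0)) (L := |l|) (by linarith) hc
  have i3 := wt_int (a := s.re + 3) (c := Real.cos (2 * φ0)) (L := |l|) (by linarith) hc
  exact Integrable.const_mul (Integrable.add (Integrable.const_mul i1 _) (Integrable.add i3 (Integrable.const_mul i2 _))) _

lemma rD_integral (l : ℝ) {s : ℂ} (hs : -2 < s.re) {φ : ℝ} (h : |φ| < Real.pi / 4) :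
    ∫ t in Ioi (0:ℝ), rD l s φ t = 0 := by
  have hint : IntegrableOn (rD l s φ) (Ioi 0) := by
    refine Integrable.mono' (rD_bound_int l hs (abs_nonneg φ) h) (rD_meas l s φ) ?_
    filter_upwards [ae_restrict_mem measurableSet_Ioi] with t ht
    exact rD_norm l s h le_rfl ht
  have hc : 0 < Real.cos (2 * |φ|) := cos_two_pos (by simpa using h)
  set P : ℝ → ℂ := fun t : ℝ => Complex.I * Complex.exp (φ * Complex.I * (s + 2)) * ((t:ℂ)^(s+2) * rE l φ t) with hP
  have hcont : ContinuousWithinAt P (Ici 0) 0 := by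
    apply ContinuousAt.continuousWithinAt
    have h1 : ContinuousAt (fun t : ℝ => (t:ℂ) ^ (s+2)) 0 :=
      Complex.continuousAt_ofReal_cpow_const 0 (s+2) (Or.inl (by simp; linarith))
    have := (rE_cont l φ).continuousAt (x := 0)
    fun_prop
  have hP0 : P 0 = 0 := by
    have : s + 2 ≠ 0 := by
      intro h; have := congrArg Complex.re h; simp at this; linarith
    simp [hP, Complex.zero_cpow this]
  have htop : Tendsto P atTop (𝓝 0) := by
    have b : Tendsto (fun t : ℝ => Real.exp (-φ * s.im) * Real.exp (|l|^2/Real.cos (2*|φ|)) * (t ^ (s.re+2) * Real.exp (-(Real.cos (2*|φ|)/4) * t))) atTop (𝓝 0) := by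
      have := (tendsto_rpow_mul_exp_neg_mul_atTop_nhds_zero (s.re+2) (Real.cos (2*|φ|)/4) (by positivity)).const_mul (Real.exp (-φ * s.im) * Real.exp (|l|^2/Real.cos (2*|φ|)))
      simpa using this
    refine squeeze_zero_norm' ?_ b
    filter_upwards [eventually_ge_atTop 1] with t ht
    have ht0 : 0 < t := by linarith
    have := rE_le (l := l) h le_rfl ht0.le
    have e2 : Real.exp (-(Real.cos (2 * |φ|)) * t ^ 2 / 2 + |l| * t) ≤ Real.exp (|l|^2/Real.cos (2*|φ|)) * Real.exp (-(Real.cos (2*|φ|)/4) * t) := by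
      rw [← Real.exp_add]
      apply Real.exp_le_exp.2
      set c := Real.cos (2*|φ|)
      have : |l|^2/c - c/4*t^2 + c*t^2/2 - |l| * t = (|l| - c*t/2)^2/c := by field_simp; ring
      have h2 : 0 ≤ (|l| - c*t/2)^2/c := by positivity
      have : c * t ≤ c * t^2 := mul_le_mul_of_nonneg_left (by nlinarith) hc.le
      nlinarith
    rw [hP]
    simp only [norm_mul, Complex.norm_I, one_mul, Complex.norm_exp]
    rw [Complex.norm_cpow_eq_rpow_re_of_pos ht0]
    have r : (φ * Complex.I * (s+2)).re = -φ * s.im := by simp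
    rw [r]
    have r2 : (s+2).re = s.re + 2 := by simp
    rw [r2]
    calc _ ≤ Real.exp (-φ * s.im) * (t ^ (s.re+2) * (Real.exp (|l|^2/Real.cos (2*|φ|)) * Real.exp (-(Real.cos (2*|φ|)/4) * t))) := by
            gcongr; exact this.trans e2
      _ = _ := by ring
  have := integral_Ioi_of_hasDerivAt_of_tendsto hcont (fun t ht => rD_int_aux l s φ ht) hint htop
  rw [this, hP0, sub_zero]

lemma rH_const (l : ℝ) {s : ℂ} (hs : -2 < s.re) {φ : ℝ} (h : |φ| < Real.pi / 4) :
    ∫ t in Ioi (0:ℝ), rH l s φ t = ∫ t in Ioi (0:ℝ), rH l s 0 t := by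
  have hd : ∀ φ ∈ Ioo (-(Real.pi/4)) (Real.pi/4), HasDerivAt (fun φ => ∫ t in Ioi (0:ℝ), rH l s φ t) 0 φ := by
    intro φ hφ
    have hφ' : |φ| < Real.pi/4 := abs_lt.2 hφ
    obtain ⟨φ0, h1, h2⟩ := exists_between hφ'
    have hs1 : Metric.ball φ (φ0 - |φ|) ∈ 𝓝 φ := Metric.ball_mem_nhds _ (by linarith)
    have := hasDerivAt_integral_of_dominated_loc_of_deriv_le (μ := volume.restrict (Ioi (0:ℝ))) (F := rH l s) (F' := rD l s) (x₀ := φ) hs1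
      (Eventually.of_forall (fun φ => rH_meas l s φ)) (rH_int l hs hφ') (rD_meas l s φ)
      (bound := fun t => Real.exp (φ0 * |s.im|) * (‖s+2‖ * (t ^ (s.re+1) * Real.exp (-(Real.cos (2 * φ0)) * t ^ 2 / 2 + |l| * t)) +
      (t ^ (s.re+3) * Real.exp (-(Real.cos (2 * φ0)) * t ^ 2 / 2 + |l| * t) + |l| * (t ^ (s.re+2) * Real.exp (-(Real.cos (2 * φ0)) * t ^ 2 / 2 + |l| * t)))))
      ?_ (rD_bound_int l hs ((abs_nonneg φ).trans h1.le) h2) ?_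
    · have h3 := this.2
      rwa [rD_integral l hs hφ'] at h3
    · filter_upwards [ae_restrict_mem measurableSet_Ioi] with t ht ψ hψ
      apply rD_norm l s h2 _ ht
      rw [Metric.mem_ball, Real.dist_eq] at hψ
      have := abs_sub_abs_le_abs_sub ψ φ
      linarith
    · filter_upwards [ae_restrict_mem measurableSet_Ioi] with t ht ψ hψ
      exact rH_deriv_φ l s ψ ht
  have hpi := Real.pi_pos
  have := (convex_Ioo (-(Real.pi/4)) (Real.pi/4)).is_const_of_fderivWithin_eq_zero (𝕜 := ℝ) (f := fun φ => ∫ t in Ioi (0:ℝ), rH l s φ t)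
    (fun y hy => (hd y hy).differentiableAt.differentiableWithinAt)
    (fun y hy => by
      rw [fderivWithin_of_isOpen isOpen_Ioo hy]
      have := (hd y hy).hasFDerivAt.fderiv
      rw [this]; ext; simp)
    (abs_lt.1 h : φ ∈ Ioo (-(Real.pi/4)) (Real.pi/4)) (show (0:ℝ) ∈ Ioo (-(Real.pi/4)) (Real.pi/4) from ⟨by linarith, by linarith⟩)
  exact this

lemma mellin_gg (δ : ℝ) (s : ℂ) : mellin (gg δ) s = ∫ t in Ioi (0:ℝ), rH (2 * Real.pi * δ) s 0 t := by
  unfold mellin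
  apply setIntegral_congr_fun measurableSet_Ioi
  intro t ht
  have ht : 0 < t := ht
  have e := cpow_pred' ht s
  simp only [rH, rE, gg, e2pi, etaSq, e, smul_eq_mul]
  push_cast
  simp only [mul_zero, zero_mul, Complex.exp_zero, one_mul, mul_one]
  rw [Complex.exp_add]
  have : 2 * (Real.pi:ℂ) * Complex.I * (δ * t) = Complex.I * (2 * Real.pi * δ) * t := by ring
  rw [this]
  have : -(1:ℂ) * t^2/2 = -(t:ℂ)^2/2 := by ring
  rw [this]
  ring

/-- rotation bound -/
lemma mellin_gg_rot (δ : ℝ) {s : ℂ} (hs : -2 < s.re) {φ : ℝ} (h : |φ| < Real.pi / 4) :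
    ‖mellin (gg δ) s‖ ≤ Real.exp (-φ * s.im) * ∫ t in Ioi (0:ℝ), t ^ (s.re+1) *
      Real.exp (-(Real.cos (2 * φ)) * t ^ 2 / 2 - 2 * Real.pi * δ * Real.sin φ * t) := by
  rw [mellin_gg, ← rH_const _ hs h, ← integral_const_mul]
  refine (norm_integral_le_integral_norm _).trans (le_of_eq ?_)
  apply setIntegral_congr_fun measurableSet_Ioi
  intro t ht
  simp only
  rw [rH_norm _ _ _ ht, rE_norm]

lemma mellin_gg_conv (δ : ℝ) {s : ℂ} (hs : -2 < s.re) : MellinConvergent (gg δ) s := by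
  have h := rH_int (2 * Real.pi * δ) hs (φ := 0) (by simp [Real.pi_pos])
  refine IntegrableOn.congr_fun h ?_ measurableSet_Ioi
  intro t ht
  have ht : 0 < t := ht
  have e := cpow_pred' ht s
  simp only [rH, rE, gg, e2pi, etaSq, e, smul_eq_mul]
  push_cast
  simp only [mul_zero, zero_mul, Complex.exp_zero, one_mul, mul_one]
  rw [Complex.exp_add]
  have : 2 * (Real.pi:ℂ) * Complex.I * (δ * t) = Complex.I * (2 * Real.pi * δ) * t := by ring
  rw [this]
  have : -(1:ℂ) * t^2/2 = -(t:ℂ)^2/2 := by ring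
  rw [this]
  ring

/-- exponential decay on vertical lines -/
lemma mellin_gg_decay (δ : ℝ) {σ : ℝ} (hs : -2 < σ) : ∃ C : ℝ, 0 ≤ C ∧ ∀ t : ℝ,
    ‖mellin (gg δ) (σ + t * Complex.I)‖ ≤ C * Real.exp (-(1/4) * |t|) := by
  have hp := Real.pi_gt_three
  have k : ∀ φ : ℝ, |φ| = 1/4 → ∃ C : ℝ, 0 ≤ C ∧ ∀ t : ℝ,
    ‖mellin (gg δ) (σ + t * Complex.I)‖ ≤ C * Real.exp (-φ * t) := by
    intro φ hφ
    refine ⟨∫ t in Ioi (0:ℝ), t ^ (σ+1) *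
      Real.exp (-(Real.cos (2 * φ)) * t ^ 2 / 2 - 2 * Real.pi * δ * Real.sin φ * t), ?_, ?_⟩
    · apply setIntegral_nonneg measurableSet_Ioi
      intro t ht
      have ht : 0 < t := ht
      positivity
    · intro t
      have := mellin_gg_rot δ (s := σ + t * Complex.I) (by simpa using hs) (φ := φ) (by rw [hφ]; linarith)
      simp only [Complex.add_re, Complex.ofReal_re, Complex.mul_re, Complex.I_re, mul_zero, Complex.ofReal_im, Complex.I_im, mul_one, sub_self, add_zero, Complex.add_im, Complex.mul_im, zero_add] at this
      linarith
  obtain ⟨C1, h1, k1⟩ := k (1/4) (by norm_num)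
  obtain ⟨C2, h2, k2⟩ := k (-(1/4)) (by norm_num)
  refine ⟨max C1 C2, le_max_of_le_left h1, fun t => ?_⟩
  rcases le_total 0 t with ht | ht
  · rw [abs_of_nonneg ht]
    exact (k1 t).trans (by gcongr; exact le_max_left _ _)
  · rw [abs_of_nonpos ht]
    refine (k2 t).trans ?_
    have : -(1/4) * -t = - -(1/4) * t := by ring
    rw [this]; gcongr; exact le_max_right _ _
end

section
open MeasureTheory Set Filter Topology
open scoped ComplexConjugate
set_option linter.unusedSectionVars false
set_option linter.unusedSimpArgs false

lemma cpow_mi_cont : ContinuousOn (fun p : ℝ × ℝ => (p.1 : ℂ) ^ (-(p.2 * Complex.I))) (Ioi 0 ×ˢ univ) := by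
  intro p hp
  apply ContinuousAt.continuousWithinAt
  have : (0:ℝ) < p.1 := hp.1
  apply ContinuousAt.cpow (by fun_prop) (by fun_prop)
  left; simpa using this

lemma pairing (f : ℝ → ℂ) (c : ℝ) (hf : MellinConvergent f c)
    (hV : Complex.VerticalIntegrable (mellin f) c) (hfc : ContinuousOn f (Ioi 0)) (k : ℝ → ℂ)
    (hk : IntegrableOn (fun y : ℝ => (y:ℂ) ^ (-(c:ℂ)) * k y) (Ioi 0)) :
    ∫ y in Ioi (0:ℝ), f y * k y = (1 / (2 * Real.pi) : ℂ) *
      ∫ t : ℝ, mellin f (c + t * Complex.I) * ∫ y in Ioi (0:ℝ), (y:ℂ) ^ (-((c:ℂ) + t * Complex.I)) * k y := by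
  have h1 : ∀ y ∈ Ioi (0:ℝ), f y * k y = (1 / (2 * Real.pi) : ℂ) * ∫ t : ℝ, mellin f (c + t * Complex.I) * ((y:ℂ) ^ (-((c:ℂ) + t * Complex.I)) * k y) := by
    intro y hy
    have hy : 0 < y := hy
    have := mellinInv_mellin_eq c f hy hf hV (hfc.continuousAt (Ioi_mem_nhds hy))
    rw [← this, mellinInv, Complex.real_smul, mul_assoc, ← integral_mul_const]
    push_cast
    congr 2
    ext t
    simp only [smul_eq_mul]; ring
  rw [setIntegral_congr_fun measurableSet_Ioi h1, integral_const_mul]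
  congr 1
  rw [integral_integral_swap]
  · congr 1; ext t; rw [integral_const_mul]
  · have hp : Integrable (fun p : ℝ × ℝ => (fun y : ℝ => (y:ℂ) ^ (-(c:ℂ)) * k y) p.1 * (fun t : ℝ => mellin f (c + t * Complex.I)) p.2)
      ((volume.restrict (Ioi 0)).prod volume) := Integrable.mul_prod hk hV
    have hb := hp.bdd_mul (f := fun p : ℝ × ℝ => (p.1 : ℂ) ^ (-(p.2 * Complex.I))) (c := 1) ?_ ?_
    · refine hb.congr ?_
      have : ((volume.restrict (Ioi (0:ℝ))).prod (volume : Measure ℝ)) = (volume.prod volume).restrict (Ioi 0 ×ˢ univ) := by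
        rw [← Measure.prod_restrict, Measure.restrict_univ]
      rw [this]
      filter_upwards [ae_restrict_mem (measurableSet_Ioi.prod MeasurableSet.univ)] with p hp
      have h0 : (p.1:ℂ) ≠ 0 := by exact_mod_cast (ne_of_gt hp.1)
      simp only [Function.uncurry]
      rw [neg_add, Complex.cpow_add _ _ h0]
      ring
    · have : ((volume.restrict (Ioi (0:ℝ))).prod (volume : Measure ℝ)) = (volume.prod volume).restrict (Ioi 0 ×ˢ univ) := by
        rw [← Measure.prod_restrict, Measure.restrict_univ]
      rw [this]
      exact cpow_mi_cont.aestronglyMeasurable (measurableSet_Ioi.prod MeasurableSet.univ)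
    · have : ((volume.restrict (Ioi (0:ℝ))).prod (volume : Measure ℝ)) = (volume.prod volume).restrict (Ioi 0 ×ˢ univ) := by
        rw [← Measure.prod_restrict, Measure.restrict_univ]
      rw [this]
      filter_upwards [ae_restrict_mem (measurableSet_Ioi.prod MeasurableSet.univ)] with p hp
      rw [Complex.norm_cpow_eq_rpow_re_of_pos hp.1]
      simp

lemma gg_cont (δ : ℝ) : Continuous (gg δ) := by
  unfold gg e2pi etaSq; fun_prop

lemma mellin_gg_cont (δ : ℝ) {σ : ℝ} (hs : -2 < σ) :
    Continuous (fun t : ℝ => mellin (gg δ) (σ + t * Complex.I)) := by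
  simp only [mellin_gg]
  have hi := rH_int (2 * Real.pi * δ) (s := σ) (by simpa using hs) (φ := 0) (by simp [Real.pi_pos])
  refine continuous_of_dominated (bound := fun y => ‖rH (2 * Real.pi * δ) σ 0 y‖) (fun t => rH_meas _ _ _) ?_ hi.norm ?_
  · intro t
    filter_upwards [ae_restrict_mem measurableSet_Ioi] with y hy
    rw [rH_norm _ _ _ hy, rH_norm _ _ _ hy]; simp
  · filter_upwards [ae_restrict_mem measurableSet_Ioi] with y hy
    have hy : 0 < y := hy
    unfold rH
    have : Continuous (fun t : ℝ => (y:ℂ) ^ ((σ:ℂ) + t * Complex.I + 1)) := by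
      apply Continuous.const_cpow (by fun_prop)
      left; exact_mod_cast hy.ne'
    fun_prop

lemma exp_abs_int {c : ℝ} (hc : 0 < c) : Integrable (fun t : ℝ => Real.exp (-c * |t|)) := by
  have h1 : IntegrableOn (fun t : ℝ => Real.exp (-c * |t|)) (Iic 0) := by
    refine (integrableOn_exp_mul_Iic hc 0).congr_fun (fun t ht => ?_) measurableSet_Iic
    simp only [abs_of_nonpos (show t ≤ 0 from ht)]; congr 1; ring
  have h2 : IntegrableOn (fun t : ℝ => Real.exp (-c * |t|)) (Ioi 0) := by
    refine (integrableOn_exp_mul_Ioi (a := -c) (by linarith) 0).congr_fun (fun t ht => ?_) measurableSet_Ioi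
    simp only [abs_of_pos (show 0 < t from ht)]
  have := h1.union h2
  rwa [Iic_union_Ioi, integrableOn_univ] at this

lemma mellin_gg_vert (δ : ℝ) {σ : ℝ} (hs : -2 < σ) :
    Complex.VerticalIntegrable (mellin (gg δ)) σ := by
  obtain ⟨C, hC, h⟩ := mellin_gg_decay δ hs
  refine Integrable.mono' ((exp_abs_int (c := 1/4) (by norm_num)).const_mul C) (mellin_gg_cont δ hs).aestronglyMeasurable ?_
  exact Eventually.of_forall h

/-- rescaled test function -/
noncomputable def fx (x δ y : ℝ) : ℂ := gg δ (y / x)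

lemma fx_cont (x δ : ℝ) : Continuous (fx x δ) := by
  unfold fx; exact (gg_cont δ).comp (by fun_prop)

lemma mellin_fx {x : ℝ} (hx : 0 < x) (δ : ℝ) (s : ℂ) : mellin (fx x δ) s = (x:ℂ) ^ s * mellin (gg δ) s := by
  have := mellin_comp_mul_left (gg δ) s (a := x⁻¹) (by positivity)
  have e : fx x δ = fun t => gg δ (x⁻¹ * t) := by ext t; simp [fx, div_eq_inv_mul]
  rw [e, this, smul_eq_mul]
  congr 1
  push_cast
  rw [Complex.inv_cpow _ _ (by rw [Complex.arg_ofReal_of_nonneg hx.le]; exact Real.pi_pos.ne), Complex.cpow_neg, inv_inv]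

lemma mellin_fx_conv {x : ℝ} (hx : 0 < x) (δ : ℝ) {s : ℂ} (hs : -2 < s.re) : MellinConvergent (fx x δ) s := by
  have e : fx x δ = fun t => gg δ (x⁻¹ * t) := by ext t; simp [fx, div_eq_inv_mul]
  rw [e]
  exact (MellinConvergent.comp_mul_left (a := x⁻¹) (by positivity)).2 (mellin_gg_conv δ hs)

lemma mellin_fx_decay {x : ℝ} (hx : 0 < x) (δ : ℝ) {σ : ℝ} (hs : -2 < σ) : ∃ C : ℝ, 0 ≤ C ∧ ∀ t : ℝ,
    ‖mellin (fx x δ) (σ + t * Complex.I)‖ ≤ C * Real.exp (-(1/4) * |t|) := by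
  obtain ⟨C, hC, h⟩ := mellin_gg_decay δ hs
  refine ⟨x ^ σ * C, by positivity, fun t => ?_⟩
  rw [mellin_fx hx, norm_mul, Complex.norm_cpow_eq_rpow_re_of_pos hx]
  simp only [Complex.add_re, Complex.ofReal_re, Complex.mul_re, Complex.I_re, mul_zero, Complex.ofReal_im, Complex.I_im, mul_one, sub_self, add_zero]
  rw [mul_assoc]
  gcongr
  exact h t

lemma mellin_fx_cont {x : ℝ} (hx : 0 < x) (δ : ℝ) {σ : ℝ} (hs : -2 < σ) :
    Continuous (fun t : ℝ => mellin (fx x δ) (σ + t * Complex.I)) := by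
  simp only [mellin_fx hx]
  have : Continuous (fun t : ℝ => (x:ℂ) ^ ((σ:ℂ) + t * Complex.I)) := by
    apply Continuous.const_cpow (by fun_prop)
    left; exact_mod_cast hx.ne'
  exact this.mul (mellin_gg_cont δ hs)

lemma mellin_fx_vert {x : ℝ} (hx : 0 < x) (δ : ℝ) {σ : ℝ} (hs : -2 < σ) :
    Complex.VerticalIntegrable (mellin (fx x δ)) σ := by
  obtain ⟨C, hC, h⟩ := mellin_fx_decay hx δ hs
  refine Integrable.mono' ((exp_abs_int (c := 1/4) (by norm_num)).const_mul C) (mellin_fx_cont hx δ hs).aestronglyMeasurable ?_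
  exact Eventually.of_forall h

/-- kernel 1: `(1/2π)∫ F/(s-ρ) = ∫_1^∞ f y^{ρ-1}` -/
lemma pair_pole {x : ℝ} (hx : 0 < x) (δ : ℝ) {ρ : ℂ} (hρ : ρ.re < 2) :
    (1 / (2 * Real.pi) : ℂ) * ∫ t : ℝ, mellin (fx x δ) (2 + t * Complex.I) * (1 / (2 + t * Complex.I - ρ))
      = ∫ y in Ioi (1:ℝ), fx x δ y * (y:ℂ) ^ (ρ - 1) := by
  have e0 : ∀ (s : ℂ) , ∀ y ∈ Ioi (0:ℝ), (y:ℂ) ^ (-s) * (Ioi (1:ℝ)).indicator (fun y : ℝ => (y:ℂ)^(ρ-1)) y = (Ioi (1:ℝ)).indicator (fun y : ℝ => (y:ℂ)^(ρ-1-s)) y := by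
    intro s y hy
    have hy0 : (y:ℂ) ≠ 0 := by exact_mod_cast (ne_of_gt (hy : (0:ℝ) < y))
    by_cases h : y ∈ Ioi (1:ℝ)
    · rw [indicator_of_mem h, indicator_of_mem h, ← Complex.cpow_add _ _ hy0]; congr 1; ring
    · rw [indicator_of_notMem h, indicator_of_notMem h, mul_zero]
  have hsub : Ioi (1:ℝ) ⊆ Ioi 0 := Ioi_subset_Ioi zero_le_one
  have := pairing (fx x δ) 2 (mellin_fx_conv hx δ (by norm_num)) (mellin_fx_vert hx δ (by norm_num)) (fx_cont x δ).continuousOn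
    ((Ioi (1:ℝ)).indicator (fun y : ℝ => (y:ℂ)^(ρ-1))) ?_
  · push_cast at this
    have e1 : ∀ t : ℝ, ∫ y in Ioi (0:ℝ), (y:ℂ) ^ (-((2:ℂ) + t * Complex.I)) * (Ioi (1:ℝ)).indicator (fun y : ℝ => (y:ℂ)^(ρ-1)) y = 1 / (2 + t * Complex.I - ρ) := by
      intro t
      rw [setIntegral_congr_fun measurableSet_Ioi (e0 _), setIntegral_indicator measurableSet_Ioi, inter_eq_self_of_subset_right hsub,
        integral_Ioi_cpow_of_lt (by simp; linarith) zero_lt_one]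
      have : (2 + t * Complex.I - ρ) ≠ 0 := by
        intro h; have := congrArg Complex.re h; simp at this; linarith
      simp only [Complex.ofReal_one, Complex.one_cpow]
      rw [show ρ - 1 - (2 + t * Complex.I) + 1 = -(2 + t * Complex.I - ρ) by ring]
      field_simp
    simp only [e1] at this
    rw [← this]
    have e2 : ∀ y ∈ Ioi (0:ℝ), fx x δ y * (Ioi (1:ℝ)).indicator (fun y : ℝ => (y:ℂ)^(ρ-1)) y = (Ioi (1:ℝ)).indicator (fun y : ℝ => fx x δ y * (y:ℂ)^(ρ-1)) y := by
      intro y hy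
      by_cases h : y ∈ Ioi (1:ℝ)
      · rw [indicator_of_mem h, indicator_of_mem h]
      · rw [indicator_of_notMem h, indicator_of_notMem h, mul_zero]
    rw [setIntegral_congr_fun measurableSet_Ioi e2, setIntegral_indicator measurableSet_Ioi, inter_eq_self_of_subset_right hsub]
  · rw [integrableOn_congr_fun (e0 _) measurableSet_Ioi]
    rw [IntegrableOn, integrable_indicator_iff measurableSet_Ioi, IntegrableOn, Measure.restrict_restrict_of_subset hsub]
    exact integrableOn_Ioi_cpow_of_lt (by simp; linarith) zero_lt_one
end

section
open MeasureTheory Set Filter Topology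
open scoped ComplexConjugate
set_option linter.unusedSectionVars false
set_option linter.unusedSimpArgs false

noncomputable def Am (x δ : ℝ) (φ : ℝ → ℂ) : ℂ :=
  (1 / (2 * Real.pi) : ℂ) * ∫ t : ℝ, mellin (fx x δ) (2 + t * Complex.I) * φ t

lemma wt2_int : Integrable (fun t : ℝ => (1 + |t|)^2 * Real.exp (-(1/4) * |t|)) := by
  refine Integrable.mono' ((exp_abs_int (c := 1/8) (by norm_num)).const_mul 256) (by fun_prop) ?_
  refine Eventually.of_forall fun t => ?_
  have h0 := abs_nonneg t
  set u := |t|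
  rw [Real.norm_of_nonneg (by positivity)]
  have : Real.exp (-(1/8) * u) = Real.exp (-(1/4)*u) * Real.exp (u/8) := by rw [← Real.exp_add]; congr 1; ring
  rw [this]
  have h2 := Real.quadratic_le_exp_of_nonneg (show 0 ≤ u/8 by positivity)
  have h3 := Real.exp_pos (-(1/4)*u)
  have : (1+u)^2 ≤ 256 * Real.exp (u/8) := by nlinarith
  nlinarith

lemma fx_cont2 {x : ℝ} (hx : 0 < x) (δ : ℝ) : Continuous (fun t : ℝ => mellin (fx x δ) (2 + t * Complex.I)) := by
  have := mellin_fx_cont hx δ (σ := 2) (by norm_num)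
  push_cast at this; exact this

lemma fx_decay2 {x : ℝ} (hx : 0 < x) (δ : ℝ) : ∃ C : ℝ, 0 ≤ C ∧ ∀ t : ℝ,
    ‖mellin (fx x δ) (2 + t * Complex.I)‖ ≤ C * Real.exp (-(1/4) * |t|) := by
  have := mellin_fx_decay hx δ (σ := 2) (by norm_num)
  push_cast at this; exact this

lemma Am_int {x : ℝ} (hx : 0 < x) (δ : ℝ) {φ : ℝ → ℂ} (hm : AEStronglyMeasurable φ) {c : ℝ}
    (hb : ∀ t, ‖φ t‖ ≤ c * (1 + |t|)^2) : Integrable (fun t : ℝ => mellin (fx x δ) (2 + t * Complex.I) * φ t) := by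
  obtain ⟨C, hC, h⟩ := fx_decay2 hx δ
  refine Integrable.mono' (wt2_int.const_mul (C * c)) ((fx_cont2 hx δ).aestronglyMeasurable.mul hm) ?_
  refine Eventually.of_forall fun t => ?_
  rw [norm_mul]
  calc _ ≤ (C * Real.exp (-(1/4) * |t|)) * (c * (1 + |t|)^2) := mul_le_mul (h t) (hb t) (norm_nonneg _) (by positivity)
    _ = _ := by ring

lemma Am_hasSum_count {x : ℝ} (hx : 0 < x) (δ : ℝ) {ι : Type} [Countable ι] {φ : ι → ℝ → ℂ} {Φ : ℝ → ℂ}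
    (hm : ∀ i, Continuous (φ i)) {c : ι → ℝ} (hc : Summable c) (hb : ∀ i t, ‖φ i t‖ ≤ c i * (1 + |t|)^2)
    (hs : ∀ t, HasSum (fun i => φ i t) (Φ t)) :
    HasSum (fun i => Am x δ (φ i)) (Am x δ Φ) ∧ Integrable (fun t : ℝ => mellin (fx x δ) (2 + t * Complex.I) * Φ t) := by
  constructor
  · unfold Am
    apply HasSum.mul_left
    have e : ∫ t : ℝ, mellin (fx x δ) (2 + t * Complex.I) * Φ t = ∫ t : ℝ, ∑' i, mellin (fx x δ) (2 + t * Complex.I) * φ i t := by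
      congr 1; ext t; exact ((hs t).mul_left _).tsum_eq.symm
    rw [e]
    apply hasSum_integral_of_summable_integral_norm
    · intro i; exact Am_int hx δ (hm i).aestronglyMeasurable (hb i)
    · obtain ⟨C, hC, h⟩ := fx_decay2 hx δ
      refine Summable.of_nonneg_of_le (fun i => integral_nonneg fun t => norm_nonneg _) (fun i => ?_) (hc.mul_right (C * ∫ t : ℝ, (1 + |t|)^2 * Real.exp (-(1/4) * |t|)))
      rw [← mul_assoc, ← integral_const_mul]
      apply integral_mono (Am_int hx δ (hm i).aestronglyMeasurable (hb i)).norm (wt2_int.const_mul _)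
      intro t
      simp only [norm_mul]
      calc _ ≤ (C * Real.exp (-(1/4) * |t|)) * (c i * (1 + |t|)^2) := mul_le_mul (h t) (hb i t) (norm_nonneg _) (by positivity)
        _ = _ := by ring
  · apply Am_int hx δ (c := ∑' i, c i)
    · apply aestronglyMeasurable_of_tendsto_ae (u := atTop) (f := fun (s : Finset ι) t => ∑ i ∈ s, φ i t)
      · intro s
        exact (continuous_finsetSum s fun i _ => hm i).aestronglyMeasurable
      · exact Eventually.of_forall fun t => hs t
    · intro t
      rw [← (hs t).tsum_eq]
      exact tsum_of_norm_bounded (hc.hasSum.mul_right _) (fun i => hb i t)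

lemma Am_hasSum {x : ℝ} (hx : 0 < x) (δ : ℝ) {ι : Type} {φ : ι → ℝ → ℂ} {Φ : ℝ → ℂ}
    (hm : ∀ i, Continuous (φ i)) {c : ι → ℝ} (hc : Summable c) (hb : ∀ i t, ‖φ i t‖ ≤ c i * (1 + |t|)^2)
    (hs : ∀ t, HasSum (fun i => φ i t) (Φ t)) :
    HasSum (fun i => Am x δ (φ i)) (Am x δ Φ) ∧ Integrable (fun t : ℝ => mellin (fx x δ) (2 + t * Complex.I) * Φ t) := by
  have hcount := hc.countable_support
  have : Countable (Function.support c) := hcount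
  have hz : ∀ i, i ∉ Function.support c → φ i = 0 := by
    intro i hi
    ext t
    have := hb i t
    rw [Function.notMem_support.1 hi, zero_mul] at this
    simpa using this
  have := Am_hasSum_count hx δ (ι := Function.support c) (φ := fun i => φ i) (Φ := Φ) (fun i => hm i) (c := fun i => c i)
    (hc.subtype _) (fun i t => hb i t) (fun t => by
      refine (hasSum_subtype_iff_of_support_subset (s := Function.support c) ?_).2 (hs t)
      intro i hi
      by_contra h
      exact hi (by simp [hz i h]))
  refine ⟨(hasSum_subtype_iff_of_support_subset (s := Function.support c) (f := fun i => Am x δ (φ i)) ?_).1 this.1, this.2⟩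
  intro i hi
  by_contra h
  exact hi (by simp [hz i h, Am])

/-- inversion on the line 2 -/
lemma Am_cpow {x : ℝ} (hx : 0 < x) (δ : ℝ) {y : ℝ} (hy : 0 < y) :
    Am x δ (fun t => (y:ℂ) ^ (-((2:ℂ) + t * Complex.I))) = fx x δ y := by
  have := mellinInv_mellin_eq 2 (fx x δ) hy (mellin_fx_conv hx δ (by norm_num)) (mellin_fx_vert hx δ (by norm_num)) (fx_cont x δ).continuousAt
  rw [← this, mellinInv, Am, Complex.real_smul]
  push_cast
  congr 2
  ext t; simp only [smul_eq_mul]; ring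

lemma Am_one {x : ℝ} (hx : 0 < x) (δ : ℝ) (a : ℂ) : Am x δ (fun _ => a) = a * fx x δ 1 := by
  have := Am_cpow hx δ (y := 1) one_pos
  simp only [Complex.ofReal_one, Complex.one_cpow] at this
  rw [← this, Am, Am, integral_mul_const, integral_mul_const]; ring

/-- the basic quantity -/
noncomputable def UU (x δ : ℝ) (ρ : ℂ) : ℂ := (∫ y in Ioi (1:ℝ), fx x δ y * (y:ℂ) ^ (ρ - 1)) - fx x δ 1 / (2 - ρ)

lemma sub_ne {ρ : ℂ} (hρ : ρ.re < 2) (t : ℝ) : (2 + t * Complex.I - ρ) ≠ 0 := by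
  intro h; have := congrArg Complex.re h; simp at this; linarith

lemma pole_cont {ρ : ℂ} (hρ : ρ.re < 2) : Continuous (fun t : ℝ => 1 / (2 + t * Complex.I - ρ)) := by
  apply Continuous.div (by fun_prop) (by fun_prop)
  intro t; exact sub_ne hρ t

lemma pole_bd {ρ : ℂ} (hρ : ρ.re ≤ 1) (t : ℝ) : ‖1 / (2 + t * Complex.I - ρ)‖ ≤ 1 * (1 + |t|)^2 := by
  have h1 : (1:ℝ) ≤ ‖2 + t * Complex.I - ρ‖ := by
    refine le_trans ?_ (Complex.re_le_norm _)
    simp; linarith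
  have h2 : ‖1 / (2 + t * Complex.I - ρ)‖ ≤ 1 := by
    rw [norm_div, norm_one]; exact div_le_one_of_le₀ h1 (by positivity)
  have := abs_nonneg t
  nlinarith

lemma Am_pole {x : ℝ} (hx : 0 < x) (δ : ℝ) {ρ : ℂ} (hρ : ρ.re ≤ 1) :
    Am x δ (fun t => 1 / (2 + t * Complex.I - ρ) - 1 / (2 - ρ)) = UU x δ ρ := by
  have h1 := Am_int hx δ (pole_cont (ρ := ρ) (by linarith)).aestronglyMeasurable (pole_bd hρ)
  have h2 := Am_int hx δ (φ := fun _ => 1 / (2 - ρ)) aestronglyMeasurable_const (c := ‖1 / (2 - ρ)‖) (fun t => by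
    have : 1 ≤ (1 + |t|)^2 := by nlinarith [abs_nonneg t]
    exact le_mul_of_one_le_right (norm_nonneg _) this)
  have h3 := pair_pole hx δ (ρ := ρ) (by linarith)
  have h4 := Am_one hx δ (1 / (2 - ρ))
  unfold UU
  rw [← h3, Am]
  rw [Am] at h4
  simp only [mul_sub]
  rw [integral_sub h1 h2, mul_sub, h4]
  ring

section
variable {q : ℕ} [NeZero q] {χ : DirichletCharacter ℂ q}

lemma Am_L {x : ℝ} (hx : 0 < x) (δ : ℝ) :
    HasSum (fun n : ℕ => (ArithmeticFunction.vonMangoldt n : ℂ) * χ (n : ZMod q) * fx x δ n)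
      (Am x δ (fun t => - logDeriv χ.LFunction (2 + t * Complex.I))) := by
  have := (Am_hasSum hx δ (φ := fun (n:ℕ) t => (ArithmeticFunction.vonMangoldt n : ℂ) * χ (n : ZMod q) * (n:ℂ) ^ (-((2:ℂ) + t * Complex.I)))
    (Φ := fun t => - logDeriv χ.LFunction (2 + t * Complex.I)) ?_ lam_summable.1 ?_ ?_).1
  · convert this using 2 with n
    rcases eq_or_ne n 0 with rfl | hn
    · simp [Am]
    · have hn' : (0:ℝ) < n := by exact_mod_cast Nat.pos_of_ne_zero hn
      have h := Am_cpow hx δ hn'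
      rw [← h, Am, Am]
      simp only [Complex.ofReal_natCast]
      rw [mul_left_comm, ← integral_const_mul]
      congr 2; ext t; ring
  · intro n
    rcases eq_or_ne n 0 with rfl | hn
    · simp; exact continuous_const
    · apply Continuous.mul continuous_const
      apply Continuous.const_cpow (by fun_prop)
      left; exact_mod_cast hn
  · intro n t
    refine (L_term_norm _ (by simp) n).trans ?_
    have : 1 ≤ (1 + |t|)^2 := by nlinarith [abs_nonneg t]
    exact le_mul_of_one_le_right (by have := ArithmeticFunction.vonMangoldt_nonneg (n := n); positivity) this
  · intro t
    exact neg_logDeriv_L _ (by simp)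

lemma Am_zeros (hχ : χ.IsPrimitive) {x : ℝ} (hx : 0 < x) (δ : ℝ) :
    HasSum (fun ρ => (mul' (Xi χ) ρ : ℂ) * UU x δ ρ)
      (Am x δ (fun t => logDeriv (Xi χ) (2 + t * Complex.I) - logDeriv (Xi χ) 2)) ∧
    Integrable (fun t : ℝ => mellin (fx x δ) (2 + t * Complex.I) * (logDeriv (Xi χ) (2 + t * Complex.I) - logDeriv (Xi χ) 2)) := by
  have hX := Xi_XiLike hχ
  have := Am_hasSum hx δ (φ := fun ρ t => (mul' (Xi χ) ρ : ℂ) * (1 / (2 + t * Complex.I - ρ) - 1 / (2 - ρ)))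
    (Φ := fun t => logDeriv (Xi χ) (2 + t * Complex.I) - logDeriv (Xi χ) 2) ?_ hX.summable_sq ?_ (fun t => hX.hasSum_diff t)
  · refine ⟨?_, this.2⟩
    convert this.1 using 2 with ρ
    by_cases hm : mul' (Xi χ) ρ = 0
    · simp [hm, Am]
    · rw [← Am_pole hx δ (hX.strip ρ (XiLike.zero_of_mul ρ hm)).2.le, Am, Am, mul_left_comm, ← integral_const_mul]
      congr 2; ext t; ring
  · intro ρ
    by_cases hm : mul' (Xi χ) ρ = 0
    · simp [hm]; exact continuous_const
    · have := pole_cont (ρ := ρ) (by linarith [(hX.strip ρ (XiLike.zero_of_mul ρ hm)).2])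
      fun_prop
  · intro ρ t
    have hmn : 0 ≤ mul' (Xi χ) ρ := by unfold mul'; positivity
    by_cases hm : mul' (Xi χ) ρ = 0
    · simp [hm]
    · have := XiLike.diff_bound t ρ (hX.strip ρ (XiLike.zero_of_mul ρ hm)).2
      rw [norm_mul, Complex.norm_real, Real.norm_of_nonneg hmn]
      have h0 := abs_nonneg t
      calc _ ≤ mul' (Xi χ) ρ * (|t| * (1 + |t|) / ‖2 - ρ‖ ^ 2) := by gcongr
        _ ≤ mul' (Xi χ) ρ * ((1 + |t|)^2 / ‖2 - ρ‖ ^ 2) := by gcongr; nlinarith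
        _ = _ := by ring

lemma Am_gamma {x : ℝ} (hx : 0 < x) (δ : ℝ) :
    HasSum (fun j : ℕ => - UU x δ (-(kap χ : ℂ) - 2 * j))
      (Am x δ (fun t => (Complex.digamma ((2 + t * Complex.I + kap χ) / 2) - Complex.digamma ((2 + kap χ : ℂ) / 2)) / 2)) ∧
    Integrable (fun t : ℝ => mellin (fx x δ) (2 + t * Complex.I) * ((Complex.digamma ((2 + t * Complex.I + kap χ) / 2) - Complex.digamma ((2 + kap χ : ℂ) / 2)) / 2)) := by
  have hk : 0 ≤ kap χ := by rcases kap_cases (χ := χ) with h | h <;> rw [h] <;> norm_num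
  have hre : ∀ j : ℕ, (-(kap χ : ℂ) - 2 * j).re = - kap χ - 2 * j := by intro j; simp
  have hre1 : ∀ j : ℕ, (-(kap χ : ℂ) - 2 * j).re ≤ 0 := by intro j; rw [hre]; have : (0:ℝ) ≤ j := by positivity
                                                           linarith
  have hn : ∀ j : ℕ, (j + 1 : ℝ) ≤ ‖2 - (-(kap χ : ℂ) - 2 * j)‖ := by
    intro j
    refine le_trans ?_ (Complex.re_le_norm _)
    rw [Complex.sub_re, hre]
    have : (0:ℝ) ≤ j := by positivity
    simp; linarith
  have := Am_hasSum hx δ (φ := fun (j:ℕ) t => -(1 / (2 + t * Complex.I - (-(kap χ : ℂ) - 2 * j)) - 1 / (2 - (-(kap χ : ℂ) - 2 * j))))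
    (Φ := fun t => (Complex.digamma ((2 + t * Complex.I + kap χ) / 2) - Complex.digamma ((2 + kap χ : ℂ) / 2)) / 2)
    (c := fun j => 1 / ((j:ℝ) + 1)^2) ?_ ?_ ?_ ?_
  · refine ⟨?_, this.2⟩
    convert this.1 using 2 with j
    rw [← Am_pole hx δ (by linarith [hre1 j])]
    simp only [Am, mul_neg, integral_neg]
  · intro j
    have := pole_cont (ρ := (-(kap χ : ℂ) - 2 * j)) (by linarith [hre1 j])
    fun_prop
  · have h := (summable_nat_add_iff 1).2 (Real.summable_one_div_nat_pow.2 (one_lt_two : 1 < 2))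
    simpa using h
  · intro j t
    rw [norm_neg]
    refine (XiLike.diff_bound t _ (by linarith [hre1 j])).trans ?_
    have h0 := abs_nonneg t
    rw [div_mul_eq_mul_div, one_mul]
    have h1 := hn j
    have h2 : (0:ℝ) < j + 1 := by positivity
    gcongr
    nlinarith
  · intro t
    have := (digamma_hasSum (s := (2 + t * Complex.I + kap χ) / 2) (w := (2 + kap χ : ℂ) / 2) (by simp; linarith) (by simp; linarith)).div_const 2
    have key : ∀ f g : ℕ → ℂ, ∀ a, (∀ j, f j = g j) → HasSum g a → HasSum f a := fun f g a h hg => by rwa [funext h]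
    refine key _ _ _ (fun j => ?_) this
    have h1 := sub_ne (ρ := -(kap χ : ℂ) - 2 * j) (by linarith [hre1 j]) t
    have h2 := sub_ne (ρ := -(kap χ : ℂ) - 2 * j) (by linarith [hre1 j]) 0
    have e1 : (2 + t * Complex.I + kap χ) / 2 + j = (2 + t * Complex.I - (-(kap χ : ℂ) - 2 * j)) / 2 := by ring
    have e2 : (2 + kap χ : ℂ) / 2 + j = (2 - (-(kap χ : ℂ) - 2 * j)) / 2 := by ring
    rw [e1, e2]
    simp only [Complex.ofReal_zero, zero_mul, add_zero] at h2
    field_simp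
    ring

theorem explicit_formula (hχ : χ.IsPrimitive) {x : ℝ} (hx : 0 < x) (δ : ℝ) :
    ∑' n : ℕ, (ArithmeticFunction.vonMangoldt n : ℂ) * χ (n : ZMod q) * fx x δ n
      = - logDeriv χ.LFunction 2 * fx x δ 1 + (∑' j : ℕ, - UU x δ (-(kap χ : ℂ) - 2 * j))
        + (if q = 1 then UU x δ 0 + UU x δ 1 else 0) - ∑' ρ, (mul' (Xi χ) ρ : ℂ) * UU x δ ρ := by
  rw [(Am_L hx δ).tsum_eq, (Am_gamma hx δ).1.tsum_eq, (Am_zeros hχ hx δ).1.tsum_eq]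
  have i0 := Am_int hx δ (φ := fun _ => - logDeriv χ.LFunction 2) aestronglyMeasurable_const (c := ‖- logDeriv χ.LFunction 2‖) (fun t => by
    have : 1 ≤ (1 + |t|)^2 := by nlinarith [abs_nonneg t]
    exact le_mul_of_one_le_right (norm_nonneg _) this)
  have i1 := (Am_gamma (χ := χ) hx δ).2
  have i2 := (Am_zeros hχ hx δ).2
  have db : ∀ ρ : ℂ, ρ.re ≤ 1 → Integrable (fun t : ℝ => mellin (fx x δ) (2 + t * Complex.I) * (1 / (2 + t * Complex.I - ρ) - 1 / (2 - ρ))) := by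
    intro ρ hρ
    have h1 := Am_int hx δ (pole_cont (ρ := ρ) (by linarith)).aestronglyMeasurable (pole_bd hρ)
    have h2 := Am_int hx δ (φ := fun _ => 1 / (2 - ρ)) aestronglyMeasurable_const (c := ‖1 / (2 - ρ)‖) (fun t => by
      have : 1 ≤ (1 + |t|)^2 := by nlinarith [abs_nonneg t]
      exact le_mul_of_one_le_right (norm_nonneg _) this)
    have := h1.sub h2
    refine this.congr (Eventually.of_forall fun t => ?_)
    simp [mul_sub]
  have i3 : Integrable (fun t : ℝ => mellin (fx x δ) (2 + t * Complex.I) * (if q = 1 then (1 / (2 + t * Complex.I - 0) - 1 / (2 - 0)) + (1 / (2 + t * Complex.I - 1) - 1 / (2 - 1)) else 0)) := by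
    split_ifs
    · have := (db 0 (by simp)).add (db 1 (by simp))
      refine this.congr (Eventually.of_forall fun t => ?_)
      simp only [Pi.add_apply]; ring
    · simp
  have e3 : (if q = 1 then UU x δ 0 + UU x δ 1 else 0) = Am x δ (fun t => if q = 1 then (1 / (2 + t * Complex.I - 0) - 1 / (2 - 0)) + (1 / (2 + t * Complex.I - 1) - 1 / (2 - 1)) else 0) := by
    split_ifs
    · rw [← Am_pole hx δ (ρ := 0) (by simp), ← Am_pole hx δ (ρ := 1) (by simp), Am, Am, Am, ← mul_add, ← integral_add (db 0 (by simp)) (db 1 (by simp))]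
      congr 2; ext t; ring
    · simp [Am]
  rw [e3, ← Am_one hx δ, Am, Am, Am, Am, Am, ← mul_add, ← mul_add, ← mul_sub, ← integral_add i0 i1, ← integral_add (by exact i0.add i1) i3,
    ← integral_sub (by exact (i0.add i1).add i3) i2]
  congr 2
  ext t
  rw [← mul_add, ← mul_add, ← mul_sub]
  congr 1
  have k1 := Xi_logDeriv hχ (2 + t * Complex.I) (by simp)
  have k2 := Xi_logDeriv hχ 2 (by norm_num)
  rw [k1, k2]
  split_ifs <;> ring
end
end

section
open MeasureTheory Set Filter Topology
open scoped ComplexConjugate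
set_option linter.unusedSectionVars false
set_option linter.unusedSimpArgs false

/-- `fx / y^2` -/
noncomputable def hh (x δ y : ℝ) : ℂ :=
  Complex.exp (2 * Real.pi * Complex.I * δ / x * y - y ^ 2 / (2 * x ^ 2)) / x ^ 2

noncomputable def hq (x δ y : ℝ) : ℂ := 2 * Real.pi * Complex.I * δ / x - y / x ^ 2

lemma fx_hh {x : ℝ} (δ y : ℝ) : fx x δ y = y ^ 2 * hh x δ y := by
  unfold fx gg e2pi etaSq hh
  rw [sub_eq_add_neg, Complex.exp_add]
  push_cast
  have e1 : 2 * (Real.pi:ℂ) * Complex.I * (δ * (y / x)) = 2 * Real.pi * Complex.I * δ / x * y := by ring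
  have e2 : -((y:ℂ)/x)^2/2 = -((y:ℂ)^2/(2 * x^2)) := by ring
  rw [e1, e2]; ring

lemma hh_norm {x : ℝ} (δ y : ℝ) : ‖hh x δ y‖ = Real.exp (-(y^2 / (2*x^2))) / x^2 := by
  unfold hh
  rw [norm_div, Complex.norm_exp]
  congr 1
  · congr 1
    have : 2 * (Real.pi:ℂ) * Complex.I * δ / x * y - y ^ 2 / (2 * x ^ 2) = ((-(y^2/(2*x^2)) : ℝ) : ℂ) + ((2 * Real.pi * δ / x * y : ℝ) : ℂ) * Complex.I := by
      push_cast; ring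
    rw [this]; simp only [Complex.add_re, Complex.ofReal_re, Complex.mul_re, Complex.I_re, Complex.ofReal_im, Complex.I_im]; ring
  · simp

lemma hh_deriv {x : ℝ} (δ y : ℝ) : HasDerivAt (hh x δ) (hq x δ y * hh x δ y) y := by
  unfold hh hq
  have h0 : HasDerivAt (fun t : ℝ => (t:ℂ)) 1 y := Complex.ofRealCLM.hasDerivAt
  have := ((h0.const_mul (2 * Real.pi * Complex.I * δ / x : ℂ)).sub ((h0.pow 2).div_const (2 * (x:ℂ) ^ 2))).cexp.div_const ((x:ℂ)^2)
  convert! this using 1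
  simp; ring

lemma hq_deriv {x : ℝ} (δ y : ℝ) : HasDerivAt (hq x δ) (-(1 / (x:ℂ)^2)) y := by
  unfold hq
  have h0 : HasDerivAt (fun t : ℝ => (t:ℂ)) 1 y := Complex.ofRealCLM.hasDerivAt
  have := (h0.div_const ((x:ℂ) ^ 2)).const_sub (2 * Real.pi * Complex.I * δ / x : ℂ)
  exact this

lemma hh_cont (x δ : ℝ) : Continuous (hh x δ) := by unfold hh; fun_prop
lemma hq_cont (x δ : ℝ) : Continuous (hq x δ) := by unfold hq; fun_prop

lemma hq_norm {x : ℝ} (hx : 0 < x) (δ : ℝ) {y : ℝ} (hy : 0 ≤ y) : ‖hq x δ y‖ ≤ 2 * Real.pi * |δ| / x + y / x^2 := by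
  unfold hq
  refine (norm_sub_le _ _).trans (le_of_eq ?_)
  simp [abs_of_pos hx, abs_of_pos Real.pi_pos, abs_of_nonneg hy]

lemma hh_le {x : ℝ} (hx : 0 < x) (δ y : ℝ) : ‖hh x δ y‖ ≤ 1 / x^2 := by
  rw [hh_norm]
  gcongr
  apply Real.exp_le_one_iff.2
  have : 0 ≤ y^2/(2*x^2) := by positivity
  linarith

lemma fx1_le {x : ℝ} (hx : 0 < x) (δ : ℝ) : ‖fx x δ 1‖ ≤ 1 / x^2 := by
  rw [fx_hh]; simpa using hh_le hx δ 1

noncomputable def MM (x δ : ℝ) : ℝ := (4 + (2 * Real.pi * |δ| / x + 1 / x^2) + ((2 * Real.pi * |δ| / x + 1 / x^2)^2 + 1/x^2)) / x^2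

lemma MM_nonneg {x : ℝ} (hx : 0 < x) (δ : ℝ) : 0 ≤ MM x δ := by
  have := Real.pi_pos
  unfold MM; positivity

/-- remainder for a zero -/
lemma RR_bound {x : ℝ} (hx : 0 < x) (δ : ℝ) {ρ : ℂ} (h0 : 0 < ρ.re) (h1 : ρ.re < 1) :
    ‖(∫ y in (0:ℝ)..1, fx x δ y * (y:ℂ) ^ (ρ - 1)) + fx x δ 1 / (2 - ρ)‖ ≤ MM x δ / ‖2 - ρ‖^2 := by
  have r2 : (2 - ρ) ≠ 0 := by intro h; have := congrArg Complex.re h; simp at this; linarith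
  have r3 : (ρ + 2) ≠ 0 := by intro h; have := congrArg Complex.re h; simp at this; linarith
  have r4 : (ρ + 3) ≠ 0 := by intro h; have := congrArg Complex.re h; simp at this; linarith
  have n3 : ‖2 - ρ‖ ≤ ‖ρ + 2‖ := by
    apply (Real.sqrt_le_sqrt _)
    simp only [Complex.normSq_apply, Complex.sub_re, Complex.add_re, Complex.sub_im, Complex.add_im]
    simp; nlinarith
  have n4 : ‖2 - ρ‖ ≤ ‖ρ + 3‖ := by
    apply (Real.sqrt_le_sqrt _)
    simp only [Complex.normSq_apply, Complex.sub_re, Complex.add_re, Complex.sub_im, Complex.add_im]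
    simp; nlinarith
  have n2 : 0 < ‖2 - ρ‖ := norm_pos_iff.2 r2
  set D : ℝ → ℂ := fun y => (hq x δ y * hq x δ y - 1 / (x:ℂ)^2) * hh x δ y * (y:ℂ)^(ρ+3) / ((ρ+2)*(ρ+3)) with hD
  set P : ℝ → ℂ := fun y => hh x δ y * ((y:ℂ)^(ρ+2) / (ρ+2)) - hq x δ y * hh x δ y * ((y:ℂ)^(ρ+3) / (ρ+3)) / (ρ+2) with hP
  have cp : ∀ a : ℂ, 0 < a.re → Continuous (fun y : ℝ => (y:ℂ)^a) := fun a ha =>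
    Complex.continuous_ofReal_cpow_const ha
  have c2 := cp (ρ+2) (by simp; linarith)
  have c3 := cp (ρ+3) (by simp; linarith)
  have hc := hh_cont x δ
  have qc := hq_cont x δ
  have cD : Continuous D := by rw [hD]; fun_prop
  have cP : Continuous P := by rw [hP]; fun_prop
  have cpd : ∀ a : ℂ, a + 1 ≠ 0 → ∀ y : ℝ, 0 < y → HasDerivAt (fun y : ℝ => (y:ℂ)^(a+1) / (a+1)) ((y:ℂ)^a) y :=
    fun a ha y hy => hasDerivAt_ofReal_cpow_const' hy.ne' (by intro h; apply ha; rw [h]; ring)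
  have hI : IntervalIntegrable (fun y => fx x δ y * (y:ℂ) ^ (ρ - 1)) volume 0 1 := by
    have := mellin_fx_conv hx δ (s := ρ) (by linarith)
    rw [intervalIntegrable_iff_integrableOn_Ioc_of_le zero_le_one]
    refine (IntegrableOn.mono_set this Ioc_subset_Ioi_self).congr_fun (fun y _ => ?_) measurableSet_Ioc
    simp only [smul_eq_mul]; ring
  have key : ∫ y in (0:ℝ)..1, (fx x δ y * (y:ℂ) ^ (ρ - 1) - D y) = P 1 - P 0 := by
    apply intervalIntegral.integral_eq_sub_of_hasDerivAt_of_le zero_le_one cP.continuousOn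
    · intro y hy
      have hy0 : 0 < y := hy.1
      have yc : (y:ℂ) ≠ 0 := by exact_mod_cast hy0.ne'
      have d2 := cpd (ρ+1) (by rwa [add_assoc, one_add_one_eq_two]) y hy0
      have d3 := cpd (ρ+2) (by rw [add_assoc]; norm_num; exact r4) y hy0
      rw [show ρ + 1 + 1 = ρ + 2 by ring] at d2
      rw [show ρ + 2 + 1 = ρ + 3 by ring] at d3
      have := ((hh_deriv (x := x) δ y).mul d2).sub ((((hq_deriv (x := x) δ y).mul (hh_deriv (x := x) δ y)).mul d3).div_const (ρ+2))
      convert! this using 1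
      simp only [Pi.mul_apply]; rw [fx_hh, hD]
      have e1 : (y:ℂ)^(ρ+1) = (y:ℂ)^(ρ-1) * y^2 := cpow_pred' hy0 ρ
      rw [e1]
      field_simp
      ring
    · exact hI.sub (cD.intervalIntegrable _ _)
  rw [intervalIntegral.integral_sub hI (cD.intervalIntegrable _ _)] at key
  have P0 : P 0 = 0 := by simp [hP, Complex.zero_cpow r3, Complex.zero_cpow r4]
  have P1 : P 1 = hh x δ 1 / (ρ+2) - hq x δ 1 * hh x δ 1 / ((ρ+2)*(ρ+3)) := by
    simp only [hP, Complex.ofReal_one, Complex.one_cpow]; field_simp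
  have hDb : ‖∫ y in (0:ℝ)..1, D y‖ ≤ (((2 * Real.pi * |δ| / x + 1 / x^2)^2 + 1/x^2) / x^2 / ‖2-ρ‖^2) * |1 - 0| := by
    apply intervalIntegral.norm_integral_le_of_norm_le_const
    intro y hy
    rw [uIoc_of_le zero_le_one] at hy
    have a1 := hq_norm hx δ hy.1.le
    have a2 : ‖hq x δ y‖ ≤ 2 * Real.pi * |δ| / x + 1 / x^2 := a1.trans (by gcongr; exact hy.2)
    have a3 := hh_le hx δ y
    have a4 : ‖(y:ℂ)^(ρ+3)‖ ≤ 1 := by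
      rw [Complex.norm_cpow_eq_rpow_re_of_pos hy.1]
      exact Real.rpow_le_one hy.1.le hy.2 (by simp; linarith)
    have a5 : ‖hq x δ y * hq x δ y - 1 / (x:ℂ)^2‖ ≤ (2 * Real.pi * |δ| / x + 1 / x^2)^2 + 1/x^2 := by
      refine (norm_sub_le _ _).trans ?_
      rw [norm_mul]
      have : ‖1 / (x:ℂ)^2‖ = 1/x^2 := by simp
      rw [this]; have := mul_self_le_mul_self (norm_nonneg _) a2; nlinarith
    rw [hD]
    simp only [norm_mul, norm_div]
    have pp := Real.pi_pos
    calc _ ≤ ((2 * Real.pi * |δ| / x + 1 / x^2)^2 + 1/x^2) * (1/x^2) * 1 / (‖2-ρ‖ * ‖2-ρ‖) := by gcongr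
      _ = _ := by ring
  have fin : (∫ y in (0:ℝ)..1, fx x δ y * (y:ℂ) ^ (ρ - 1)) + fx x δ 1 / (2 - ρ) =
      4 * hh x δ 1 / ((ρ+2) * (2-ρ)) - hq x δ 1 * hh x δ 1 / ((ρ+2)*(ρ+3)) + ∫ y in (0:ℝ)..1, D y := by
    have : (∫ y in (0:ℝ)..1, fx x δ y * (y:ℂ) ^ (ρ - 1)) = P 1 + ∫ y in (0:ℝ)..1, D y := by
      rw [P0] at key; linear_combination key
    rw [this, P1, fx_hh]
    push_cast
    field_simp
    ring
  rw [fin]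
  have b1 : ‖4 * hh x δ 1 / ((ρ+2) * (2-ρ))‖ ≤ 4 / x^2 / ‖2-ρ‖^2 := by
    rw [norm_div, norm_mul, norm_mul]
    have := hh_le hx δ 1
    calc _ ≤ ‖(4:ℂ)‖ * (1/x^2) / (‖2-ρ‖ * ‖2-ρ‖) := by gcongr
      _ = _ := by simp; ring
  have b2 : ‖hq x δ 1 * hh x δ 1 / ((ρ+2)*(ρ+3))‖ ≤ (2 * Real.pi * |δ| / x + 1 / x^2) / x^2 / ‖2-ρ‖^2 := by
    rw [norm_div, norm_mul, norm_mul]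
    have := hh_le hx δ 1
    have a1 := hq_norm hx δ (y := 1) zero_le_one
    have pp := Real.pi_pos
    calc _ ≤ (2 * Real.pi * |δ| / x + 1 / x^2) * (1/x^2) / (‖2-ρ‖ * ‖2-ρ‖) := by gcongr
      _ = _ := by ring
  have := norm_add₃_le (a := 4 * hh x δ 1 / ((ρ+2) * (2-ρ))) (b := - (hq x δ 1 * hh x δ 1 / ((ρ+2)*(ρ+3)))) (c := ∫ y in (0:ℝ)..1, D y)
  rw [norm_neg, ← sub_eq_add_neg] at this
  refine this.trans ?_
  have : MM x δ / ‖2 - ρ‖^2 = 4 / x^2 / ‖2-ρ‖^2 + (2 * Real.pi * |δ| / x + 1 / x^2) / x^2 / ‖2-ρ‖^2 + (((2 * Real.pi * |δ| / x + 1 / x^2)^2 + 1/x^2) / x^2 / ‖2-ρ‖^2) * |1 - 0| := by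
    unfold MM; simp; ring
  rw [this]
  gcongr

lemma UU_split {x : ℝ} (hx : 0 < x) (δ : ℝ) {ρ : ℂ} (h0 : -2 < ρ.re) :
    UU x δ ρ = (x:ℂ)^ρ * mellin (gg δ) ρ - ((∫ y in (0:ℝ)..1, fx x δ y * (y:ℂ) ^ (ρ - 1)) + fx x δ 1 / (2 - ρ)) := by
  have hm : IntegrableOn (fun y => fx x δ y * (y:ℂ) ^ (ρ - 1)) (Ioi 0) := by
    refine (mellin_fx_conv hx δ h0).congr_fun (fun y _ => ?_) measurableSet_Ioi
    simp only [smul_eq_mul]; ring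
  have e : mellin (fx x δ) ρ = (∫ y in (0:ℝ)..1, fx x δ y * (y:ℂ) ^ (ρ - 1)) + ∫ y in Ioi (1:ℝ), fx x δ y * (y:ℂ) ^ (ρ - 1) := by
    rw [intervalIntegral.integral_of_le zero_le_one, ← setIntegral_union (Ioc_disjoint_Ioi le_rfl) measurableSet_Ioi (hm.mono_set Ioc_subset_Ioi_self)
      (hm.mono_set (Ioi_subset_Ioi zero_le_one)), Ioc_union_Ioi_eq_Ioi zero_le_one, mellin]
    congr 1; ext y; simp only [smul_eq_mul]; ring
  rw [← mellin_fx hx, e, UU]; ring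
end

section
open MeasureTheory Set Filter Topology
open scoped ComplexConjugate
set_option linter.unusedSectionVars false
set_option linter.unusedSimpArgs false

lemma UU_le {x : ℝ} (hx : 0 < x) (δ : ℝ) {ρ : ℂ} (h0 : ρ.re ≤ 0) : ‖UU x δ ρ‖ ≤ 1 + 1 / (2 * x^2) := by
  have d : ∀ y ∈ Ici (1:ℝ), HasDerivAt (fun y : ℝ => - Real.exp (-(y^2/(2*x^2)))) (y / x^2 * Real.exp (-(y^2/(2*x^2)))) y := by
    intro y _
    have := ((((hasDerivAt_id y).pow 2).div_const (2*x^2)).neg.exp).neg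
    convert! this using 1
    simp; field_simp
  have lim : Tendsto (fun y : ℝ => - Real.exp (-(y^2/(2*x^2)))) atTop (𝓝 (-0)) := by
    apply Tendsto.neg
    apply Real.tendsto_exp_atBot.comp
    apply tendsto_neg_atTop_atBot.comp
    exact (tendsto_pow_atTop two_ne_zero).atTop_div_const (by positivity)
  have pos : ∀ y ∈ Ioi (1:ℝ), 0 ≤ y / x^2 * Real.exp (-(y^2/(2*x^2))) := fun y hy => by
    have : (1:ℝ) < y := hy
    positivity
  have I1 := integrableOn_Ioi_deriv_of_nonneg' d pos lim
  have I2 := integral_Ioi_of_hasDerivAt_of_nonneg' d pos lim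
  have b1 : ‖∫ y in Ioi (1:ℝ), fx x δ y * (y:ℂ) ^ (ρ - 1)‖ ≤ ∫ y in Ioi (1:ℝ), y / x^2 * Real.exp (-(y^2/(2*x^2))) := by
    apply norm_integral_le_of_norm_le I1
    refine (ae_restrict_mem measurableSet_Ioi).mono fun y hy => ?_
    have hy : (1:ℝ) < y := hy
    rw [norm_mul, fx_hh, norm_mul, hh_norm, Complex.norm_cpow_eq_rpow_re_of_pos (by linarith)]
    have : y ^ (ρ - 1).re ≤ y ^ (-1:ℝ) := Real.rpow_le_rpow_of_exponent_le hy.le (by simp; linarith)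
    rw [Real.rpow_neg_one] at this
    calc _ ≤ ‖(y:ℂ)^2‖ * (Real.exp (-(y^2/(2*x^2))) / x^2) * y⁻¹ := by gcongr
      _ = _ := by simp; field_simp
  have b2 : ‖fx x δ 1 / (2 - ρ)‖ ≤ 1 / (2*x^2) := by
    rw [norm_div]
    have : 2 ≤ ‖2 - ρ‖ := le_trans (by simp; linarith) (Complex.re_le_norm _)
    calc _ ≤ (1/x^2) / 2 := by gcongr; exact fx1_le hx δ
      _ = _ := by ring
  have b3 : Real.exp (-(1^2/(2*x^2))) ≤ 1 := Real.exp_le_one_iff.2 (by have : 0 ≤ (1:ℝ)^2/(2*x^2) := by positivity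
                                                                       linarith)
  refine (norm_sub_le _ _).trans ?_
  linarith

lemma UU_far {x : ℝ} (hx : 0 < x) (δ : ℝ) {n : ℝ} (hn : 4 ≤ n) :
    ‖UU x δ (-n)‖ ≤ 4 / x^2 / (n^2-4) + (2 * Real.pi * |δ| / x + 1/x) / x^2 / ((n-2)*(n-3)) := by
  have n2 : (n:ℂ) - 2 ≠ 0 := by intro h; have := congrArg Complex.re h; simp at this; linarith
  have n2' : (n:ℂ) + 2 ≠ 0 := by intro h; have := congrArg Complex.re h; simp at this; linarith
  set K := (2 * Real.pi * |δ| / x + 1/x) / x^2 with hK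
  have pp := Real.pi_pos
  have K0 : 0 ≤ K := by positivity
  have hq1 : ∀ y ∈ Ioi (1:ℝ), ‖hq x δ y * hh x δ y‖ ≤ K := by
    intro y hy
    have hy : (1:ℝ) < y := hy
    rw [norm_mul, hh_norm]
    have a1 := hq_norm hx δ (y := y) (by linarith)
    have a2 : Real.exp (-(y^2/(2*x^2))) ≤ 1 := Real.exp_le_one_iff.2 (by have : 0 ≤ y^2/(2*x^2) := by positivity
                                                                         linarith)
    have a3 : y / x * Real.exp (-(y^2/(2*x^2))) ≤ 1 := by
      rw [Real.exp_neg, ← div_eq_mul_inv, div_le_one (Real.exp_pos _)]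
      refine le_trans ?_ (Real.add_one_le_exp _)
      have : y^2/(2*x^2) = (y/x)^2/2 := by field_simp
      rw [this]; nlinarith [sq_nonneg (y/x-1)]
    calc _ ≤ (2 * Real.pi * |δ| / x + y / x^2) * (Real.exp (-(y^2/(2*x^2))) / x^2) := by gcongr
      _ = (2 * Real.pi * |δ| / x * Real.exp (-(y^2/(2*x^2))) + 1/x*(y / x * Real.exp (-(y^2/(2*x^2))))) / x^2 := by field_simp
      _ ≤ (2 * Real.pi * |δ| / x * 1 + 1/x*1) / x^2 := by gcongr
      _ = _ := by rw [hK]; ring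
  have cp : ∀ a : ℂ, ContinuousOn (fun y : ℝ => (y:ℂ)^a) (Ioi 1) := fun a y hy =>
    (Complex.continuousAt_ofReal_cpow_const y a (Or.inr (by have : (1:ℝ) < y := hy
                                                            linarith))).continuousWithinAt
  have cpi : ∀ a : ℝ, a < -1 → IntegrableOn (fun y : ℝ => y ^ a) (Ioi 1) := fun a ha => integrableOn_Ioi_rpow_of_lt ha one_pos
  have nr : ∀ (a : ℝ), ∀ y ∈ Ioi (1:ℝ), ‖(y:ℂ)^(a:ℂ)‖ = y^a := fun a y hy => by
    rw [Complex.norm_cpow_eq_rpow_re_of_pos (by have : (1:ℝ) < y := hy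
                                                linarith)]; simp
  have m1 : IntegrableOn (fun y : ℝ => hq x δ y * hh x δ y * ((y:ℂ)^((2-n : ℝ):ℂ) / (2-n))) (Ioi 1) := by
    refine Integrable.mono' (((cpi (2-n) (by linarith)).const_mul (K/‖(2-n:ℂ)‖))) ?_ ?_
    · exact (((hq_cont x δ).mul (hh_cont x δ)).continuousOn.mul ((cp _).div_const _)).aestronglyMeasurable measurableSet_Ioi
    · refine (ae_restrict_mem measurableSet_Ioi).mono fun y hy => ?_
      rw [norm_mul, norm_div, nr _ y hy]
      have hy' : (1:ℝ) < y := hy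
      calc _ ≤ K * (y^(2-n)/‖(2-n:ℂ)‖) := by gcongr; exact hq1 y hy
        _ = _ := by ring
  have m2 : IntegrableOn (fun y : ℝ => hh x δ y * (y:ℂ)^((1-n:ℝ):ℂ)) (Ioi 1) := by
    refine Integrable.mono' (((cpi (1-n) (by linarith)).const_mul (1/x^2))) ?_ ?_
    · exact ((hh_cont x δ).continuousOn.mul (cp _)).aestronglyMeasurable measurableSet_Ioi
    · refine (ae_restrict_mem measurableSet_Ioi).mono fun y hy => ?_
      rw [norm_mul, nr _ y hy]
      have : (1:ℝ) < y := hy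
      gcongr
      exact hh_le hx δ y
  have key := integral_Ioi_of_hasDerivAt_of_tendsto' (a := 1) (m := 0)
    (f := fun y : ℝ => hh x δ y * ((y:ℂ)^((2-n : ℝ):ℂ) / (2-n)))
    (f' := fun y : ℝ => hq x δ y * hh x δ y * ((y:ℂ)^((2-n : ℝ):ℂ) / (2-n)) + hh x δ y * (y:ℂ)^((1-n:ℝ):ℂ)) ?_ (m1.add m2) ?_
  · rw [integral_add m1 m2] at key
    have e1 : (∫ y in Ioi (1:ℝ), fx x δ y * (y:ℂ) ^ (-(n:ℂ) - 1)) = ∫ y in Ioi (1:ℝ), hh x δ y * (y:ℂ)^((1-n:ℝ):ℂ) := by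
      refine setIntegral_congr_fun measurableSet_Ioi fun y hy => ?_
      have hy : (1:ℝ) < y := hy
      have hy0 : (y:ℂ) ≠ 0 := by exact_mod_cast (by linarith : y ≠ 0)
      rw [fx_hh, show ((1-n:ℝ):ℂ) = (-(n:ℂ)-1) + 2 by push_cast; ring, Complex.cpow_add _ _ hy0]
      rw [Complex.cpow_ofNat]
      ring
    have e2 : UU x δ (-n) = 4 * hh x δ 1 / ((n-2)*(n+2)) - ∫ y in Ioi (1:ℝ), hq x δ y * hh x δ y * ((y:ℂ)^((2-n : ℝ):ℂ) / (2-n)) := by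
      unfold UU
      rw [e1, fx_hh]
      simp only [Complex.ofReal_one, Complex.one_cpow] at key ⊢
      have n2'' : (2:ℂ) - n ≠ 0 := by intro h; apply n2; linear_combination -h
      have n3'' : (2:ℂ) + n ≠ 0 := by rwa [add_comm]
      have : hh x δ 1 * (1 / (2 - (n:ℂ))) + (4 * hh x δ 1 / ((n-2)*(n+2)) + 1 ^ 2 * hh x δ 1 / (2 - -(n:ℂ))) = 0 := by
        rw [sub_neg_eq_add]
        field_simp
        ring
      linear_combination key - this
    have b1 : ‖∫ y in Ioi (1:ℝ), hq x δ y * hh x δ y * ((y:ℂ)^((2-n : ℝ):ℂ) / (2-n))‖ ≤ ∫ y in Ioi (1:ℝ), K/(n-2) * y^(2-n) := by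
      apply norm_integral_le_of_norm_le ((cpi (2-n) (by linarith)).const_mul _)
      refine (ae_restrict_mem measurableSet_Ioi).mono fun y hy => ?_
      rw [norm_mul, norm_div, nr _ y hy]
      have : ‖(2:ℂ)-n‖ = n - 2 := by
        rw [norm_sub_rev]
        have : (n:ℂ)-2 = ((n-2:ℝ):ℂ) := by push_cast; ring
        rw [this, Complex.norm_real, Real.norm_of_nonneg (by linarith)]
      rw [this]
      have hy' : (1:ℝ) < y := hy
      have : 0 < n-2 := by linarith
      calc _ ≤ K * (y^(2-n)/(n-2)) := by gcongr; exact hq1 y hy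
        _ = _ := by ring
    rw [integral_const_mul, integral_Ioi_rpow_of_lt (by linarith) one_pos] at b1
    have b2 : ‖4 * hh x δ 1 / (((n:ℂ)-2)*(n+2))‖ ≤ 4 / x^2 / (n^2-4) := by
      have : ((n:ℂ)-2)*(n+2) = ((n^2-4:ℝ):ℂ) := by push_cast; ring
      have h3 : 0 < n^2-4 := by nlinarith
      rw [this, norm_div, Complex.norm_real, Real.norm_of_nonneg h3.le, norm_mul]
      have := hh_le hx δ 1
      gcongr
      simp; simp at this; rw [div_eq_mul_inv]; gcongr
    rw [e2]
    refine (norm_sub_le _ _).trans (add_le_add b2 (b1.trans (le_of_eq ?_)))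
    rw [Real.one_rpow]
    have h3 : n - 3 ≠ 0 := by linarith
    have h4 : 2 - n + 1 ≠ 0 := by linarith
    have h5 : n - 2 ≠ 0 := by linarith
    field_simp
    ring
  · intro y hy
    have hy : (1:ℝ) ≤ y := hy
    have := hasDerivAt_ofReal_cpow_const' (x := y) (r := ((1-n:ℝ):ℂ)) (by linarith) (by intro h; have := congrArg Complex.re h; simp at this; linarith)
    rw [show ((1-n:ℝ):ℂ) + 1 = ((2-n:ℝ):ℂ) by push_cast; ring] at this
    have := (hh_deriv (x := x) δ y).mul this
    rw [show ((2:ℂ)-n) = ((2-n:ℝ):ℂ) by push_cast; ring]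
    exact this
  · rw [tendsto_zero_iff_norm_tendsto_zero]
    have : Tendsto (fun y : ℝ => 1/x^2 * (y^(-(n-2)) / ‖(2-n:ℂ)‖)) atTop (𝓝 (1/x^2*(0/‖(2-n:ℂ)‖))) :=
      ((tendsto_rpow_neg_atTop (by linarith)).div_const _).const_mul _
    rw [zero_div, mul_zero] at this
    refine squeeze_zero' (Eventually.of_forall fun y => norm_nonneg _) ?_ this
    filter_upwards [eventually_gt_atTop 1] with y hy
    rw [norm_mul, norm_div, nr _ y hy, show 2 - n = -(n-2) by ring]
    gcongr
    exact hh_le hx δ y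

lemma UU_one {x : ℝ} (hx : 0 < x) (δ : ℝ) : ‖UU x δ 1 - x * ∫ t in Ioi (0:ℝ), gg δ t‖ ≤ 2 / x^2 := by
  rw [UU_split hx δ (by norm_num)]
  have : mellin (gg δ) 1 = ∫ t in Ioi (0:ℝ), gg δ t := by simp [mellin]
  rw [this, Complex.cpow_one, sub_right_comm, sub_self, zero_sub, norm_neg]
  refine (norm_add_le _ _).trans ?_
  have b1 : ‖∫ y in (0:ℝ)..1, fx x δ y * (y:ℂ) ^ ((1:ℂ) - 1)‖ ≤ 1/x^2 * |1-0| := by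
    apply intervalIntegral.norm_integral_le_of_norm_le_const
    intro y hy
    rw [uIoc_of_le zero_le_one] at hy
    rw [fx_hh]; simp
    have := hh_le hx δ y
    have h2 : y^2 ≤ 1 := by nlinarith [hy.1, hy.2]
    simp at this
    calc _ ≤ 1 * (x^2)⁻¹ := by gcongr
      _ = _ := by ring
  have b2 : ‖fx x δ 1 / (2 - 1)‖ ≤ 1/x^2 := by
    norm_num; simpa using fx1_le hx δ
  calc _ ≤ 1/x^2 * |1-0| + 1/x^2 := add_le_add b1 b2
    _ = _ := by simp; ring

lemma hasSum_tele : HasSum (fun j : ℕ => 1 / (((j:ℝ)+1)*(j+2))) 1 := by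
  rw [hasSum_iff_tendsto_nat_of_nonneg (fun j => by positivity)]
  have : ∀ n : ℕ, ∑ i ∈ Finset.range n, 1 / (((i:ℝ)+1)*(i+2)) = 1 - 1/((n:ℝ)+1) := by
    intro n
    induction n with
    | zero => simp
    | succ k ih => rw [Finset.sum_range_succ, ih]; push_cast; field_simp; ring
  simp_rw [this]
  have := (tendsto_one_div_add_atTop_nhds_zero_nat (𝕜 := ℝ)).const_sub 1
  simpa using this

variable {q : ℕ} [NeZero q] {χ : DirichletCharacter ℂ q}

lemma gamma_small {x : ℝ} (hx : 10 ≤ x) {δ : ℝ} (hl : 2 * Real.pi * |δ| ≤ x^3/100) :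
    ‖∑' j : ℕ, - UU x δ (-(kap χ : ℂ) - 2 * j)‖ ≤ 6.03 := by
  have x0 : 0 < x := by linarith
  have hk : 0 ≤ kap χ ∧ kap χ ≤ 1 := by rcases kap_cases (χ := χ) with h | h <;> rw [h] <;> norm_num
  have x2 : 1/x^2 ≤ 0.01 := by rw [div_le_iff₀ (by positivity)]; nlinarith
  have x3 : (2 * Real.pi * |δ| / x + 1/x) / x^2 ≤ 0.011 := by
    rw [div_le_iff₀ (by positivity), ← add_div, div_le_iff₀ x0]
    nlinarith [mul_pos x0 x0, mul_self_nonneg (x-10)]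
  have := hasSum_tele.mul_left 6.03
  rw [mul_one] at this
  refine tsum_of_norm_bounded this fun j => ?_
  rw [norm_neg]
  have small : ‖UU x δ (-(kap χ : ℂ) - 2 * j)‖ ≤ 1.005 := by
    refine (UU_le x0 δ (by simp; linarith [hk.1, (Nat.cast_nonneg j : (0:ℝ) ≤ j)])).trans ?_
    rw [show 1/(2*x^2) = (1/x^2)/2 by ring]; linarith
  rcases (by omega : j = 0 ∨ j = 1 ∨ 2 ≤ j) with h | h | h
  · subst h; refine small.trans ?_; norm_num
  · subst h; refine small.trans ?_; norm_num
  · have hj : (2:ℝ) ≤ j := by exact_mod_cast h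
    have := UU_far x0 δ (n := kap χ + 2 * j) (by linarith [hk.1])
    rw [show -((kap χ + 2 * j : ℝ):ℂ) = -(kap χ : ℂ) - 2 * j by push_cast; ring] at this
    refine this.trans ?_
    have k := hk.1
    have d1 : 4 * (((j:ℝ)+1)*(j-1)) ≤ (kap χ + 2 * j)^2-4 := by nlinarith
    have d2 : (2*j-2)*(2*j-3) ≤ (kap χ + 2 * j-2)*(kap χ + 2 * j-3) := by nlinarith
    have p1 : 0 < 4 * (((j:ℝ)+1)*(j-1)) := mul_pos four_pos (mul_pos (by linarith) (by linarith))
    have p2 : 0 < (2*(j:ℝ)-2)*(2*j-3) := mul_pos (by linarith) (by linarith)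
    calc _ ≤ 0.04 / (4 * (((j:ℝ)+1)*(j-1))) + 0.011 / ((2*j-2)*(2*j-3)) := by
            have : 4/x^2 ≤ 0.04 := by rw [div_eq_mul_one_div]; linarith
            gcongr
      _ ≤ 0.04 * (1 / (((j:ℝ)+1)*(j+2))) + 0.066 * (1 / (((j:ℝ)+1)*(j+2))) := by
            gcongr ?_ + ?_
            · rw [mul_one_div]; apply div_le_div_of_nonneg_left (by norm_num) (by positivity); nlinarith
            · rw [mul_one_div, div_le_div_iff₀ p2 (by positivity)]; nlinarith
      _ ≤ _ := by
            have : 0 ≤ 1 / (((j:ℝ)+1)*(j+2)) := by positivity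
            linarith

theorem small_terms (hχ : χ.IsPrimitive) {x : ℝ} (hx : 10 ≤ x) {δ : ℝ} (hl : 2 * Real.pi * |δ| ≤ x^3/100) :
    Summable (fun ρ => mul' (Xi χ) ρ * (x^ρ.re * ‖mellin (gg δ) ρ‖)) ∧
    ‖(∑' n : ℕ, (ArithmeticFunction.vonMangoldt n : ℂ) * χ (n : ZMod q) * fx x δ n) -
      (if q = 1 then (∫ t in Ioi (0:ℝ), gg δ t) * x else 0)‖ ≤
      (∑' ρ, mul' (Xi χ) ρ * (x^ρ.re * ‖mellin (gg δ) ρ‖)) + 7.3 + MM x δ * (Real.log (q * 100) + 2) := by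
  have x0 : 0 < x := by linarith
  have x2 : 1/x^2 ≤ 0.01 := by rw [div_le_iff₀ (by positivity)]; nlinarith
  have hX := Xi_XiLike hχ
  have mn : ∀ ρ, 0 ≤ mul' (Xi χ) ρ := fun ρ => by unfold mul'; positivity
  have hU := (Am_zeros hχ x0 δ).1.summable
  have hsq := hX.summable_sq.mul_left (MM x δ)
  have R : ∀ ρ, ‖(mul' (Xi χ) ρ : ℂ) * UU x δ ρ - mul' (Xi χ) ρ * ((x:ℂ)^ρ * mellin (gg δ) ρ)‖ ≤ MM x δ * (mul' (Xi χ) ρ / ‖2-ρ‖^2) := by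
    intro ρ
    by_cases hm : mul' (Xi χ) ρ = 0
    · simp [hm]
    · obtain ⟨h0, h1⟩ := hX.strip ρ (XiLike.zero_of_mul ρ hm)
      have := RR_bound x0 δ h0 h1
      rw [UU_split x0 δ (by linarith), ← mul_sub, sub_right_comm, sub_self, zero_sub, norm_mul, norm_neg, Complex.norm_real, Real.norm_of_nonneg (mn ρ)]
      calc _ ≤ mul' (Xi χ) ρ * (MM x δ / ‖2 - ρ‖^2) := by gcongr
        _ = _ := by ring
  have nG : ∀ ρ, ‖(mul' (Xi χ) ρ : ℂ) * ((x:ℂ)^ρ * mellin (gg δ) ρ)‖ = mul' (Xi χ) ρ * (x^ρ.re * ‖mellin (gg δ) ρ‖) := by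
    intro ρ
    rw [norm_mul, norm_mul, Complex.norm_real, Real.norm_of_nonneg (mn ρ), Complex.norm_cpow_eq_rpow_re_of_pos x0]
  have hG : Summable (fun ρ => mul' (Xi χ) ρ * (x^ρ.re * ‖mellin (gg δ) ρ‖)) := by
    refine Summable.of_nonneg_of_le (fun ρ => by have := mn ρ; positivity) (fun ρ => ?_) (hU.norm.add hsq)
    rw [← nG]
    have := norm_sub_norm_le ((mul' (Xi χ) ρ : ℂ) * ((x:ℂ)^ρ * mellin (gg δ) ρ)) ((mul' (Xi χ) ρ : ℂ) * UU x δ ρ)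
    rw [norm_sub_rev] at this
    linarith [R ρ]
  refine ⟨hG, ?_⟩
  have Z : ‖∑' ρ, (mul' (Xi χ) ρ : ℂ) * UU x δ ρ‖ ≤ (∑' ρ, mul' (Xi χ) ρ * (x^ρ.re * ‖mellin (gg δ) ρ‖)) + MM x δ * (Real.log (q * 100) + 2) := by
    refine (tsum_of_norm_bounded (hG.add hsq).hasSum fun ρ => ?_).trans ?_
    · have := norm_sub_norm_le ((mul' (Xi χ) ρ : ℂ) * UU x δ ρ) ((mul' (Xi χ) ρ : ℂ) * ((x:ℂ)^ρ * mellin (gg δ) ρ))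
      rw [nG] at this
      linarith [R ρ]
    · rw [hG.tsum_add hsq, tsum_mul_left]
      gcongr
      · exact MM_nonneg x0 δ
      · have := W_le_clamp hχ (t := 0) (T := 100) le_rfl (by norm_num)
        simp only [Complex.ofReal_zero, zero_mul, add_zero] at this
        linarith [hX.tsum_sq_le]
  have Gm := gamma_small (χ := χ) hx hl
  have b1 : ‖- logDeriv χ.LFunction 2 * fx x δ 1‖ ≤ 0.0061 := by
    rw [norm_mul, norm_neg]
    have h := mul_le_mul (L_logDeriv_le (χ := χ) 2 (by simp)) ((fx1_le x0 δ).trans x2) (norm_nonneg _) (by norm_num)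
    linarith
  have b2 : ‖(if q = 1 then UU x δ 0 + UU x δ 1 else 0) - (if q = 1 then (∫ t in Ioi (0:ℝ), gg δ t) * x else 0)‖ ≤ 1.025 := by
    split_ifs
    · have c1 := UU_le x0 δ (ρ := 0) (by simp)
      have c2 := UU_one x0 δ
      have c3 : 1/(2*x^2) ≤ 0.005 := by rw [show 1/(2*x^2) = (1/x^2)/2 by ring]; linarith
      have c4 : 2/x^2 ≤ 0.02 := by rw [div_eq_mul_one_div]; linarith
      rw [add_sub_assoc, mul_comm _ (x:ℂ)]
      refine (norm_add_le _ _).trans ?_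
      linarith
    · norm_num
  rw [explicit_formula hχ x0 δ]
  set A := - logDeriv χ.LFunction 2 * fx x δ 1
  set B := ∑' j : ℕ, - UU x δ (-(kap χ : ℂ) - 2 * j)
  set C := (if q = 1 then UU x δ 0 + UU x δ 1 else 0)
  set D := ∑' ρ, (mul' (Xi χ) ρ : ℂ) * UU x δ ρ
  set C' := (if q = 1 then (∫ t in Ioi (0:ℝ), gg δ t) * x else 0)
  rw [show A + B + C - D - C' = A + B + (C - C') - D by ring]
  have t1 := norm_sub_le (A + B + (C - C')) D
  have t2 := norm_add₃_le (a := A) (b := B) (c := C - C')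
  linarith
end

section
open MeasureTheory Set Filter Topology
open scoped ComplexConjugate
set_option linter.unusedSectionVars false
set_option linter.unusedSimpArgs false

lemma pair_set (δ : ℝ) {c : ℝ} (hc : -2 < c) (ρ : ℂ) {A : Set ℝ} (hA : MeasurableSet A) (hs : A ⊆ Ioi 0)
    (hi : IntegrableOn (fun y : ℝ => (y:ℂ)^(ρ - 1 - c)) A) :
    ∫ y in A, gg δ y * (y:ℂ)^(ρ-1) = (1 / (2 * Real.pi) : ℂ) *
      ∫ t : ℝ, mellin (gg δ) (c + t * Complex.I) * ∫ y in A, (y:ℂ)^(ρ-1-(c + t * Complex.I)) := by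
  have e0 : ∀ (s : ℂ), ∀ y ∈ Ioi (0:ℝ), (y:ℂ) ^ (-s) * A.indicator (fun y : ℝ => (y:ℂ)^(ρ-1)) y = A.indicator (fun y : ℝ => (y:ℂ)^(ρ-1-s)) y := by
    intro s y hy
    have hy0 : (y:ℂ) ≠ 0 := by exact_mod_cast (ne_of_gt (hy : (0:ℝ) < y))
    by_cases h : y ∈ A
    · rw [indicator_of_mem h, indicator_of_mem h, ← Complex.cpow_add _ _ hy0]; congr 1; ring
    · rw [indicator_of_notMem h, indicator_of_notMem h, mul_zero]
  have e1 : ∀ F : ℝ → ℂ, ∫ y in Ioi (0:ℝ), A.indicator F y = ∫ y in A, F y := by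
    intro F
    rw [setIntegral_indicator hA, inter_eq_self_of_subset_right hs]
  have := pairing (gg δ) c (mellin_gg_conv δ (by simpa using hc)) (mellin_gg_vert δ hc) (gg_cont δ).continuousOn (A.indicator (fun y : ℝ => (y:ℂ)^(ρ-1))) ?_
  · rw [← e1]
    rw [show (∫ y in Ioi (0:ℝ), A.indicator (fun y => gg δ y * (y:ℂ)^(ρ-1)) y) = ∫ y in Ioi (0:ℝ), gg δ y * A.indicator (fun y : ℝ => (y:ℂ)^(ρ-1)) y from ?_, this]
    · congr 2; ext t; congr 1
      rw [← e1]
      exact setIntegral_congr_fun measurableSet_Ioi (e0 _)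
    · congr 1; ext y; by_cases h : y ∈ A <;> simp [h]
  · refine IntegrableOn.congr_fun ?_ (fun y hy => (e0 (c:ℂ) y hy).symm) measurableSet_Ioi
    exact (hi.integrable_indicator hA).integrableOn

noncomputable def EE (δ c : ℝ) (ρ : ℂ) : ℂ := (1 / (2 * Real.pi) : ℂ) * ∫ t : ℝ, mellin (gg δ) (c + t * Complex.I) * (1 / (c + t * Complex.I - ρ))

lemma EE_gt (δ : ℝ) {c : ℝ} (hc : -2 < c) {ρ : ℂ} (h : ρ.re < c) : EE δ c ρ = ∫ y in Ioi (1:ℝ), gg δ y * (y:ℂ)^(ρ-1) := by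
  rw [pair_set δ hc ρ measurableSet_Ioi (Ioi_subset_Ioi zero_le_one) (integrableOn_Ioi_cpow_of_lt (by simp; linarith) one_pos), EE]
  congr 2; ext t; congr 1
  rw [integral_Ioi_cpow_of_lt (by simp; linarith) one_pos]
  have : (c:ℂ) + t * Complex.I - ρ ≠ 0 := by intro h'; have := congrArg Complex.re h'; simp at this; linarith
  simp only [Complex.ofReal_one, Complex.one_cpow]
  rw [show ρ - 1 - (c + t * Complex.I) + 1 = -((c:ℂ) + t * Complex.I - ρ) by ring]
  field_simp

lemma EE_lt (δ : ℝ) {c : ℝ} (hc : -2 < c) {ρ : ℂ} (h : c < ρ.re) : EE δ c ρ = - ∫ y in Ioc (0:ℝ) 1, gg δ y * (y:ℂ)^(ρ-1) := by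
  rw [pair_set δ hc ρ measurableSet_Ioc Ioc_subset_Ioi_self ?_, EE, ← mul_neg, ← integral_neg]
  · congr 2; ext t
    rw [← intervalIntegral.integral_of_le zero_le_one, integral_cpow (by left; simp; linarith)]
    have h0 : (c:ℂ) + t * Complex.I - ρ ≠ 0 := by intro h'; have := congrArg Complex.re h'; simp at this; linarith
    rw [show ρ - 1 - (c + t * Complex.I) + 1 = -((c:ℂ) + t * Complex.I - ρ) by ring]
    simp only [Complex.ofReal_one, Complex.one_cpow, Complex.ofReal_zero]
    rw [Complex.zero_cpow (neg_ne_zero.2 h0)]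
    field_simp
    ring
  · rw [← intervalIntegrable_iff_integrableOn_Ioc_of_le zero_le_one]
    exact intervalIntegral.intervalIntegrable_cpow' (by simp; linarith)

lemma EE_int (δ : ℝ) {c : ℝ} (hc : -2 < c) {ρ : ℂ} (h : ρ.re ≠ c) :
    Integrable (fun t : ℝ => mellin (gg δ) (c + t * Complex.I) * (1 / (c + t * Complex.I - ρ))) := by
  have ne : ∀ t : ℝ, (c:ℂ) + t * Complex.I - ρ ≠ 0 := fun t h' => by
    have := congrArg Complex.re h'; simp at this; exact h (by linarith)
  refine Integrable.mul_bdd (c := 1/|c - ρ.re|) (mellin_gg_vert δ hc) (Continuous.aestronglyMeasurable ?_) (Eventually.of_forall fun t => ?_)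
  · exact Continuous.div continuous_const (by fun_prop) ne
  · rw [norm_div, norm_one]
    have h1 := Complex.abs_re_le_norm ((c:ℂ) + t * Complex.I - ρ)
    simp at h1
    have : 0 < |c - ρ.re| := abs_pos.2 (by intro h'; apply h; linarith)
    gcongr

noncomputable def kk (w : ℂ) : ℂ := 1 / w - 1 / 2 * (1 / (w + 3)) - 1 / 2 * (1 / (w - 3))

lemma kk_norm {w : ℂ} (hw : |w.re| = 3/2) : ‖kk w‖ ≤ 2 / (9/4 + w.im^2) := by
  have hw2 : w.re^2 = 9/4 := by rw [← sq_abs, hw]; norm_num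
  have sq : ‖w‖^2 = 9/4 + w.im^2 := by rw [← Complex.normSq_eq_norm_sq, Complex.normSq_apply]; nlinarith
  have p : 0 < 9/4 + w.im^2 := by positivity
  have w0 : w ≠ 0 := by rintro rfl; norm_num at hw2
  have sq2 : (9/2 * ‖w‖)^2 ≤ ‖w^2-9‖^2 := by
    rw [mul_pow, sq, ← Complex.normSq_eq_norm_sq, Complex.normSq_apply]
    simp [pow_two w]
    nlinarith [sq_nonneg w.im, sq_nonneg (w.im^2)]
  have h2 : 9/2 * ‖w‖ ≤ ‖w^2-9‖ := (pow_le_pow_iff_left₀ (by positivity) (by positivity) two_ne_zero).1 sq2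
  have w1 : 0 < ‖w‖ := norm_pos_iff.2 w0
  have h9 : w^2 - 9 ≠ 0 := norm_pos_iff.1 (by nlinarith)
  have a1 : w + 3 ≠ 0 := by intro h; apply h9; linear_combination (w-3)*h
  have a2 : w - 3 ≠ 0 := by intro h; apply h9; linear_combination (w+3)*h
  have e : kk w = -9 / (w * (w^2-9)) := by
    unfold kk
    have : w^2-9 = (w+3)*(w-3) := by ring
    rw [this]; field_simp; ring
  rw [e, norm_div, norm_mul, ← sq]
  calc _ ≤ 9 / (‖w‖ * (9/2*‖w‖)) := by gcongr; simp
    _ = _ := by field_simp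

lemma mellin_rep (δ : ℝ) {ρ : ℂ} (h : ρ.re = 1/2) :
    ‖mellin (gg δ) ρ‖ ≤ 1 / (2 * Real.pi) * ∫ t : ℝ, (‖mellin (gg δ) ((-1:ℝ) + t * Complex.I)‖ + ‖mellin (gg δ) ((2:ℝ) + t * Complex.I)‖) * (2 / (9/4 + (t - ρ.im)^2)) := by
  have hm : IntegrableOn (fun y => gg δ y * (y:ℂ) ^ (ρ - 1)) (Ioi 0) := by
    refine (mellin_gg_conv δ (s := ρ) (by linarith)).congr_fun (fun y _ => ?_) measurableSet_Ioi
    simp only [smul_eq_mul]; ring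
  have e : mellin (gg δ) ρ = (∫ y in Ioc (0:ℝ) 1, gg δ y * (y:ℂ) ^ (ρ - 1)) + ∫ y in Ioi (1:ℝ), gg δ y * (y:ℂ) ^ (ρ - 1) := by
    rw [← setIntegral_union (Ioc_disjoint_Ioi le_rfl) measurableSet_Ioi (hm.mono_set Ioc_subset_Ioi_self)
      (hm.mono_set (Ioi_subset_Ioi zero_le_one)), Ioc_union_Ioi_eq_Ioi zero_le_one, mellin]
    congr 1; ext y; simp only [smul_eq_mul]; ring
  have n1 : (-2:ℝ) < -1 := by norm_num
  have n2 : (-2:ℝ) < 2 := by norm_num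
  have i : ∀ c : ℝ, -2 < c → c = -1 ∨ c = 2 → Integrable (fun t : ℝ => mellin (gg δ) (c + t * Complex.I) * kk (c + t * Complex.I - ρ)) ∧
      (1 / (2 * Real.pi) : ℂ) * (∫ t : ℝ, mellin (gg δ) (c + t * Complex.I) * kk (c + t * Complex.I - ρ)) = EE δ c ρ - 1/2 * EE δ c (ρ-3) - 1/2 * EE δ c (ρ+3) := by
    intro c hc hc2
    have i1 := EE_int δ hc (ρ := ρ) (by rcases hc2 with h' | h' <;> rw [h, h'] <;> norm_num)
    have i2 := EE_int δ hc (ρ := ρ-3) (by rcases hc2 with h' | h' <;> simp [h, h'] <;> norm_num)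
    have i3 := EE_int δ hc (ρ := ρ+3) (by rcases hc2 with h' | h' <;> simp [h, h'] <;> norm_num)
    have ee : (fun t : ℝ => mellin (gg δ) (c + t * Complex.I) * kk (c + t * Complex.I - ρ)) = fun t : ℝ =>
      mellin (gg δ) (c + t * Complex.I) * (1 / (c + t * Complex.I - ρ)) - 1/2 * (mellin (gg δ) (c + t * Complex.I) * (1 / (c + t * Complex.I - (ρ-3)))) -
      1/2 * (mellin (gg δ) (c + t * Complex.I) * (1 / (c + t * Complex.I - (ρ+3)))) := by
      ext t; unfold kk
      rw [show (c + t * Complex.I - (ρ-3)) = c + t * Complex.I - ρ + 3 by ring, show (c + t * Complex.I - (ρ+3)) = c + t * Complex.I - ρ - 3 by ring]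
      ring
    have j := i1.sub (i2.const_mul (1/2))
    have k := j.sub (i3.const_mul (1/2))
    refine ⟨by rw [ee]; exact k, ?_⟩
    rw [ee]
    have := integral_sub j (i3.const_mul (1/2))
    simp only [Pi.sub_apply] at this
    rw [this, integral_sub i1 (i2.const_mul _), integral_const_mul, integral_const_mul]
    unfold EE; ring
  have rep : mellin (gg δ) ρ = (1 / (2 * Real.pi) : ℂ) * ((∫ t : ℝ, mellin (gg δ) ((2:ℝ) + t * Complex.I) * kk ((2:ℝ) + t * Complex.I - ρ)) - ∫ t : ℝ, mellin (gg δ) ((-1:ℝ) + t * Complex.I) * kk ((-1:ℝ) + t * Complex.I - ρ)) := by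
    rw [mul_sub, (i 2 n2 (Or.inr rfl)).2, (i (-1) n1 (Or.inl rfl)).2, e]
    rw [EE_gt δ n2 (by linarith), EE_gt δ n2 (ρ := ρ-3) (by simp; linarith), EE_lt δ n2 (ρ := ρ+3) (by simp; linarith),
      EE_lt δ n1 (ρ := ρ) (by linarith), EE_gt δ n1 (ρ := ρ-3) (by simp; linarith), EE_lt δ n1 (ρ := ρ+3) (by simp; linarith)]
    ring
  have bd : ∀ c : ℝ, -2 < c → c = -1 ∨ c = 2 → Integrable (fun t : ℝ => ‖mellin (gg δ) (c + t * Complex.I)‖ * (2 / (9/4 + (t - ρ.im)^2))) ∧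
      ‖∫ t : ℝ, mellin (gg δ) (c + t * Complex.I) * kk (c + t * Complex.I - ρ)‖ ≤ ∫ t : ℝ, ‖mellin (gg δ) (c + t * Complex.I)‖ * (2 / (9/4 + (t - ρ.im)^2)) := by
    intro c hc hc2
    have I1 : Integrable (fun t : ℝ => ‖mellin (gg δ) (c + t * Complex.I)‖ * (2 / (9/4 + (t - ρ.im)^2))) := by
      refine Integrable.mul_bdd (c := 1) (mellin_gg_vert δ hc).norm (Continuous.aestronglyMeasurable ?_) (Eventually.of_forall fun t => ?_)
      · exact Continuous.div continuous_const (by fun_prop) (fun t => by positivity)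
      · rw [Real.norm_of_nonneg (by positivity), div_le_one (by positivity)]; nlinarith [sq_nonneg (t - ρ.im)]
    refine ⟨I1, norm_integral_le_of_norm_le I1 (Eventually.of_forall fun t => ?_)⟩
    rw [norm_mul]
    gcongr
    have := kk_norm (w := c + t * Complex.I - ρ) (by simp [h]; rcases hc2 with h' | h' <;> rw [h'] <;> norm_num [abs_of_pos, abs_of_neg])
    simpa using this
  obtain ⟨j1, k1⟩ := bd 2 n2 (Or.inr rfl)
  obtain ⟨j2, k2⟩ := bd (-1) n1 (Or.inl rfl)
  simp_rw [add_mul]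
  rw [rep, integral_add j2 j1, norm_mul]
  have : ‖(1 / (2 * Real.pi) : ℂ)‖ = 1 / (2 * Real.pi) := by simp [abs_of_pos Real.pi_pos]
  rw [this]
  gcongr
  refine (norm_sub_le _ _).trans ?_
  linarith

variable {q : ℕ} [NeZero q] {χ : DirichletCharacter ℂ q}

lemma ker_half (t : ℝ) {ρ : ℂ} (h : ρ.re = 1/2) : XiLike.ker (2 + t * Complex.I) ρ = 3 / (9/4 + (t - ρ.im)^2) := by
  have e : 1 - conj ρ = ρ := by apply Complex.ext <;> simp [h]; norm_num
  have p : 0 < 9/4 + (t - ρ.im)^2 := by positivity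
  unfold XiLike.ker
  rw [e, XiLike.inv_re, ← Complex.normSq_eq_norm_sq, Complex.normSq_apply]
  simp only [Complex.sub_re, Complex.add_re, Complex.sub_im, Complex.add_im, Complex.mul_re, Complex.mul_im, h]
  norm_num
  rw [← sq]
  field_simp; norm_num

lemma low_zeros (hχ : χ.IsPrimitive) (δ : ℝ) {T : ℝ} (hT : 100 ≤ T) (S : Finset ℂ) (hS : ∀ ρ ∈ S, mul' (Xi χ) ρ ≠ 0 → ρ.re = 1/2 ∧ |ρ.im| ≤ T) :
    ∑ ρ ∈ S, mul' (Xi χ) ρ * ‖mellin (gg δ) ρ‖ ≤ 1 / (3 * Real.pi) * (Real.log (q * T) + 2) *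
      ((∫ t : ℝ, ‖mellin (gg δ) ((-1:ℝ) + t * Complex.I)‖) + ∫ t : ℝ, ‖mellin (gg δ) ((2:ℝ) + t * Complex.I)‖) := by
  have hX := Xi_XiLike hχ
  have mn : ∀ ρ, 0 ≤ mul' (Xi χ) ρ := fun ρ => by unfold mul'; positivity
  have n1 : (-2:ℝ) < -1 := by norm_num
  have n2 : (-2:ℝ) < 2 := by norm_num
  set N : ℝ → ℝ := fun t => ‖mellin (gg δ) ((-1:ℝ) + t * Complex.I)‖ + ‖mellin (gg δ) ((2:ℝ) + t * Complex.I)‖ with hN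
  have N0 : ∀ t, 0 ≤ N t := fun t => by positivity
  have NI : Integrable N := (mellin_gg_vert δ n1).norm.add (mellin_gg_vert δ n2).norm
  have NIk : ∀ ρ : ℂ, Integrable (fun t => N t * (2 / (9/4 + (t - ρ.im)^2))) := by
    intro ρ
    refine Integrable.mul_bdd (c := 1) NI (Continuous.aestronglyMeasurable ?_) (Eventually.of_forall fun t => ?_)
    · exact Continuous.div continuous_const (by fun_prop) (fun t => by positivity)
    · rw [Real.norm_of_nonneg (by positivity), div_le_one (by positivity)]; nlinarith [sq_nonneg (t - ρ.im)]
  have key : ∀ u : ℝ, |u| ≤ T → ∑ ρ ∈ S, mul' (Xi χ) ρ * (3 / (9/4 + (u - ρ.im)^2)) ≤ Real.log (q*T) + 2 := by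
    intro u hu
    have h1 := W_le_clamp hχ hT hu
    have h2 := hX.hasSum_W (2 + u * Complex.I) (by simp)
    have h3 := sum_le_hasSum S (fun ρ _ => ?_) h2
    · refine le_trans (le_trans (Finset.sum_le_sum fun ρ hρ => ?_) h3) (by linarith)
      by_cases hm : mul' (Xi χ) ρ = 0
      · simp [hm]
      · rw [ker_half u (hS ρ hρ hm).1]
    · by_cases hm : mul' (Xi χ) ρ = 0
      · simp [hm]
      · have := XiLike.ker_term_nonneg (2 + u * Complex.I) ρ (by simp) (hX.strip ρ (XiLike.zero_of_mul ρ hm))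
        exact mul_nonneg (mn ρ) (add_nonneg this.1 this.2)
  have key2 : ∀ t : ℝ, ∑ ρ ∈ S, mul' (Xi χ) ρ * (2 / (9/4 + (t - ρ.im)^2)) ≤ 2/3 * (Real.log (q*T) + 2) := by
    intro t
    set u := max (-T) (min t T) with hu
    have hu1 : |u| ≤ T := by
      rw [abs_le]; exact ⟨le_max_left _ _, max_le (by linarith) (min_le_right _ _)⟩
    refine le_trans ?_ (mul_le_mul_of_nonneg_left (key u hu1) (by norm_num))
    rw [Finset.mul_sum]
    refine Finset.sum_le_sum fun ρ hρ => ?_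
    by_cases hm : mul' (Xi χ) ρ = 0
    · simp [hm]
    · have h3 := abs_le.1 (hS ρ hρ hm).2
      have h4 : (u - ρ.im)^2 ≤ (t - ρ.im)^2 := by
        rcases le_total t T with a | a
        · rw [min_eq_left a] at hu
          rcases le_total (-T) t with b | b
          · rw [hu, max_eq_right b]
          · rw [hu, max_eq_left b]; nlinarith
        · rw [min_eq_right a, max_eq_right (by linarith)] at hu
          rw [hu]; nlinarith
      have := mn ρ
      calc _ ≤ mul' (Xi χ) ρ * (2 / (9/4 + (u - ρ.im)^2)) := by gcongr
        _ = _ := by ring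
  have pp := Real.pi_pos
  have st : ∑ ρ ∈ S, mul' (Xi χ) ρ * ‖mellin (gg δ) ρ‖ ≤ ∑ ρ ∈ S, 1/(2*Real.pi) * ∫ t, mul' (Xi χ) ρ * (N t * (2 / (9/4 + (t - ρ.im)^2))) := by
    refine Finset.sum_le_sum fun ρ hρ => ?_
    by_cases hm : mul' (Xi χ) ρ = 0
    · simp [hm]
    · rw [integral_const_mul]
      calc _ ≤ mul' (Xi χ) ρ * (1/(2*Real.pi) * ∫ t, N t * (2 / (9/4 + (t - ρ.im)^2))) := by
            have := mn ρ
            gcongr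
            exact mellin_rep δ (hS ρ hρ hm).1
        _ = _ := by ring
  refine st.trans ?_
  rw [← Finset.mul_sum, ← integral_finsetSum _ (fun ρ _ => (NIk ρ).const_mul _)]
  rw [← integral_add (mellin_gg_vert δ n1).norm (mellin_gg_vert δ n2).norm]
  have : ∫ t, ∑ ρ ∈ S, mul' (Xi χ) ρ * (N t * (2 / (9/4 + (t - ρ.im)^2))) ≤ ∫ t, N t * (2/3 * (Real.log (q*T) + 2)) := by
    refine integral_mono (integrable_finsetSum _ (fun ρ _ => (NIk ρ).const_mul _)) (NI.mul_const _) fun t => ?_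
    simp only
    refine le_trans (le_of_eq ?_) (mul_le_mul_of_nonneg_left (key2 t) (N0 t))
    rw [Finset.mul_sum]
    exact Finset.sum_congr rfl fun ρ _ => by ring
  rw [integral_mul_const] at this
  calc _ ≤ 1/(2*Real.pi) * ((∫ t, N t) * (2/3 * (Real.log (q*T) + 2))) := by gcongr
    _ = _ := by field_simp; rw [mul_comm]
end

section
open MeasureTheory Set Filter Topology
open scoped ComplexConjugate
set_option linter.unusedSectionVars false
set_option linter.unusedSimpArgs false

lemma planch (f : ℝ → ℂ) (c : ℝ) (hf : MellinConvergent f c)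
    (hV : Complex.VerticalIntegrable (mellin f) c) (hfc : ContinuousOn f (Ioi 0)) :
    ∫ t : ℝ, ‖mellin f (c + t * Complex.I)‖^2 = 2 * Real.pi * ∫ y in Ioi (0:ℝ), y^(2*c-1) * ‖f y‖^2 := by
  have hp : ∀ a b : ℝ, ∀ y : ℝ, 0 < y → (y:ℂ)^(-(c:ℂ) - b * Complex.I) * ((y:ℂ)^((2*c-1 : ℝ):ℂ) * conj (f y)) = conj ((y:ℂ)^((c:ℂ) + b * Complex.I - 1) * f y) := by
    intro a b y hy
    have y0 : (y:ℂ) ≠ 0 := by exact_mod_cast hy.ne'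
    have cj := Complex.cpow_conj (y:ℂ) ((c:ℂ) + b * Complex.I - 1) (by rw [Complex.arg_ofReal_of_nonneg hy.le]; exact Real.pi_pos.ne)
    rw [Complex.conj_ofReal] at cj
    rw [map_mul, ← cj, ← mul_assoc, ← Complex.cpow_add _ _ y0]
    simp only [Complex.conj_ofReal, map_add, map_sub, map_mul, Complex.conj_I, map_one]
    congr 2; push_cast; ring
  have := pairing f c hf hV hfc (fun y => (y:ℂ)^((2*c-1 : ℝ):ℂ) * conj (f y)) ?_
  · have e1 : ∀ t : ℝ, ∫ y in Ioi (0:ℝ), (y:ℂ) ^ (-((c:ℂ) + t * Complex.I)) * ((y:ℂ)^((2*c-1 : ℝ):ℂ) * conj (f y)) = conj (mellin f (c + t * Complex.I)) := by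
      intro t
      rw [mellin, ← integral_conj]
      refine setIntegral_congr_fun measurableSet_Ioi fun y hy => ?_
      have := hp 0 t y hy
      simp only [smul_eq_mul]
      rw [← this, neg_add, ← sub_eq_add_neg]
    simp_rw [e1] at this
    have e2 : ∀ t : ℝ, mellin f (c + t * Complex.I) * conj (mellin f (c + t * Complex.I)) = ((‖mellin f (c + t * Complex.I)‖^2 : ℝ) : ℂ) := by
      intro t; rw [Complex.mul_conj, Complex.normSq_eq_norm_sq]
    simp_rw [e2] at this
    rw [integral_complex_ofReal] at this
    have e3 : ∫ y in Ioi (0:ℝ), f y * ((y:ℂ)^((2*c-1 : ℝ):ℂ) * conj (f y)) = ((∫ y in Ioi (0:ℝ), y^(2*c-1) * ‖f y‖^2 : ℝ) : ℂ) := by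
      rw [← integral_complex_ofReal]
      refine setIntegral_congr_fun measurableSet_Ioi fun y hy => ?_
      have hy : 0 < y := hy
      have : f y * conj (f y) = ((‖f y‖^2 : ℝ):ℂ) := by rw [Complex.mul_conj, Complex.normSq_eq_norm_sq]
      rw [Complex.ofReal_mul, ← this, Complex.ofReal_cpow hy.le]; ring
    rw [e3] at this
    have h2 : (∫ y in Ioi (0:ℝ), y^(2*c-1) * ‖f y‖^2) = 1 / (2 * Real.pi) * ∫ t : ℝ, ‖mellin f (c + t * Complex.I)‖^2 := by exact_mod_cast this
    rw [h2, ← mul_assoc, mul_one_div_cancel (by positivity), one_mul]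
  · have h1 : IntegrableOn (fun y : ℝ => conj ((y:ℂ)^((c:ℂ) - 1) * f y)) (Ioi 0) := by
      have := Complex.conjCLE.toContinuousLinearMap.integrable_comp hf
      exact this
    refine h1.congr_fun (fun y hy => ?_) measurableSet_Ioi
    have := hp 0 0 y hy
    simpa using this.symm

noncomputable def FF (δ y : ℝ) : ℂ := (2 + y * hq 1 δ y) * gg δ y

lemma gg_hh (δ y : ℝ) : gg δ y = y^2 * hh 1 δ y := by
  rw [← fx_hh]; simp [fx]

lemma FF_mellin (δ : ℝ) {s : ℂ} (hs : -2 < s.re) : MellinConvergent (FF δ) s ∧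
    mellin (FF δ) s = 2 * mellin (gg δ) s + 2 * Real.pi * Complex.I * δ * mellin (gg δ) (s+1) - mellin (gg δ) (s+2) ∧
    mellin (FF δ) s = - s * mellin (gg δ) s := by
  have i0 := mellin_gg_conv δ hs
  have i1 := mellin_gg_conv δ (s := s+1) (by simp; linarith)
  have i2 := mellin_gg_conv δ (s := s+2) (by simp; linarith)
  have e : ∀ y ∈ Ioi (0:ℝ), (y:ℂ)^(s-1) * FF δ y = 2 * ((y:ℂ)^(s-1) * gg δ y) + 2 * Real.pi * Complex.I * δ * ((y:ℂ)^(s+1-1) * gg δ y) - (y:ℂ)^(s+2-1) * gg δ y := by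
    intro y hy
    have y0 : (y:ℂ) ≠ 0 := by exact_mod_cast (ne_of_gt (hy : (0:ℝ) < y))
    rw [show s + 1 - 1 = s - 1 + 1 by ring, show s + 2 - 1 = s - 1 + 1 + 1 by ring, Complex.cpow_add _ _ y0, Complex.cpow_add _ _ y0, Complex.cpow_add _ _ y0, Complex.cpow_one, FF, hq]
    push_cast; ring
  unfold MellinConvergent at i0 i1 i2 ⊢
  simp only [smul_eq_mul] at i0 i1 i2 ⊢
  have j1 := (i0.const_mul 2).add (i1.const_mul (2 * Real.pi * Complex.I * δ))
  have j2 := j1.sub i2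
  have c1 : IntegrableOn (fun t : ℝ => (t:ℂ)^(s-1) * FF δ t) (Ioi 0) :=
    IntegrableOn.congr_fun (f := fun y : ℝ => 2 * ((y:ℂ)^(s-1) * gg δ y) + 2 * Real.pi * Complex.I * δ * ((y:ℂ)^(s+1-1) * gg δ y) - (y:ℂ)^(s+2-1) * gg δ y) j2 (fun y hy => (e y hy).symm) measurableSet_Ioi
  refine ⟨c1, ?_, ?_⟩
  · unfold mellin
    simp only [smul_eq_mul]
    rw [setIntegral_congr_fun measurableSet_Ioi e]
    have a := integral_sub j1 i2
    have b := integral_add (i0.const_mul 2) (i1.const_mul (2 * Real.pi * Complex.I * δ))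
    simp only [Pi.add_apply] at a
    rw [a, b, integral_const_mul, integral_const_mul]
  · have cc : Continuous (fun y : ℝ => (y:ℂ)^(s+2) * hh 1 δ y) :=
      (Complex.continuous_ofReal_cpow_const (by simp; linarith)).mul (hh_cont 1 δ)
    have n2 : s + 2 ≠ 0 := by intro h; have := congrArg Complex.re h; simp at this; linarith
    have key := integral_Ioi_of_hasDerivAt_of_tendsto (a := 0) (m := 0) (f := fun y : ℝ => (y:ℂ)^(s+2) * hh 1 δ y)
      (f' := fun y : ℝ => s * ((y:ℂ)^(s-1) * gg δ y) + (y:ℂ)^(s-1) * FF δ y) cc.continuousWithinAt ?_ ((i0.const_mul s).add c1) ?_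
    · rw [integral_add (i0.const_mul s) c1, integral_const_mul] at key
      simp only [Complex.ofReal_zero, Complex.zero_cpow n2, zero_mul, sub_zero] at key
      unfold mellin
      simp only [smul_eq_mul]
      linear_combination key
    · intro y hy
      have hy : 0 < y := hy
      have := hasDerivAt_ofReal_cpow_const' (x := y) (r := s+1) (by linarith) (by intro h; apply n2; linear_combination h)
      rw [show s+1+1 = s+2 by ring] at this
      have := (this.const_mul (s+2)).mul (hh_deriv (x := 1) δ y)
      convert! this using 1
      · ext y; simp only [Pi.mul_apply]; field_simp
      · simp only [FF]
        rw [gg_hh, cpow_succ' hy s, cpow_pred' hy s]; field_simp; ring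
    · rw [tendsto_zero_iff_norm_tendsto_zero]
      have := tendsto_rpow_abs_mul_exp_neg_mul_sq_cocompact (a := 1/2) (by norm_num) (s.re+2)
      have := this.mono_left atTop_le_cocompact
      refine this.congr' ?_
      filter_upwards [eventually_gt_atTop 0] with y hy
      rw [norm_mul, hh_norm, Complex.norm_cpow_eq_rpow_re_of_pos hy, abs_of_pos hy]
      simp
      left; ring

lemma mom (n : ℕ) : IntegrableOn (fun y : ℝ => y^(2*n+1) * Real.exp (-y^2)) (Ioi 0) ∧
    ∫ y in Ioi (0:ℝ), y^(2*n+1) * Real.exp (-y^2) = n.factorial / 2 := by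
  have hq0 : (-1:ℝ) < ((2*n+1:ℕ):ℝ) := lt_of_lt_of_le (by norm_num) (Nat.cast_nonneg _)
  have h1 := integral_rpow_mul_exp_neg_rpow (p := 2) (q := (2*n+1 : ℕ)) (by norm_num) hq0
  have h2 := integrableOn_rpow_mul_exp_neg_mul_sq (b := 1) one_pos (s := (2*n+1 : ℕ)) hq0
  simp only [Real.rpow_natCast, Real.rpow_ofNat, neg_one_mul] at h1 h2
  refine ⟨h2, h1.trans ?_⟩
  rw [show (((2*n+1:ℕ):ℝ)+1)/2 = n + 1 by push_cast; ring, Real.Gamma_nat_eq_factorial]; ring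

lemma G_moments (δ : ℝ) (n : ℕ) : (∫ t : ℝ, ‖mellin (gg δ) (((n-1 : ℝ):ℂ) + t * Complex.I)‖^2 = Real.pi * n.factorial) ∧
    (∫ t : ℝ, t^2 * ‖mellin (gg δ) (((n-1 : ℝ):ℂ) + t * Complex.I)‖^2 = Real.pi * (n+1).factorial * (1 + (2 * Real.pi * δ)^2)) ∧
    Integrable (fun t : ℝ => ‖mellin (gg δ) (((n-1 : ℝ):ℂ) + t * Complex.I)‖^2) ∧
    Integrable (fun t : ℝ => t^2 * ‖mellin (gg δ) (((n-1 : ℝ):ℂ) + t * Complex.I)‖^2) := by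
  have hn : (0:ℝ) ≤ n := Nat.cast_nonneg n
  set c : ℝ := n - 1 with hc
  have c2 : -2 < c := by linarith
  have ng : ∀ y : ℝ, ‖gg δ y‖^2 = y^4 * Real.exp (-y^2) := by
    intro y
    rw [gg_hh, norm_mul, hh_norm, mul_pow, norm_pow, Complex.norm_real]
    simp only [one_pow, mul_one, div_one, ← Real.exp_nat_mul, Real.norm_eq_abs, sq_abs]
    push_cast
    rw [show 2 * -(y^2/2) = -y^2 by ring]; ring
  have nF : ∀ y : ℝ, ‖FF δ y‖^2 = ((2-y^2)^2 + (2*Real.pi*δ)^2*y^2) * (y^4 * Real.exp (-y^2)) := by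
    intro y
    rw [FF, norm_mul, mul_pow, ng, hq]
    congr 1
    rw [show (2 + y * (2 * Real.pi * Complex.I * δ / (1:ℝ) - y/((1:ℝ):ℂ)^2) : ℂ) = ((2 - y^2 : ℝ):ℂ) + ((2*Real.pi*δ*y:ℝ):ℂ) * Complex.I by push_cast; ring,
      ← Complex.normSq_eq_norm_sq, Complex.normSq_add_mul_I]
    ring
  have py : ∀ y ∈ Ioi (0:ℝ), y^(2*c-1) * y^4 = y^(2*n+1) := by
    intro y hy
    rw [← Real.rpow_natCast, ← Real.rpow_add hy, ← Real.rpow_natCast]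
    congr 1; rw [hc]; push_cast; ring
  have P0 := planch (gg δ) c (mellin_gg_conv δ (by simpa using c2)) (mellin_gg_vert δ c2) (gg_cont δ).continuousOn
  have m0 := mom n
  have m1 := mom (n+1)
  have m2 := mom (n+2)
  rw [setIntegral_congr_fun (g := fun y => y^(2*n+1) * Real.exp (-y^2)) measurableSet_Ioi (fun y hy => by simp only [ng]; rw [← mul_assoc, py y hy]), m0.2] at P0
  have sh : ∀ (k : ℕ) (t : ℝ), (c:ℂ) + t * Complex.I + k = ((c + k : ℝ):ℂ) + t * Complex.I := by intro k t; push_cast; ring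
  have VF : Complex.VerticalIntegrable (mellin (FF δ)) c := by
    have a1 := mellin_gg_vert δ (σ := c+(1:ℕ)) (by push_cast; linarith)
    have a2 := mellin_gg_vert δ (σ := c+(2:ℕ)) (by push_cast; linarith)
    have a0 := mellin_gg_vert δ c2
    unfold Complex.VerticalIntegrable at *
    refine (((a0.const_mul 2).add (a1.const_mul (2 * Real.pi * Complex.I * δ))).sub a2).congr (Eventually.of_forall fun t => ?_)
    simp only [Pi.add_apply, Pi.sub_apply]
    rw [(FF_mellin δ (s := c + t * Complex.I) (by simpa using c2)).2.1, ← sh, ← sh]; norm_num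
  have cF : Continuous (FF δ) := by
    have := hq_cont 1 δ
    have := gg_cont δ
    unfold FF; fun_prop
  have P1 := planch (FF δ) c (FF_mellin δ (s := c) (by simpa using c2)).1 VF cF.continuousOn
  have nm : ∀ t : ℝ, ‖mellin (FF δ) (c + t * Complex.I)‖^2 = c^2 * ‖mellin (gg δ) (c + t * Complex.I)‖^2 + t^2 * ‖mellin (gg δ) (c + t * Complex.I)‖^2 := by
    intro t
    rw [(FF_mellin δ (s := c + t * Complex.I) (by simpa using c2)).2.2, norm_mul, norm_neg, mul_pow, ← Complex.normSq_eq_norm_sq (c + t * Complex.I), Complex.normSq_add_mul_I]; ring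
  have I2 : Integrable (fun t : ℝ => t^2 * ‖mellin (gg δ) (c + t * Complex.I)‖^2) ∧ Integrable (fun t : ℝ => ‖mellin (gg δ) (c + t * Complex.I)‖^2) := by
    obtain ⟨C, C0, hC⟩ := mellin_gg_decay δ c2
    have ct := mellin_gg_cont δ c2
    have bd : ∀ t : ℝ, ‖mellin (gg δ) (c + t * Complex.I)‖^2 ≤ C^2 * Real.exp (-(1/4) * |t|) := by
      intro t
      have h1 : Real.exp (-(1/4) * |t|) ≤ 1 := Real.exp_le_one_iff.2 (by have := abs_nonneg t
                                                                         linarith)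
      calc _ ≤ (C * Real.exp (-(1/4) * |t|))^2 := by gcongr; exact hC t
        _ = C^2 * (Real.exp (-(1/4) * |t|) * Real.exp (-(1/4) * |t|)) := by ring
        _ ≤ C^2 * (Real.exp (-(1/4) * |t|) * 1) := by gcongr
        _ = _ := by ring
    constructor
    · refine Integrable.mono' (wt2_int.const_mul (C^2)) ((continuous_pow 2).mul (ct.norm.pow 2)).aestronglyMeasurable (Eventually.of_forall fun t => ?_)
      rw [Real.norm_of_nonneg (by positivity)]
      calc _ ≤ (1+|t|)^2 * (C^2 * Real.exp (-(1/4) * |t|)) := by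
            gcongr ?_ * ?_
            · rw [← sq_abs]; gcongr; linarith
            · exact bd t
        _ = _ := by ring
    · refine Integrable.mono' ((exp_abs_int (c := 1/4) (by norm_num)).const_mul (C^2)) (ct.norm.pow 2).aestronglyMeasurable (Eventually.of_forall fun t => ?_)
      rw [Real.norm_of_nonneg (by positivity)]
      exact bd t
  simp_rw [nm] at P1
  rw [integral_add (I2.2.const_mul _) I2.1, integral_const_mul, P0] at P1
  have k1 := (m0.1.const_mul 4).add (m1.1.const_mul ((2*Real.pi*δ)^2-4))
  rw [setIntegral_congr_fun (g := fun y => (4 * (y^(2*n+1) * Real.exp (-y^2)) + ((2*Real.pi*δ)^2-4) * (y^(2*(n+1)+1) * Real.exp (-y^2))) + y^(2*(n+2)+1) * Real.exp (-y^2)) measurableSet_Ioi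
    (fun y hy => by
      simp only [nF]
      rw [show 2*(n+2)+1 = 2*n+1+4 by ring, show 2*(n+1)+1 = 2*n+1+2 by ring, pow_add _ _ 2, pow_add _ _ 4]
      linear_combination ((2-y^2)^2+(2*Real.pi*δ)^2*y^2)*Real.exp (-y^2) * py y hy)] at P1
  have k2 := integral_add k1 m2.1
  simp only [Pi.add_apply] at k2
  rw [k2, integral_add (m0.1.const_mul 4) (m1.1.const_mul _), integral_const_mul, integral_const_mul, m0.2, m1.2, m2.2] at P1
  refine ⟨by rw [P0]; ring, ?_, I2.2, I2.1⟩
  rw [eq_sub_of_add_eq' P1, hc]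
  simp only [Nat.factorial_succ]
  push_cast
  ring

lemma G_L1 (δ : ℝ) (n : ℕ) {l μ B : ℝ} (hl : 0 < l) (hμ : 0 < μ) (hB : 1 + (2*Real.pi*δ)^2 ≤ B) :
    ∫ t : ℝ, ‖mellin (gg δ) (((n-1 : ℝ):ℂ) + t * Complex.I)‖ ≤ Real.pi / 2 * (μ * (l^2 * n.factorial + (n+1).factorial * B) + 1 / (l * μ)) := by
  obtain ⟨A0, A2, J0, J2⟩ := G_moments δ n
  have hn : (0:ℝ) ≤ n := Nat.cast_nonneg n
  have c2 : -2 < (n-1:ℝ) := by linarith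
  have IV := (mellin_gg_vert δ c2).norm
  set G : ℝ → ℝ := fun t => ‖mellin (gg δ) (((n-1 : ℝ):ℂ) + t * Complex.I)‖ with hG
  have li : Integrable (fun t : ℝ => (1 + (l⁻¹ * t)^2)⁻¹) := integrable_inv_one_add_sq.comp_mul_left' (inv_ne_zero hl.ne')
  have lv : ∫ t : ℝ, (1 + (l⁻¹ * t)^2)⁻¹ = l * Real.pi := by
    have := Measure.integral_comp_mul_left (fun t : ℝ => (1 + t^2)⁻¹) l⁻¹
    rw [this, integral_univ_inv_one_add_sq, inv_inv, abs_of_pos hl, smul_eq_mul]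
  have pw : ∀ t, G t ≤ (μ/2*l^2) * G t^2 + (μ/2) * (t^2 * G t^2) + 1/(2*μ*l^2) * (1 + (l⁻¹ * t)^2)⁻¹ := by
    intro t
    set w := l^2 + t^2 with hw
    have w0 : 0 < w := by positivity
    have e : 1/(2*μ*l^2) * (1 + (l⁻¹ * t)^2)⁻¹ = 1/(2*μ*w) := by rw [hw]; field_simp
    have := sq_nonneg (μ * w * G t - 1)
    rw [e, ← sub_nonneg]
    have e2 : (μ/2*l^2) * G t^2 + (μ/2) * (t^2 * G t^2) + 1/(2*μ*w) - G t = (μ * w * G t - 1)^2 / (2*μ*w) := by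
      rw [hw]; field_simp; ring
    rw [e2]; positivity
  have I1 := (J0.const_mul (μ/2*l^2)).add (J2.const_mul (μ/2))
  have I2 := li.const_mul (1/(2*μ*l^2))
  have := integral_mono IV (I1.add I2) pw
  have q1 := integral_add I1 I2
  have q2 := integral_add (J0.const_mul (μ/2*l^2)) (J2.const_mul (μ/2))
  simp only [Pi.add_apply] at this q1
  rw [q1, q2, integral_const_mul, integral_const_mul, integral_const_mul, lv, A0, A2] at this
  refine this.trans ?_
  have pp := Real.pi_pos
  calc _ ≤ μ/2*l^2 * (Real.pi * n.factorial) + μ/2 * (Real.pi * (n+1).factorial * B) + 1/(2*μ*l^2) * (l * Real.pi) := by gcongr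
    _ = _ := by field_simp

variable {q : ℕ} [NeZero q] {χ : DirichletCharacter ℂ q}

theorem low_final (hχ : χ.IsPrimitive) {δ T : ℝ} (hT : 100 ≤ T) (hd : 4 * Real.pi^2 * |δ| ≤ T) (S : Finset ℂ) (hS : ∀ ρ ∈ S, mul' (Xi χ) ρ ≠ 0 → ρ.re = 1/2 ∧ |ρ.im| ≤ T) :
    ∑ ρ ∈ S, mul' (Xi χ) ρ * ‖mellin (gg δ) ρ‖ ≤ 0.842 * Real.sqrt T * (Real.log (q * T) + 2) := by
  have pp := Real.pi_pos
  have p3 := Real.pi_gt_d2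
  set r := Real.sqrt T with hr
  have rr : r^2 = T := Real.sq_sqrt (by linarith)
  have r0 : 0 < r := Real.sqrt_pos.2 (by linarith)
  have hB : 1 + (2*Real.pi*δ)^2 ≤ (0.16*r^2)^2 := by
    rw [rr]
    have h1 : (4 * Real.pi^2 * |δ|)^2 ≤ T^2 := by gcongr
    have h2 : (4 * Real.pi^2 * |δ|)^2 = (2*Real.pi)^2 * (2*Real.pi*δ)^2 := by rw [mul_pow, sq_abs]; ring
    have h3 : (6.28:ℝ)^2 ≤ (2*Real.pi)^2 := by gcongr; linarith
    have h4 : (6.28:ℝ)^2 * (2*Real.pi*δ)^2 ≤ T^2 := by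
      refine le_trans ?_ h1
      rw [h2]; gcongr
    nlinarith
  have g0 := G_L1 δ 0 (l := 0.16*r^2) (μ := 0.7/(0.4*r)^3) (by positivity) (by positivity) hB
  have g3 := G_L1 δ 3 (l := 2*(0.16*r^2)) (μ := 0.1/(0.4*r)^3) (by positivity) (by positivity) hB
  have e0 : Real.pi / 2 * (0.7/(0.4*r)^3 * ((0.16*r^2)^2 * (Nat.factorial 0 : ℕ) + (Nat.factorial (0+1) : ℕ) * (0.16*r^2)^2) + 1 / ((0.16*r^2) * (0.7/(0.4*r)^3))) ≤ Real.pi * 0.5658 * r := by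
    rw [show Real.pi / 2 * (0.7/(0.4*r)^3 * ((0.16*r^2)^2 * (Nat.factorial 0 : ℕ) + (Nat.factorial (0+1) : ℕ) * (0.16*r^2)^2) + 1 / ((0.16*r^2) * (0.7/(0.4*r)^3))) = Real.pi * r * (0.28+0.4/1.4) by
      simp [Nat.factorial]; field_simp; ring]
    nlinarith [mul_pos pp r0]
  have e3 : Real.pi / 2 * (0.1/(0.4*r)^3 * ((2*(0.16*r^2))^2 * (Nat.factorial 3 : ℕ) + (Nat.factorial (3+1) : ℕ) * (0.16*r^2)^2) + 1 / ((2*(0.16*r^2)) * (0.1/(0.4*r)^3))) = Real.pi * 1.96 * r := by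
    simp [Nat.factorial]; field_simp; ring
  have h := low_zeros hχ δ hT S hS
  rw [e3] at g3
  replace g0 := g0.trans e0
  norm_num at g0 g3 h
  have q1 : (1:ℝ) ≤ q := by exact_mod_cast NeZero.one_le
  have lg : 0 ≤ Real.log (q * T) := Real.log_nonneg (by nlinarith)
  refine h.trans ?_
  calc _ ≤ Real.pi⁻¹ * (1/3) * (Real.log (q * T) + 2) * (Real.pi * 0.5658 * r + Real.pi * 1.96 * r) := by
        gcongr <;> first | linarith | skip
    _ = (0.5658+1.96)/3 * r * (Real.log (q * T) + 2) := by field_simp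
    _ ≤ _ := by gcongr; norm_num
end

section
open MeasureTheory Set Filter Topology
set_option linter.unusedSimpArgs false
lemma cos_low {u : ℝ} (h0 : 0 ≤ u) (h1 : u ≤ 1) : 1 - u^2/2 + u^4/24 - u^6/720 - u^8/30000 ≤ Real.cos u := by
  have := Complex.exp_bound (x := u * Complex.I) (by simp [abs_of_nonneg h0, h1]) (n := 8) (by norm_num)
  have h2 := (Complex.abs_re_le_norm _).trans this
  have e : (Complex.exp (u * Complex.I) - ∑ m ∈ Finset.range 8, (u * Complex.I)^m / (m.factorial:ℂ)).re = Real.cos u - (1 - u^2/2 + u^4/24 - u^6/720) := by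
    rw [Complex.sub_re, Complex.exp_ofReal_mul_I_re]
    congr 1
    have i2 := Complex.I_sq
    have i3 : Complex.I^3 = -Complex.I := by rw [pow_succ, i2]; ring
    have i4 : Complex.I^4 = 1 := Complex.I_pow_four
    have i5 : Complex.I^5 = Complex.I := by rw [pow_succ, i4]; ring
    have i6 : Complex.I^6 = -1 := by rw [pow_succ, i5, ← sq, i2]
    have i7 : Complex.I^7 = -Complex.I := by rw [pow_succ, i6]; ring
    have : (∑ m ∈ Finset.range 8, (u * Complex.I)^m / (m.factorial:ℂ)) = ((1 - u^2/2 + u^4/24 - u^6/720 : ℝ):ℂ) + ((u - u^3/6+u^5/120-u^7/5040 : ℝ):ℂ) * Complex.I := by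
      simp only [Finset.sum_range_succ, Finset.sum_range_zero, mul_pow, i2, i3, i4, i5, i6, i7, Nat.factorial]
      push_cast; ring
    rw [this]; simp
    simp [← Complex.ofReal_pow]
  rw [e] at h2
  have h3 := (abs_le.1 h2).1
  simp [abs_of_nonneg h0, Nat.factorial] at h3
  have : u^8 * (9 * (40320⁻¹ * 8⁻¹)) ≤ u^8/30000 := by rw [div_eq_mul_inv]; gcongr; norm_num
  norm_num at h3 this ⊢
  linarith

lemma A_le {θ : ℝ} (h0 : 0 ≤ θ) (h1 : θ ≤ 0.2826) : 0.8 ≤ Real.cos (2*θ) ∧ Real.sin θ^2/(2*Real.cos (2*θ)) ≤ θ^2/2 + 0.9585*θ^4 := by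
  have h := cos_low (u := 2*θ) (by linarith) (by linarith)
  have t1 : θ^2 ≤ 0.0799 := by nlinarith
  have t0 : 0 ≤ θ^2 := sq_nonneg θ
  have e : 1 - (2*θ)^2/2 + (2*θ)^4/24 - (2*θ)^6/720 - (2*θ)^8/30000 = 1 - 2*θ^2 + 2/3*(θ^2)^2 - 4/45*(θ^2)^3 - 256/30000*(θ^2)^4 := by ring
  rw [e] at h
  set τ := θ^2 with hτ
  have c0 : 0.8 ≤ Real.cos (2*θ) := by
    have : τ^3 ≤ 1*τ := by nlinarith
    have : τ^4 ≤ 1*τ := by nlinarith [sq_nonneg τ, sq_nonneg (τ^2)]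
    nlinarith
  refine ⟨c0, ?_⟩
  have s2 : Real.sin θ^2 = (1 - Real.cos (2*θ))/2 := by rw [Real.cos_two_mul, Real.sin_sq]; ring
  rw [div_le_iff₀ (by linarith), s2, show θ^4 = τ^2 by rw [hτ]; ring]
  have key : 1 ≤ Real.cos (2*θ) * (1 + 2*τ + 4*0.9585*τ^2) := by
    refine le_trans ?_ (mul_le_mul_of_nonneg_right h (by positivity))
    have : 0 ≤ τ^2 * (0.5006 - 6.4238*τ + 2.2*τ^2) := by
      apply mul_nonneg (by positivity); nlinarith
    have : 0 ≤ τ^4 * (1 - 10*τ) := mul_nonneg (by positivity) (by linarith)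
    have : 0 ≤ τ^5 := by positivity
    have : τ^6 ≤ 0.1 * τ^5 := by rw [pow_succ τ 5, mul_comm]; gcongr; linarith
    nlinarith
  nlinarith

lemma cos_ge {θ m c : ℝ} (h0 : 0 ≤ θ) (h1 : θ ≤ m) (h2 : m ≤ 0.5) (h : c ≤ 1 - (2*m)^2/2 + (2*m)^4/24 - (2*m)^6/720 - (2*m)^8/30000) : c ≤ Real.cos (2*θ) :=
  (h.trans (cos_low (by linarith) (by linarith))).trans (Real.cos_le_cos_of_nonneg_of_le_pi (by linarith) (by linarith [Real.pi_gt_three]) (by linarith))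

lemma exp_num {x : ℝ} (h0 : 0 ≤ x) (h1 : x ≤ 1) : Real.exp x ≤ 1 + x + x^2/2 + x^3/6 + x^4/24 + x^5/120 + x^6 * (7/4320) := by
  have := Real.exp_bound' h0 h1 (n := 6) (by norm_num)
  simp [Finset.sum_range_succ, Nat.factorial] at this
  norm_num at this
  linarith

lemma pre_le {T ℓ L θ cc E f R w : ℝ} (hT : 0 < T) (hθ : 0 < θ) (hL : 0 ≤ L) (hff : 0 ≤ f) (hc : 0 < cc) (hE : Real.exp (1.5*θ) ≤ E)
    (hf0 : 0 ≤ (1/θ-1.5)/(2*T)) (hf : L/2+0.64+(1/θ-1.5)/(2*T) ≤ f * L) (hR0 : 0 ≤ R) (hR : 2*Real.pi ≤ cc * R^2) (hw : ℓ^2 = w*T) :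
    (2/3)*Real.exp (1.5*θ)/θ*(L/2+0.64+(1/θ-1.5)/(2*T))*((0.55*(ℓ^2*θ^2/cc^2)+0.825/cc+1.875)*Real.sqrt (2*Real.pi/cc)) ≤
      T*L*((2/3)*E*f*R*(0.55*(w*θ)/cc^2+(0.825/cc+1.875)/(θ*T))) := by
  have hs : Real.sqrt (2*Real.pi/cc) ≤ R := by
    apply Real.sqrt_le_iff.2 ⟨hR0, _⟩
    rw [div_le_iff₀ hc]; linarith
  have E0 := (Real.exp_pos (1.5*θ)).le.trans hE
  calc _ ≤ (2/3)*E/θ*(f*L)*((0.55*(ℓ^2*θ^2/cc^2)+0.825/cc+1.875)*R) := by gcongr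
    _ = _ := by rw [hw]; field_simp; ring

lemma comb (n : ℕ) (hn : 0 < n) {P T g a b : ℝ} (hP : 0 ≤ P) (hT : 0 ≤ T) (hp : ∀ y : ℝ, 0 ≤ y → P*y^2 ≤ 0.64+3.5*y^n) (h : 2*(a-b) ≤ n*g) :
    P * Real.exp (-(g+b)*T) ≤ 3.5*Real.exp (-a*T)+0.64*Real.exp (-b*T) := by
  have n0 : (0:ℝ) < n := by exact_mod_cast hn
  have e1 : Real.exp (-(a-b)*T/n)^n = Real.exp (-(a-b)*T) := by rw [← Real.exp_nat_mul]; congr 1; field_simp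
  have e2 : Real.exp (-g*T) ≤ Real.exp (-(a-b)*T/n)^2 := by
    rw [← Real.exp_nat_mul]; apply Real.exp_le_exp.2
    push_cast
    rw [← mul_div_assoc, le_div_iff₀ n0]
    nlinarith
  have := hp _ (Real.exp_pos (-(a-b)*T/n)).le
  rw [e1] at this
  have e3 : Real.exp (-(g+b)*T) = Real.exp (-g*T) * Real.exp (-b*T) := by rw [← Real.exp_add]; congr 1; ring
  have e4 : Real.exp (-a*T) = Real.exp (-(a-b)*T) * Real.exp (-b*T) := by rw [← Real.exp_add]; congr 1; ring
  rw [e3, e4]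
  have : P * Real.exp (-g*T) ≤ 0.64 + 3.5*Real.exp (-(a-b)*T) := le_trans (by gcongr) this
  nlinarith [Real.exp_pos (-b*T)]

lemma poly10 (y : ℝ) (_ : 0 ≤ y) : 1.48*y^2 ≤ 0.64+3.5*y^10 := by
  have h := one_add_mul_le_pow (a := y^2/0.5394 - 1) (by linarith [show 0 ≤ y^2/0.5394 by positivity]) 5
  rw [show 1 + (y^2/0.5394 - 1) = y^2/0.5394 by ring, div_pow, ← pow_mul] at h
  norm_num at h
  nlinarith [sq_nonneg y]

lemma poly12 (y : ℝ) (_ : 0 ≤ y) : 1.3*y^2 ≤ 0.64+3.5*y^12 := by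
  have h := one_add_mul_le_pow (a := y^2/0.575 - 1) (by linarith [show 0 ≤ y^2/0.575 by positivity]) 6
  rw [show 1 + (y^2/0.575 - 1) = y^2/0.575 by ring, div_pow, ← pow_mul] at h
  norm_num at h
  nlinarith [sq_nonneg y]

lemma poly11 (y : ℝ) (hy : 0 ≤ y) : 1.39*y^2 ≤ 0.64+3.5*y^11 := by
  have key : ∀ u : ℝ, 0 ≤ u → 11*u^2 ≤ 2*u^11+9 := by
    intro u hu
    have : 0 ≤ (u-1)^2*(2*u^9+4*u^8+6*u^7+8*u^6+10*u^5+12*u^4+14*u^3+16*u^2+18*u+9) := by positivity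
    linarith
  have := key (y/0.747) (by positivity)
  rw [div_pow, div_pow] at this
  norm_num at this
  nlinarith [sq_nonneg y]
end

section
open MeasureTheory Set Filter Topology
set_option linter.unusedSimpArgs false

lemma fin_gen {T ℓ L θ cc E f R w P g : ℝ} (hT : 0 < T) (hθ : 0 < θ) (hL : 0 ≤ L) (hff : 0 ≤ f) (hc : 0 < cc) (hE : Real.exp (1.5*θ) ≤ E)
    (hf0 : 0 ≤ (1/θ-1.5)/(2*T)) (hf : L/2+0.64+(1/θ-1.5)/(2*T) ≤ f * L) (hR0 : 0 ≤ R) (hR : 2*Real.pi ≤ cc * R^2) (hw : ℓ^2 = w*T) (w0 : 0 < w)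
    (hP : (2/3)*E*f*R*(0.55*(w*θ)/cc^2+(0.825/cc+1.875)/(θ*T)) ≤ P) (hg : g = θ - w*(θ^2/2+0.9585*θ^4) - 0.426/w)
    (hfin : P * Real.exp (-(g+0.426/w)*T) ≤ 3.5*Real.exp (-0.1598*T)+0.64*Real.exp (-(0.426/w)*T)) :
    (2/3)*Real.exp (1.5*θ)/θ*(L/2+0.64+(1/θ-1.5)/(2*T))*((0.55*(ℓ^2*θ^2/cc^2)+0.825/cc+1.875)*Real.sqrt (2*Real.pi/cc))*Real.exp (ℓ^2*(θ^2/2+0.9585*θ^4)-θ*T) ≤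
     T*L*(3.5*Real.exp (-0.1598*T)+0.64*Real.exp (-0.426*T^2/ℓ^2)) := by
  have h := pre_le hT hθ hL hff hc hE hf0 hf hR0 hR hw
  have e1 : ℓ^2*(θ^2/2+0.9585*θ^4)-θ*T = -(g+0.426/w)*T := by rw [hw, hg]; ring
  have e2 : -0.426*T^2/ℓ^2 = -(0.426/w)*T := by rw [hw]; field_simp
  rw [e1, e2]
  calc _ ≤ T*L*P*Real.exp (-(g+0.426/w)*T) := 
        mul_le_mul_of_nonneg_right (h.trans (by gcongr)) (Real.exp_pos _).le
    _ = T*L*(P*Real.exp (-(g+0.426/w)*T)) := by ring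
    _ ≤ _ := by gcongr

set_option maxHeartbeats 2000000 in
lemma fin_ineq {T ℓ L : ℝ} (hT : 100 ≤ T) (hl : 0 ≤ ℓ) (h : 2*Real.pi*ℓ ≤ T) (hL : Real.log (T/(2*Real.pi)) ≤ L) :
    ∃ θ cc : ℝ, 0 < θ ∧ θ ≤ 0.2826 ∧ 0 < cc ∧ cc ≤ Real.cos (2*θ) ∧ 0 ≤ L ∧ 
    (2/3)*Real.exp (1.5*θ)/θ*(L/2+0.64+(1/θ-1.5)/(2*T))*((0.55*(ℓ^2*θ^2/cc^2)+0.825/cc+1.875)*Real.sqrt (2*Real.pi/cc))*Real.exp (ℓ^2*(θ^2/2+0.9585*θ^4)-θ*T) ≤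
     T*L*(3.5*Real.exp (-0.1598*T)+0.64*Real.exp (-0.426*T^2/ℓ^2)) := by
  have pp := Real.pi_pos
  have p1 := Real.pi_gt_d6
  have p2 := Real.pi_lt_d6
  have T0 : 0 < T := by linarith
  have hLx : ∀ a : ℝ, 0 ≤ a → a ≤ 1 → ∀ B, 2*Real.pi*B ≤ T → (1 + a + a^2/2 + a^3/6 + a^4/24 + a^5/120 + a^6 * (7/4320))^4 ≤ B → 4*a ≤ L := by
    intro a a0 a1 B hB hh
    refine le_trans ((Real.le_log_iff_exp_le (by positivity)).2 ?_) hL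
    rw [le_div_iff₀ (by positivity), show 4*a = (4:ℕ)*a by norm_num, Real.exp_nat_mul]
    have : Real.exp a^4 ≤ B := le_trans (by gcongr; exact exp_num a0 a1) hh
    nlinarith
  have L1 : 2.76 ≤ L := by
    have := hLx 0.69 (by norm_num) (by norm_num) 15.9 (by linarith) (by norm_num)
    linarith
  set w := ℓ^2/T with hwd
  have hw : ℓ^2 = w*T := by rw [hwd]; field_simp
  have w0 : 0 ≤ w := by positivity
  have hwT : 39.47*w ≤ T := by
    rw [hwd, ← mul_div_assoc, div_le_iff₀ T0]
    have : (2*Real.pi*ℓ)^2 ≤ T^2 := by gcongr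
    have : (6.283*ℓ)^2 ≤ (2*Real.pi*ℓ)^2 := by gcongr; linarith
    nlinarith [sq_nonneg ℓ]
  rcases le_total w 2.6656 with hA | hA
  · refine ⟨0.28, 0.847, by norm_num, by norm_num, by norm_num, cos_ge (m := 0.28) (by norm_num) le_rfl (by norm_num) (by norm_num), by linarith, ?_⟩
    have hE : Real.exp (1.5*0.28) ≤ 1.5221 := (exp_num (by norm_num) (by norm_num)).trans (by norm_num)
    have hk : ((1:ℝ)/0.28-1.5)/(2*T) ≤ 0.0104 := by
      rw [div_le_iff₀ (by positivity)]; norm_num; linarith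
    have := pre_le (L := L) (cc := 0.847) (θ := 0.28) (f := 0.736) (R := 2.724) T0 (by norm_num) (by linarith) (by norm_num) (by norm_num) hE (div_nonneg (by norm_num) (by positivity)) (by linarith) (by norm_num) (by norm_num; linarith) hw
    have pb : (2/3)*1.5221*0.736*2.724*(0.55*(w*0.28)/0.847^2+(0.825/0.847+1.875)/(0.28*T)) ≤ 3.5 := by
      have : (0.825/0.847+1.875)/(0.28*T) ≤ 0.11 := by
        rw [div_le_iff₀ (by positivity)]; norm_num; linarith
      norm_num at this ⊢
      linarith
    have e1 : ℓ^2*((0.28:ℝ)^2/2+0.9585*0.28^4)-0.28*T ≤ -0.1598*T := by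
      rw [hw]; norm_num; nlinarith
    calc _ ≤ T*L*3.5*Real.exp (-0.1598*T) := by
          refine mul_le_mul (this.trans ?_) (Real.exp_le_exp.2 e1) (Real.exp_pos _).le (by positivity)
          gcongr
      _ = T*L*(3.5*Real.exp (-0.1598*T)) := by ring
      _ ≤ _ := by gcongr; linarith [Real.exp_pos (-0.426*T^2/ℓ^2)]
  have wp : 0 < w := by linarith
  rcases le_total w 2.9 with hB | hB
  · have t1 : 0.4238-0.053*w ≤ 0.2826 := by linarith
    have t2 : 0.27 ≤ 0.4238-0.053*w := by linarith
    have q1 : w*(0.4238-0.053*w) ≤ 0.7834 := by nlinarith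
    have q2 : 0.75 ≤ w*(0.4238-0.053*w) := by nlinarith
    have F : 0 ≤ 5*(w*(0.4238-0.053*w)) - 5/2*(w*(0.4238-0.053*w))^2 - 5*0.9585*(w*(0.4238-0.053*w))^2*(0.4238-0.053*w)^2-0.1598*w-1.704 := by
      obtain ⟨t, ht⟩ : ∃ t, w = 2.6656+0.2344*t := ⟨(w-2.6656)/0.2344, by field_simp; ring⟩
      have a0 : 0 ≤ t := by linarith
      have a1 : 0 ≤ 1-t := by linarith
      rw [ht]
      have b0 : 0 ≤ (1-t)^6 := by positivity
      have b1 : 0 ≤ t*(1-t)^5 := by positivity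
      have b2 : 0 ≤ t^2*(1-t)^4 := by positivity
      have b3 : 0 ≤ t^3*(1-t)^3 := by positivity
      have b4 : 0 ≤ t^4*(1-t)^2 := by positivity
      have b5 : 0 ≤ t^5*(1-t) := by positivity
      have b6 : 0 ≤ t^6 := by positivity
      nlinarith only [b0, b1, b2, b3, b4, b5, b6]
    set θ := 0.4238-0.053*w with hθ
    have hkk : 1/θ ≤ 3.71 := by rw [div_le_iff₀ (by linarith)]; linarith
    have hk3 : 3.5 ≤ 1/θ := by rw [le_div_iff₀ (by linarith)]; linarith
    have hk : (1/θ-1.5)/(2*T) ≤ 0.0111 := by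
      rw [div_le_iff₀ (by positivity)]; linarith
    refine ⟨θ, 0.844, by linarith, t1, by norm_num, cos_ge (m := 0.2826) (by linarith) t1 (by norm_num) (by norm_num), by linarith,
      fin_gen (E := 1.5285) (f := 0.736) (R := 2.7286) (P := 1.48) T0 (by linarith) (by linarith) (by norm_num) (by norm_num) ?_ (div_nonneg (by linarith) (by positivity)) (by linarith) (by norm_num) (by norm_num; linarith) hw wp ?_ rfl (comb 10 (by norm_num) (by norm_num) T0.le poly10 ?_)⟩
    · exact (Real.exp_le_exp.2 (by linarith : 1.5*θ ≤ 0.4239)).trans ((exp_num (by norm_num) (by norm_num)).trans (by norm_num))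
    · have h3 : 29.6 ≤ θ*T := by nlinarith
      have : (0.825/0.844+1.875)/(θ*T) ≤ 0.0964 := by
        rw [div_le_iff₀ (by linarith)]; norm_num; linarith
      norm_num at this ⊢
      linarith
    · have : 0 ≤ (5*(w*θ) - 5/2*(w*θ)^2 - 5*0.9585*(w*θ)^2*θ^2-0.1598*w-1.704)/w := by positivity
      have e : (5*(w*θ) - 5/2*(w*θ)^2 - 5*0.9585*(w*θ)^2*θ^2-0.1598*w-1.704)/w = 5*(θ - w*(θ^2/2+0.9585*θ^4) - 0.426/w) - (0.1598 - 0.426/w) := by field_simp; ring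
      push_cast; linarith
  have hg : ∀ n : ℕ, 2*(0.1598*w^3-0.426*w^2) ≤ n*(0.054*w^2-0.3926016) → 2*(0.1598-0.426/w) ≤ n*(0.8/w - w*((0.8/w)^2/2+0.9585*(0.8/w)^4) - 0.426/w) := by
    intro n hn
    rw [← sub_nonneg] at hn ⊢
    have e : n*(0.8/w - w*((0.8/w)^2/2+0.9585*(0.8/w)^4) - 0.426/w) - 2*(0.1598-0.426/w) = (n*(0.054*w^2-0.3926016)-2*(0.1598*w^3-0.426*w^2))/w^3 := by
      field_simp; ring
    rw [e]; positivity
  have th0 : 0 < 0.8/w := by positivity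
  have i0 : 1/(0.8/w) = 1.25*w := by rw [one_div_div]; norm_num; ring
  have hk0 : 0 ≤ (1/(0.8/w)-1.5)/(2*T) := by
    rw [i0]; apply div_nonneg _ (by positivity); linarith
  have hk : (1/(0.8/w)-1.5)/(2*T) ≤ 0.01584 := by
    rw [i0, div_le_iff₀ (by positivity)]; linarith
  have h3 : 31.576 ≤ 0.8/w*T := by
    rw [div_mul_eq_mul_div, le_div_iff₀ wp]; linarith
  have wth : w*(0.8/w) = 0.8 := by field_simp
  have dv : ∀ c : ℝ, 0 < c → (0.825/c+1.875)/(0.8/w*T) ≤ (0.825/c+1.875)/31.576 := by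
    intro c hc; gcongr
  rcases le_total w 3.2 with hC | hC
  · have L2 : 2.9 ≤ L := by
      have := hLx 0.725 (by norm_num) (by norm_num) 18.2 (by linarith) (by norm_num)
      linarith
    have t1 : 0.8/w ≤ 0.27587 := by rw [div_le_iff₀ wp]; linarith
    refine ⟨0.8/w, 0.851, th0, by linarith, by norm_num, cos_ge (m := 0.27587) th0.le t1 (by norm_num) (by norm_num), by linarith,
      fin_gen (E := 1.5127) (f := 0.7262) (R := 2.7173) (P := 1.39) T0 th0 (by linarith) (by norm_num) (by norm_num) ?_ hk0 (by linarith) (by norm_num) (by norm_num; linarith) hw wp ?_ rfl (comb 11 (by norm_num) (by norm_num) T0.le poly11 (hg 11 ?_))⟩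
    · exact (Real.exp_le_exp.2 (by linarith : 1.5*(0.8/w) ≤ 0.41381)).trans ((exp_num (by norm_num) (by norm_num)).trans (by norm_num))
    · have := dv 0.851 (by norm_num)
      rw [wth]
      norm_num at this ⊢
      linarith
    · push_cast
      nlinarith [mul_nonneg (sub_nonneg.2 hB) (sub_nonneg.2 hC), mul_nonneg (mul_nonneg (sub_nonneg.2 hB) (sub_nonneg.2 hC)) w0]
  have t1 : 0.8/w ≤ 0.25 := by rw [div_le_iff₀ wp]; linarith
  refine ⟨0.8/w, 0.877, th0, by linarith, by norm_num, cos_ge (m := 0.25) th0.le t1 (by norm_num) (by norm_num), by linarith,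
      fin_gen (E := 1.4552) (f := 0.738) (R := 2.6767) (P := 1.27) T0 th0 (by linarith) (by norm_num) (by norm_num) ?_ hk0 (by linarith) (by norm_num) (by norm_num; linarith) hw wp ?_ rfl ?_⟩
  · exact (Real.exp_le_exp.2 (by linarith : 1.5*(0.8/w) ≤ 0.375)).trans ((exp_num (by norm_num) (by norm_num)).trans (by norm_num))
  · have := dv 0.877 (by norm_num)
    rw [wth]
    norm_num at this ⊢
    linarith
  rcases le_total w 3.4 with hD | hD
  · refine comb 12 (by norm_num) (by norm_num) T0.le (fun y hy => le_trans (by gcongr; norm_num) (poly12 y hy)) (hg 12 ?_)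
    push_cast
    nlinarith [mul_nonneg (sub_nonneg.2 hC) (sub_nonneg.2 hD), mul_nonneg (mul_nonneg (sub_nonneg.2 hC) (sub_nonneg.2 hD)) w0]
  · set g := 0.8/w - w*((0.8/w)^2/2+0.9585*(0.8/w)^4) - 0.426/w with hgd
    have e : g = (0.054-0.3926016/w^2)/w := by rw [hgd]; field_simp; ring
    have h4 : 0.3926016/w^2 ≤ 0.03397 := by rw [div_le_iff₀ (by positivity)]; nlinarith
    have h5 : 0.75 ≤ g*T := by
      rw [e, div_mul_eq_mul_div, le_div_iff₀ wp]
      nlinarith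
    have h6 : Real.exp (-(g+0.426/w)*T) ≤ 0.5 * Real.exp (-(0.426/w)*T) := by
      rw [show -(g+0.426/w)*T = -(g*T) + -(0.426/w)*T by ring, Real.exp_add]
      gcongr
      have : Real.exp (-(g*T)) ≤ Real.exp (-Real.log 2) := Real.exp_le_exp.2 (by linarith [Real.log_two_lt_d9])
      rw [Real.exp_neg (Real.log 2), Real.exp_log (by norm_num)] at this
      norm_num at this ⊢; exact this
    have := Real.exp_pos (-0.1598*T)
    have := Real.exp_pos (-(0.426/w)*T)
    linarith
end

section
open MeasureTheory Set Filter Topology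
open scoped ComplexConjugate
set_option linter.unusedSectionVars false
set_option linter.unusedSimpArgs false

noncomputable def gJ (c b t : ℝ) : ℝ := (1.1*t^2+2.5) * Real.exp (-c*t^2/2 + b*t)

lemma gJ_line {c : ℝ} (hc : 0 < c) (b : ℝ) : Integrable (gJ c b) ∧
    ∫ t, gJ c b t = (1.1*(b^2/c^2+1/c)+2.5) * Real.sqrt (2*Real.pi/c) * Real.exp (b^2/(2*c)) := by
  have h2 : 0 < c/2 := by positivity
  have i0 := integrable_exp_neg_mul_sq h2
  have i1 := integrable_mul_exp_neg_mul_sq h2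
  have i2 := integrable_rpow_mul_exp_neg_mul_sq h2 (s := 2) (by norm_num)
  simp only [Real.rpow_two] at i2
  have z1 : ∫ v : ℝ, v * Real.exp (-(c/2)*v^2) = 0 := by
    refine integral_eq_zero_of_hasDerivAt_of_integrable (f := fun v => -(1/c) * Real.exp (-(c/2)*v^2)) (fun v => ?_) i1 (i0.const_mul _)
    have := ((((hasDerivAt_id v).pow 2).const_mul (-(c/2))).exp).const_mul (-(1/c))
    refine this.congr_deriv ?_
    simp; field_simp
  have z2 : ∫ v : ℝ, (v^2 * Real.exp (-(c/2)*v^2) - 1/c * Real.exp (-(c/2)*v^2)) = 0 := by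
    refine integral_eq_zero_of_hasDerivAt_of_integrable (f := fun v => -(1/c) * (v * Real.exp (-(c/2)*v^2))) (fun v => ?_) (i2.sub (i0.const_mul _)) (i1.const_mul _)
    have := ((hasDerivAt_id v).mul (((hasDerivAt_id v).pow 2).const_mul (-(c/2))).exp).const_mul (-(1/c))
    refine this.congr_deriv ?_
    simp; field_simp; ring
  rw [integral_sub i2 (i0.const_mul _), integral_const_mul] at z2
  have g0 := integral_gaussian (c/2)
  set m := b/c with hm
  set P : ℝ → ℝ := fun v => Real.exp (b^2/(2*c)) * (1.1*(v^2 * Real.exp (-(c/2)*v^2)) + 2.2*m*(v * Real.exp (-(c/2)*v^2)) + (1.1*m^2+2.5)*Real.exp (-(c/2)*v^2)) with hP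
  have j0 := i0.const_mul (1.1*m^2+2.5)
  have j1 := i1.const_mul (2.2*m)
  have j2 := i2.const_mul 1.1
  have j21 : Integrable (fun v : ℝ => 1.1*(v^2 * Real.exp (-(c/2)*v^2)) + 2.2*m*(v * Real.exp (-(c/2)*v^2))) := j2.add j1
  have iP : Integrable P := ((j2.add j1).add j0).const_mul _
  have e : gJ c b = fun t => P (t - m) := by
    funext t
    have : -c*t^2/2+b*t = b^2/(2*c) + (-(c/2)*(t-m)^2) := by rw [hm]; field_simp; ring
    simp only [gJ, hP, this, Real.exp_add]
    ring
  refine ⟨by rw [e]; exact iP.comp_sub_right m, ?_⟩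
  rw [e, integral_sub_right_eq_self P m, integral_const_mul, integral_add j21 j0, integral_add j2 j1, integral_const_mul, integral_const_mul, integral_const_mul, z1,
    show ∫ v : ℝ, v^2 * Real.exp (-(c/2)*v^2) = 1/c * ∫ v : ℝ, Real.exp (-(c/2)*v^2) by linarith, g0,
    show Real.pi/(c/2) = 2*Real.pi/c by field_simp, hm]
  ring

lemma gJ_split {c : ℝ} (hc : 0 < c) (b : ℝ) : (∫ t in Ioi (0:ℝ), gJ c b t) + (∫ t in Ioi (0:ℝ), gJ c (-b) t) =
    (1.1*(b^2/c^2+1/c)+2.5) * Real.sqrt (2*Real.pi/c) * Real.exp (b^2/(2*c)) := by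
  obtain ⟨h1, h2⟩ := gJ_line hc b
  have e : gJ c (-b) = fun t => gJ c b (-t) := by funext t; simp [gJ]
  have e2 := integral_comp_neg_Ioi 0 (gJ c b)
  rw [neg_zero] at e2
  rw [e, e2, ← h2, ← intervalIntegral.integral_Iic_add_Ioi (b := 0) h1.integrableOn h1.integrableOn, add_comm]

lemma pow_bd {β t : ℝ} (h0 : 0 ≤ β) (h1 : β ≤ 1) (ht : 0 < t) : t^(β+1) + t^(2-β) ≤ 1.1*t^2+2.5 := by
  have k : ∀ b : ℝ, 0 ≤ b → b ≤ 1 → t^(b+1) ≤ (1-b)*t+b*t^2 := by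
    intro b b0 b1
    have := Real.geom_mean_le_arith_mean2_weighted (sub_nonneg.2 b1) b0 ht.le (sq_nonneg t) (by ring)
    rw [← Real.rpow_natCast t 2, ← Real.rpow_mul ht.le, ← Real.rpow_add ht] at this
    convert this using 2
    · push_cast; ring
    · norm_cast
  have a1 := k β h0 h1
  have a2 := k (1-β) (by linarith) (by linarith)
  rw [show 1-β+1 = 2-β by ring] at a2
  nlinarith [sq_nonneg (t-5)]

lemma rot_pair (δ : ℝ) {ρ : ℂ} (h0 : 0 < ρ.re) (h1 : ρ.re < 1) {φ : ℝ} (h : |φ| < Real.pi/4) :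
    ‖mellin (gg δ) ρ‖ + ‖mellin (gg δ) (1 - conj ρ)‖ ≤ Real.exp (-φ*ρ.im) * ∫ t in Ioi (0:ℝ), gJ (Real.cos (2*φ)) (-(2*Real.pi*δ*Real.sin φ)) t := by
  have hc := cos_two_pos h
  have a1 := mellin_gg_rot δ (s := ρ) (by linarith) h
  have a2 := mellin_gg_rot δ (s := 1 - conj ρ) (by simp; linarith) h
  have r1 : (1 - conj ρ).re + 1 = 2 - ρ.re := by simp; ring
  have r2 : (1 - conj ρ).im = ρ.im := by simp
  rw [r1, r2] at a2
  have w : ∀ a : ℝ, -1 < a → IntegrableOn (fun t : ℝ => t^a * Real.exp (-(Real.cos (2 * φ)) * t ^ 2 / 2 - 2 * Real.pi * δ * Real.sin φ * t)) (Ioi 0) := by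
    intro a ha
    have := wt_int (a := a) (L := -(2*Real.pi*δ*Real.sin φ)) ha hc
    simpa only [neg_mul, sub_eq_add_neg] using this
  have w1 := w (ρ.re+1) (by linarith)
  have w2 := w (2-ρ.re) (by linarith)
  refine (add_le_add a1 a2).trans ?_
  rw [← mul_add, ← integral_add w1 w2]
  refine mul_le_mul_of_nonneg_left ?_ (Real.exp_pos _).le
  refine setIntegral_mono_on (w1.add w2) (gJ_line hc _).1.integrableOn measurableSet_Ioi fun t ht => ?_
  rw [← add_mul]
  simp only [gJ, neg_mul, sub_eq_add_neg] 
  have := pow_bd h0.le h1.le ht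
  simp only [sub_eq_add_neg] at this
  exact mul_le_mul_of_nonneg_right this (Real.exp_pos _).le

lemma ker_low {ρ : ℂ} (h0 : 0 < ρ.re) (h1 : ρ.re < 1) (t : ℝ) (h : (t-ρ.im)^2 ≤ 2.25) :
    0.65 - 0.25*(t-ρ.im)^2 + 0.044*((t-ρ.im)^2)^2 ≤ XiLike.ker (2 + t*Complex.I) ρ / 2 := by
  unfold XiLike.ker
  rw [XiLike.inv_re, XiLike.inv_re, ← Complex.normSq_eq_norm_sq, ← Complex.normSq_eq_norm_sq, Complex.normSq_apply, Complex.normSq_apply]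
  have e : ∀ a b : ℝ, (2+t*Complex.I - ρ).re = 2 - ρ.re ∧ (2+t*Complex.I - ρ).im = t - ρ.im ∧ (2+t*Complex.I - (1 - conj ρ)).re = 1+ρ.re ∧ (2+t*Complex.I - (1-conj ρ)).im = t - ρ.im := by
    intro a b; simp; ring
  obtain ⟨e1, e2, e3, e4⟩ := e 0 0
  rw [e1, e2, e3, e4, ← sq, ← sq, ← sq]
  set u := (t-ρ.im)^2
  have u0 : 0 ≤ u := sq_nonneg _
  set β := ρ.re
  have d1 : 0 < (2-β)^2+u := by nlinarith
  have d2 : 0 < (1+β)^2+u := by nlinarith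
  rw [div_add_div _ _ d1.ne' d2.ne', div_div, le_div_iff₀ (by positivity)]
  have p0 : 0 ≤ (2-β)*(1+β) - 2 := by nlinarith
  have p1 : 0 ≤ 2.25 - (2-β)*(1+β) := by nlinarith [sq_nonneg (β-1/2)]
  set p := (2-β)*(1+β) with hp
  have n1 : (2-β)*((1+β)^2+u)+((2-β)^2+u)*(1+β) = 3*(p+u) := by rw [hp]; ring
  have n2 : ((2-β)^2+u)*((1+β)^2+u) = p^2+(9-2*p)*u+u^2 := by rw [hp]; ring
  rw [n1, n2]
  have g0 : 0 ≤ 0.65-0.25*u+0.044*u^2 := by nlinarith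
  have q1 : (0.65-0.25*u+0.044*u^2)*(2.25+u)^2 ≤ 1.5*(2.25+u) := by
    have : (0.65-0.25*u+0.044*u^2)*(2.25+u) ≤ 1.5 := by nlinarith [mul_nonneg u0 (sub_nonneg.2 h), sq_nonneg (u-1)]
    nlinarith
  have q2 : (0.65-0.25*u+0.044*u^2)*(4+5*u+u^2) ≤ 1.5*(2+u) := by
    nlinarith [mul_nonneg u0 (sub_nonneg.2 h), sq_nonneg (u-1), mul_nonneg (mul_nonneg u0 (sub_nonneg.2 h)) u0, sq_nonneg (u*(u-1)), sq_nonneg (u-0.9), mul_nonneg (mul_nonneg u0 (sub_nonneg.2 h)) (mul_nonneg u0 u0)]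
  nlinarith [mul_nonneg g0 (mul_nonneg p0 p1), mul_nonneg p0 (sub_nonneg.2 q1), mul_nonneg p1 (sub_nonneg.2 q2)]
end

section
open MeasureTheory Set Filter Topology
open scoped ComplexConjugate
set_option linter.unusedSectionVars false
set_option linter.unusedSimpArgs false

lemma lin_exp_int {θ T K : ℝ} (hθ : 0 < θ) (hT : 100 ≤ T) (hK : 0.64 ≤ K) :
    IntegrableOn (fun t => Real.exp (-θ*t) * (K + (t-T)/(2*T))) (Ioi (T-1.5)) ∧
    ∫ t in Ioi (T-1.5), Real.exp (-θ*t) * (K + (t-T)/(2*T)) = Real.exp (1.5*θ)/θ*(K+(1/θ-1.5)/(2*T)) * Real.exp (-θ*T) := by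
  have T0 : 0 < T := by linarith
  have hd : ∀ t ∈ Ici (T-1.5), HasDerivAt (fun t => -(1/θ) * (Real.exp (-θ*t) * (K + (t-T)/(2*T) + 1/(2*T*θ)))) (Real.exp (-θ*t) * (K + (t-T)/(2*T))) t := by
    intro t _
    have h1 := ((hasDerivAt_id t).const_mul (-θ)).exp
    have h2 := ((((hasDerivAt_id t).sub_const T).div_const (2*T)).const_add K).add_const (1/(2*T*θ))
    refine ((h1.mul h2).const_mul (-(1/θ))).congr_deriv ?_
    simp; field_simp; ring
  have hp : ∀ t ∈ Ioi (T-1.5), 0 ≤ Real.exp (-θ*t) * (K + (t-T)/(2*T)) := by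
    intro t ht
    have ht : T-1.5 < t := ht
    have : -0.64 ≤ (t-T)/(2*T) := by rw [le_div_iff₀ (by positivity)]; nlinarith
    exact mul_nonneg (Real.exp_pos _).le (by linarith)
  have hl : Tendsto (fun t => -(1/θ) * (Real.exp (-θ*t) * (K + (t-T)/(2*T) + 1/(2*T*θ)))) atTop (𝓝 0) := by
    have hm : Tendsto (fun t : ℝ => θ*t) atTop atTop := tendsto_id.const_mul_atTop hθ
    have h0 := (Real.tendsto_pow_mul_exp_neg_atTop_nhds_zero 0).comp hm
    have h1 := (Real.tendsto_pow_mul_exp_neg_atTop_nhds_zero 1).comp hm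
    have := (h0.const_mul (-(1/θ)*(K - T/(2*T) + 1/(2*T*θ)))).add (h1.const_mul (-(1/θ)/(2*T*θ)))
    rw [mul_zero, mul_zero, add_zero] at this
    refine this.congr fun t => ?_
    simp only [Function.comp, pow_zero, pow_one, neg_mul]
    field_simp; ring
  refine ⟨integrableOn_Ioi_deriv_of_nonneg' hd hp hl, ?_⟩
  rw [integral_Ioi_of_hasDerivAt_of_nonneg' hd hp hl, show -θ*(T-1.5) = 1.5*θ + -θ*T by ring, Real.exp_add]
  field_simp; ring

noncomputable def qk (θ g t : ℝ) : ℝ := indicator (Icc (g-1.5) (g+1.5)) (fun t => Real.exp (-θ*t) * (0.65 - 0.25*(t-g)^2 + 0.044*((t-g)^2)^2)) t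

lemma qk_int (θ g : ℝ) : Integrable (qk θ g) := by
  have : IntegrableOn (fun t => Real.exp (-θ*t) * (0.65 - 0.25*(t-g)^2 + 0.044*((t-g)^2)^2)) (Icc (g-1.5) (g+1.5)) :=
    (Continuous.continuousOn (by fun_prop)).integrableOn_Icc
  exact this.integrable_indicator measurableSet_Icc

lemma qk_low {θ g T : ℝ} (hg : T < g) : 1.5 * Real.exp (-θ*g) ≤ ∫ t in Ioi (T-1.5), qk θ g t := by
  have e : ∫ t in Ioi (T-1.5), qk θ g t = ∫ t in (g-1.5)..(g+1.5), Real.exp (-θ*t) * (0.65 - 0.25*(t-g)^2 + 0.044*((t-g)^2)^2) := by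
    unfold qk
    rw [setIntegral_indicator measurableSet_Icc, inter_eq_right.2, integral_Icc_eq_integral_Ioc, ← intervalIntegral.integral_of_le (by linarith)]
    intro t ht
    have := ht.1
    show T-1.5 < t
    linarith
  rw [e]
  have hd : ∀ t ∈ uIcc (g-1.5) (g+1.5), HasDerivAt (fun t => Real.exp (-θ*g) * (0.65*(t-g) - 0.25/3*(t-g)^3 + 0.044/5*(t-g)^5 - θ*(0.65/2*(t-g)^2-0.25/4*(t-g)^4+0.044/6*(t-g)^6)))
     (Real.exp (-θ*g) * ((1 - θ*(t-g)) * (0.65 - 0.25*(t-g)^2 + 0.044*((t-g)^2)^2))) t := by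
    intro t _
    have h := (hasDerivAt_id t).sub_const g
    refine (((((h.const_mul 0.65).sub ((h.pow 3).const_mul (0.25/3))).add ((h.pow 5).const_mul (0.044/5))).sub
      (((((h.pow 2).const_mul (0.65/2)).sub ((h.pow 4).const_mul (0.25/4))).add ((h.pow 6).const_mul (0.044/6))).const_mul θ)).const_mul (Real.exp (-θ*g))).congr_deriv ?_
    simp; ring
  have c : Continuous fun t => Real.exp (-θ*g) * ((1 - θ*(t-g)) * (0.65 - 0.25*(t-g)^2 + 0.044*((t-g)^2)^2)) := by fun_prop
  have := intervalIntegral.integral_eq_sub_of_hasDerivAt hd (c.intervalIntegrable _ _)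
  calc 1.5 * Real.exp (-θ*g) ≤ ∫ t in (g-1.5)..(g+1.5), Real.exp (-θ*g) * ((1 - θ*(t-g)) * (0.65 - 0.25*(t-g)^2 + 0.044*((t-g)^2)^2)) := by
        rw [this]; have := Real.exp_pos (-θ*g); rw [add_sub_cancel_left, show g-1.5-g = -1.5 by ring]; ring_nf at this ⊢; nlinarith
    _ ≤ _ := by
        refine intervalIntegral.integral_mono_on (by linarith) (c.intervalIntegrable _ _) (Continuous.intervalIntegrable (by fun_prop) _ _) fun t ht => ?_
        rw [show -θ*t = -θ*g + -θ*(t-g) by ring, Real.exp_add, ← mul_assoc]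
        have := Real.add_one_le_exp (-θ*(t-g))
        have u : (t-g)^2 ≤ 2.25 := by nlinarith [ht.1, ht.2]
        refine mul_le_mul_of_nonneg_right (mul_le_mul_of_nonneg_left (by linarith) (Real.exp_pos _).le) ?_
        nlinarith [sq_nonneg (t-g)]

variable {q : ℕ} [NeZero q] {χ : DirichletCharacter ℂ q}

lemma tail_count (hχ : χ.IsPrimitive) {T θ ε : ℝ} (hT : 100 ≤ T) (hθ : 0 < θ) (hε : ε^2 = 1) (hL0 : 0 ≤ Real.log (q*T/(2*Real.pi))) (S : Finset ℂ) (hS : ∀ ρ ∈ S, mul' (Xi χ) ρ ≠ 0 → T < ε*ρ.im) :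
    ∑ ρ ∈ S, mul' (Xi χ) ρ * Real.exp (-θ*(ε*ρ.im)) ≤ (2/3)*Real.exp (1.5*θ)/θ*(Real.log (q*T/(2*Real.pi))/2+0.64+(1/θ-1.5)/(2*T)) * Real.exp (-θ*T) := by
  have hX := Xi_XiLike hχ
  have mn : ∀ ρ, 0 ≤ mul' (Xi χ) ρ := fun ρ => by unfold mul'; positivity
  have pp := Real.pi_pos
  have hq0 : (0:ℝ) < q := by exact_mod_cast Nat.pos_of_ne_zero (NeZero.ne q)
  set L := Real.log (q*T/(2*Real.pi)) with hL
  have key : ∀ t ∈ Ioi (T-1.5), ∑ ρ ∈ S, mul' (Xi χ) ρ * qk θ (ε*ρ.im) t ≤ Real.exp (-θ*t) * (L/2+0.64 + (t-T)/(2*T)) := by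
    intro t ht
    have ht : T-1.5 < t := ht
    have t0 : 0 < t := by linarith
    have ab : |ε*t| = t := by
      rw [abs_mul, abs_of_pos t0, show |ε| = 1 from by rw [← pow_eq_one_iff_of_nonneg (abs_nonneg _) two_ne_zero, sq_abs, hε], one_mul]
    have h1 := W_le_tail hχ (t := ε*t) (by rw [ab]; linarith)
    rw [ab] at h1
    have h2 := hX.hasSum_W (2 + (ε*t:ℝ) * Complex.I) (by simp)
    have knn : ∀ ρ, mul' (Xi χ) ρ ≠ 0 → 0 ≤ XiLike.ker (2 + (ε*t:ℝ) * Complex.I) ρ := by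
      intro ρ hm
      have := XiLike.ker_term_nonneg (2 + (ε*t:ℝ) * Complex.I) ρ (by simp) (hX.strip ρ (XiLike.zero_of_mul ρ hm))
      exact add_nonneg this.1 this.2
    have h3 := sum_le_hasSum S (fun ρ _ => ?_) h2
    · have hl : Real.log (q*t/(2*Real.pi)) ≤ L + (t-T)/T := by
        have e : q*t/(2*Real.pi) = q*T/(2*Real.pi) * (t/T) := by field_simp
        rw [e, Real.log_mul (by positivity) (by positivity)]
        have := Real.log_le_sub_one_of_pos (x := t/T) (by positivity)
        have e3 : (t-T)/T = t/T - 1 := by field_simp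
        linarith
      calc _ ≤ ∑ ρ ∈ S, Real.exp (-θ*t) / 2 * (mul' (Xi χ) ρ * XiLike.ker (2 + (ε*t:ℝ) * Complex.I) ρ) := by
            refine Finset.sum_le_sum fun ρ hρ => ?_
            by_cases hm : mul' (Xi χ) ρ = 0
            · simp [hm]
            · have st := hX.strip ρ (XiLike.zero_of_mul ρ hm)
              rw [show Real.exp (-θ*t) / 2 * (mul' (Xi χ) ρ * XiLike.ker (2 + (ε*t:ℝ) * Complex.I) ρ) = mul' (Xi χ) ρ * (Real.exp (-θ*t) * (XiLike.ker (2 + (ε*t:ℝ) * Complex.I) ρ / 2)) by ring]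
              refine mul_le_mul_of_nonneg_left ?_ (mn ρ)
              unfold qk
              have eq : (t-ε*ρ.im)^2 = (ε*t-ρ.im)^2 := by
                have : (ε*t-ρ.im)^2 = ε^2*t^2 - 2*ε*t*ρ.im + ρ.im^2 := by ring
                rw [this]
                have : (t-ε*ρ.im)^2 = t^2 - 2*ε*t*ρ.im + ε^2*ρ.im^2 := by ring
                rw [this, hε]; ring
              refine indicator_apply_le' (fun hm => ?_) (fun _ => ?_)
              · rw [eq]
                refine mul_le_mul_of_nonneg_left (ker_low st.1 st.2 _ ?_) (Real.exp_pos _).le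
                rw [← eq]; nlinarith [hm.1, hm.2]
              · have := knn ρ hm; positivity
        _ = Real.exp (-θ*t) / 2 * ∑ ρ ∈ S, (mul' (Xi χ) ρ * XiLike.ker (2 + (ε*t:ℝ) * Complex.I) ρ) := by rw [Finset.mul_sum]
        _ ≤ Real.exp (-θ*t) / 2 * (2 * (L/2+0.64 + (t-T)/(2*T))) := by
            refine mul_le_mul_of_nonneg_left ?_ (by positivity)
            have e3 : (t-T)/(2*T) = (t-T)/T/2 := by field_simp
            rw [e3]; linarith
        _ = _ := by ring
    · by_cases hm : mul' (Xi χ) ρ = 0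
      · simp [hm]
      · exact mul_nonneg (mn ρ) (knn ρ hm)
  obtain ⟨i1, i2⟩ := lin_exp_int hθ hT (K := L/2+0.64) (by linarith)
  have m := setIntegral_mono_on (integrable_finsetSum S fun ρ _ => ((qk_int θ (ε*ρ.im)).integrableOn (s := Ioi (T-1.5))).const_mul (mul' (Xi χ) ρ)) i1 measurableSet_Ioi key
  rw [i2, integral_finsetSum _ (fun ρ _ => ((qk_int θ (ε*ρ.im)).integrableOn (s := Ioi (T-1.5))).const_mul (mul' (Xi χ) ρ))] at m
  have m2 : ∑ ρ ∈ S, mul' (Xi χ) ρ * (1.5 * Real.exp (-θ*(ε*ρ.im))) ≤ ∑ ρ ∈ S, ∫ t in Ioi (T-1.5), mul' (Xi χ) ρ * qk θ (ε*ρ.im) t := by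
    refine Finset.sum_le_sum fun ρ hρ => ?_
    rw [integral_const_mul]
    by_cases hm : mul' (Xi χ) ρ = 0
    · simp [hm]
    · exact mul_le_mul_of_nonneg_left (qk_low (hS ρ hρ hm)) (mn ρ)
  calc _ = 2/3 * ∑ ρ ∈ S, mul' (Xi χ) ρ * (1.5 * Real.exp (-θ*(ε*ρ.im))) := by
        rw [Finset.mul_sum]; exact Finset.sum_congr rfl fun ρ _ => by ring
    _ ≤ 2/3 * (Real.exp (1.5*θ)/θ*(L/2+0.64+(1/θ-1.5)/(2*T)) * Real.exp (-θ*T)) := by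
        have := m2.trans m
        linarith
    _ = _ := by ring

theorem tail_final (hχ : χ.IsPrimitive) {δ T : ℝ} (hT : 100 ≤ T) (hd : 4 * Real.pi^2 * |δ| ≤ T) (S : Finset ℂ) (hS : ∀ ρ ∈ S, mul' (Xi χ) ρ ≠ 0 → T < |ρ.im|) :
    ∑ ρ ∈ S, mul' (Xi χ) ρ * ‖mellin (gg δ) ρ‖ ≤ T * Real.log (q*T/(2*Real.pi)) * (3.5*Real.exp (-0.1598*T)+0.64*Real.exp (-0.426*T^2/(2*Real.pi*|δ|)^2)) := by
  have hX := Xi_XiLike hχ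
  have mn : ∀ ρ, 0 ≤ mul' (Xi χ) ρ := fun ρ => by unfold mul'; positivity
  have pp := Real.pi_pos
  have hq1 : (1:ℝ) ≤ q := by exact_mod_cast Nat.pos_of_ne_zero (NeZero.ne q)
  have hlog : Real.log (T/(2*Real.pi)) ≤ Real.log (q*T/(2*Real.pi)) := by
    apply Real.log_le_log (by positivity)
    gcongr
    nlinarith
  obtain ⟨θ, cc, t0, t1, c0, c1, L0, fin⟩ := fin_ineq hT (ℓ := 2*Real.pi*|δ|) (by positivity) (by nlinarith) hlog
  set L := Real.log (q*T/(2*Real.pi)) with hL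
  have t4 : |θ| < Real.pi/4 := by rw [abs_of_pos t0]; linarith [Real.pi_gt_three]
  set c := Real.cos (2*θ) with hc
  have cp : 0 < c := by linarith
  set b := 2*Real.pi*δ*Real.sin θ with hb
  set Z := (2/3)*Real.exp (1.5*θ)/θ*(L/2+0.64+(1/θ-1.5)/(2*T)) * Real.exp (-θ*T) with hZ
  set S' := S ∪ S.image (fun ρ => 1 - conj ρ) with hS'
  have inv : ∀ ρ : ℂ, 1 - conj (1 - conj ρ) = ρ := fun ρ => by simp
  have mem : ∀ ρ ∈ S', 1 - conj ρ ∈ S' := by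
    intro ρ h
    rw [hS', Finset.mem_union, Finset.mem_image] at h ⊢
    rcases h with h | ⟨r, h, rfl⟩
    · exact Or.inr ⟨ρ, h, rfl⟩
    · left; rw [inv]; exact h
  have hS2 : ∀ ρ ∈ S', mul' (Xi χ) ρ ≠ 0 → T < |ρ.im| := by
    intro ρ h
    rw [hS', Finset.mem_union, Finset.mem_image] at h
    rcases h with h | ⟨r, h, rfl⟩
    · exact hS ρ h
    · rw [hX.mul_sym]
      simpa using hS r h
  have e1 : ∑ ρ ∈ S', mul' (Xi χ) ρ * ‖mellin (gg δ) ρ‖ = ∑ ρ ∈ S', mul' (Xi χ) ρ * ‖mellin (gg δ) (1 - conj ρ)‖ := by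
    refine Finset.sum_nbij' (fun ρ => 1 - conj ρ) (fun ρ => 1 - conj ρ) mem mem (fun ρ _ => inv ρ) (fun ρ _ => inv ρ) fun ρ _ => ?_
    rw [inv, hX.mul_sym]
  set Jp := ∫ t in Ioi (0:ℝ), gJ c (-b) t with hJp
  set Jm := ∫ t in Ioi (0:ℝ), gJ c b t with hJm
  have J0 : ∀ a, 0 ≤ ∫ t in Ioi (0:ℝ), gJ c a t := fun a => by
    refine integral_nonneg fun t => ?_
    unfold gJ; positivity
  have p1 : ∑ ρ ∈ S'.filter (fun ρ => 0 < ρ.im), mul' (Xi χ) ρ * (‖mellin (gg δ) ρ‖ + ‖mellin (gg δ) (1 - conj ρ)‖) ≤ Z * Jp := by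
    have tc := tail_count hχ (ε := 1) hT t0 (by norm_num) L0 (S'.filter (fun ρ => 0 < ρ.im)) (fun ρ h hm => by
      rw [Finset.mem_filter] at h
      have := hS2 ρ h.1 hm
      rwa [abs_of_pos h.2, ← one_mul ρ.im] at this)
    refine le_trans ?_ (mul_le_mul_of_nonneg_right tc (J0 _))
    rw [Finset.sum_mul]
    refine Finset.sum_le_sum fun ρ _ => ?_
    by_cases hm : mul' (Xi χ) ρ = 0
    · simp [hm]
    have st := hX.strip ρ (XiLike.zero_of_mul ρ hm)
    have := rot_pair δ st.1 st.2 t4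
    rw [one_mul, mul_assoc]
    exact mul_le_mul_of_nonneg_left this (mn ρ)
  have p2 : ∑ ρ ∈ S'.filter (fun ρ => ¬ 0 < ρ.im), mul' (Xi χ) ρ * (‖mellin (gg δ) ρ‖ + ‖mellin (gg δ) (1 - conj ρ)‖) ≤ Z * Jm := by
    have tc := tail_count hχ (ε := -1) hT t0 (by norm_num) L0 (S'.filter (fun ρ => ¬ 0 < ρ.im)) (fun ρ h hm => by
      rw [Finset.mem_filter] at h
      have := hS2 ρ h.1 hm
      rw [abs_of_nonpos (not_lt.1 h.2)] at this
      linarith)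
    refine le_trans ?_ (mul_le_mul_of_nonneg_right tc (J0 _))
    rw [Finset.sum_mul]
    refine Finset.sum_le_sum fun ρ _ => ?_
    by_cases hm : mul' (Xi χ) ρ = 0
    · simp [hm]
    have st := hX.strip ρ (XiLike.zero_of_mul ρ hm)
    have := rot_pair δ st.1 st.2 (φ := -θ) (by rwa [abs_neg])
    rw [mul_neg, Real.cos_neg, Real.sin_neg, mul_neg, neg_neg, neg_neg] at this
    rw [mul_assoc, show -θ*(-1*ρ.im) = θ*ρ.im by ring]
    exact mul_le_mul_of_nonneg_left this (mn ρ)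
  have tot : ∑ ρ ∈ S', mul' (Xi χ) ρ * ‖mellin (gg δ) ρ‖ ≤ Z * ((Jm + Jp)/2) := by
    have h := Finset.sum_filter_add_sum_filter_not S' (fun ρ => 0 < ρ.im) (fun ρ => mul' (Xi χ) ρ * (‖mellin (gg δ) ρ‖ + ‖mellin (gg δ) (1 - conj ρ)‖))
    have h2 : ∑ ρ ∈ S', mul' (Xi χ) ρ * (‖mellin (gg δ) ρ‖ + ‖mellin (gg δ) (1 - conj ρ)‖) = 2 * ∑ ρ ∈ S', mul' (Xi χ) ρ * ‖mellin (gg δ) ρ‖ := by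
      simp_rw [mul_add]
      rw [Finset.sum_add_distrib, ← e1]; ring
    linarith
  refine (Finset.sum_le_sum_of_subset_of_nonneg Finset.subset_union_left (fun ρ _ _ => mul_nonneg (mn ρ) (norm_nonneg _))).trans (tot.trans (le_trans ?_ fin))
  rw [hJm, hJp, gJ_split cp b]
  have bsq : b^2 = (2*Real.pi*|δ|)^2 * Real.sin θ^2 := by rw [hb]; simp only [mul_pow, sq_abs]
  have ss : Real.sin θ^2 ≤ θ^2 := by
    rw [sq_le_sq]; exact Real.abs_sin_le_abs
  have A := (A_le t0.le t1).2
  set l := 2*Real.pi*|δ|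
  have l0 : 0 ≤ l := by positivity
  have x1 : b^2/c^2 ≤ l^2*θ^2/cc^2 := by rw [bsq]; gcongr
  have x2 : 1/c ≤ 1/cc := by gcongr
  have x3 : Real.sqrt (2*Real.pi/c) ≤ Real.sqrt (2*Real.pi/cc) := by gcongr
  have x4 : Real.exp (b^2/(2*c)) ≤ Real.exp (l^2*(θ^2/2+0.9585*θ^4)) := by
    apply Real.exp_le_exp.2
    rw [bsq, mul_div_assoc]
    exact mul_le_mul_of_nonneg_left A (sq_nonneg l)
  have Z0 : 0 ≤ (2/3)*Real.exp (1.5*θ)/θ*(L/2+0.64+(1/θ-1.5)/(2*T)) := by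
    have : 0 ≤ 1/θ - 1.5 := by rw [sub_nonneg, le_div_iff₀ t0]; linarith
    positivity
  have x5 : (1.1*(b^2/c^2+1/c)+2.5)/2 ≤ 0.55*(l^2*θ^2/cc^2)+0.825/cc+1.875 := by
    have : 0.825/cc = 0.825*(1/cc) := by ring
    have : 0 < 1/cc := by positivity
    linarith
  calc _ = (2/3)*Real.exp (1.5*θ)/θ*(L/2+0.64+(1/θ-1.5)/(2*T)) * ((1.1*(b^2/c^2+1/c)+2.5)/2 * Real.sqrt (2*Real.pi/c)) * (Real.exp (b^2/(2*c)) * Real.exp (-θ*T)) := by rw [hZ]; ring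
    _ ≤ (2/3)*Real.exp (1.5*θ)/θ*(L/2+0.64+(1/θ-1.5)/(2*T)) * ((0.55*(l^2*θ^2/cc^2)+0.825/cc+1.875) * Real.sqrt (2*Real.pi/cc)) * (Real.exp (l^2*(θ^2/2+0.9585*θ^4)) * Real.exp (-θ*T)) := by
        gcongr
    _ = _ := by rw [show l^2*(θ^2/2+0.9585*θ^4)-θ*T = l^2*(θ^2/2+0.9585*θ^4) + -θ*T by ring, Real.exp_add]
end

section
open MeasureTheory Set Filter Topology
open scoped ComplexConjugate
set_option linter.unusedSectionVars false
set_option linter.unusedSimpArgs false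

lemma e2pi_norm (t : ℝ) : ‖e2pi t‖ = 1 := by
  unfold e2pi
  rw [show 2 * (Real.pi:ℂ) * Complex.I * t = ((2*Real.pi*t : ℝ):ℂ) * Complex.I by push_cast; ring, Complex.norm_exp_ofReal_mul_I]

lemma etaSq_nonneg (t : ℝ) : 0 ≤ etaSq t := by unfold etaSq; positivity

lemma gg_norm (δ t : ℝ) : ‖gg δ t‖ = etaSq t := by
  rw [gg, norm_mul, e2pi_norm, one_mul, Complex.norm_real, Real.norm_of_nonneg (etaSq_nonneg t)]

lemma etaSq_le {u : ℝ} (hu : 0 < u) : etaSq u ≤ 2.17 / u^2 := by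
  unfold etaSq
  rw [le_div_iff₀ (by positivity)]
  have h1 : Real.exp 1 * (u^2/4) ≤ Real.exp (u^2/4) := by
    have := Real.add_one_le_exp (u^2/4-1)
    rw [Real.exp_sub, sub_add_cancel, le_div_iff₀ (Real.exp_pos _)] at this
    linarith
  have h2 := Real.exp_one_gt_d9
  have h3 : (2.718*(u^2/4))^2 ≤ Real.exp (u^2/4)^2 := by
    gcongr
    refine le_trans ?_ h1
    gcongr; linarith
  have h4 : Real.exp (-u^2/2) * Real.exp (u^2/4)^2 = 1 := by
    rw [← Real.exp_nat_mul, ← Real.exp_add, Real.exp_eq_one_iff]; push_cast; ring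
  have h5 := mul_le_mul_of_nonneg_left h3 (Real.exp_pos (-u^2/2)).le
  rw [h4] at h5
  nlinarith

lemma main_le (δ : ℝ) : ‖∫ t in Ioi (0:ℝ), gg δ t‖ ≤ 4.2 := by
  have h := gJ_split one_pos 0
  obtain ⟨hi, -⟩ := gJ_line one_pos 0
  have s : Real.sqrt (2*Real.pi/1) ≤ 2.51 := by
    rw [Real.sqrt_le_left (by norm_num)]
    have := Real.pi_lt_d2; norm_num at this ⊢; linarith
  have h2 : ‖∫ t in Ioi (0:ℝ), gg δ t‖ ≤ ∫ t in Ioi (0:ℝ), 1/1.1 * gJ 1 0 t := by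
    refine norm_integral_le_of_norm_le (hi.integrableOn.const_mul _) (Eventually.of_forall fun t => ?_)
    rw [gg_norm]
    unfold etaSq gJ
    have : -1*t^2/2+0*t = -t^2/2 := by ring
    rw [this]
    have := Real.exp_pos (-t^2/2)
    rw [← mul_assoc]
    gcongr
    nlinarith [sq_nonneg t]
  rw [integral_const_mul] at h2
  norm_num at h h2 s ⊢
  linarith

variable {q : ℕ} [NeZero q] {χ : DirichletCharacter ℂ q}

lemma triv_bd {x : ℝ} (hx : 0 < x) (δ : ℝ) :
    ‖(∑' n : ℕ, (ArithmeticFunction.vonMangoldt n : ℂ) * χ (n : ZMod q) * fx x δ n) -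
      (if q = 1 then (∫ t in Ioi (0:ℝ), gg δ t) * x else 0)‖ ≤ 1.33*x^2 + 4.2*x := by
  obtain ⟨ls, lb⟩ := lam_summable
  have h1 : ‖∑' n : ℕ, (ArithmeticFunction.vonMangoldt n : ℂ) * χ (n : ZMod q) * fx x δ n‖ ≤ 2.17*x^2 * ∑' n : ℕ, ArithmeticFunction.vonMangoldt n / (n:ℝ)^2 := by
    refine tsum_of_norm_bounded (ls.hasSum.mul_left (2.17*x^2)) fun n => ?_
    rcases Nat.eq_zero_or_pos n with rfl | hn
    · simp
    have n0 : (0:ℝ) < n := by exact_mod_cast hn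
    have vn : 0 ≤ ArithmeticFunction.vonMangoldt n := ArithmeticFunction.vonMangoldt_nonneg
    rw [norm_mul, norm_mul, Complex.norm_real, Real.norm_of_nonneg vn, fx, gg_norm]
    have a := etaSq_le (u := n/x) (by positivity)
    have c := DirichletCharacter.norm_le_one χ (n : ZMod q)
    have e := etaSq_nonneg (n/x)
    calc _ ≤ ArithmeticFunction.vonMangoldt n * 1 * (2.17/(n/x)^2) := by gcongr
      _ = _ := by field_simp
  have h2 : ‖(if q = 1 then (∫ t in Ioi (0:ℝ), gg δ t) * x else 0 : ℂ)‖ ≤ 4.2*x := by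
    split_ifs
    · rw [norm_mul, Complex.norm_real, Real.norm_of_nonneg hx.le]
      exact mul_le_mul_of_nonneg_right (main_le δ) hx.le
    · simp; positivity
  refine (norm_sub_le _ _).trans (add_le_add (h1.trans ?_) h2)
  nlinarith [sq_nonneg x, mul_le_mul_of_nonneg_left lb (sq_nonneg x)]

lemma MM_le {x δ T : ℝ} (hx : 10 ≤ x) (hl : 2*Real.pi*|δ| ≤ x^3/100) (hT : 4*Real.pi^2*|δ| ≤ T) : MM x δ ≤ 0.06 + 0.001*(Real.sqrt T * Real.sqrt x) := by
  have x0 : 0 < x := by linarith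
  have pp := Real.pi_pos
  have p3 := Real.pi_gt_three
  unfold MM
  set l := 2*Real.pi*|δ| with hld
  have l0 : 0 ≤ l := by positivity
  have hlT : 6*l ≤ T := by nlinarith
  have T0 : 0 ≤ T := by linarith
  have ix : 1/x ≤ 0.1 := by rw [div_le_iff₀ x0]; linarith
  set w := 1/x with hw
  have w0 : 0 < w := by positivity
  have xw : x*w = 1 := by rw [hw]; field_simp
  have e : (4 + (l/x+1/x^2) + ((l/x+1/x^2)^2+1/x^2))/x^2 = 4*w^2 + l*w^3 + w^4 + (l*w^2+w^3)^2 + w^4 := by rw [hw]; field_simp; ring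
  rw [e]
  have a1 : l*w^3 ≤ 0.01 := by
    have : l*w^3 ≤ x^3/100*w^3 := by gcongr
    have e3 : x^3/100*w^3 = (x*w)^3/100 := by ring
    rw [e3, xw] at this; linarith
  have a2 : (l*w^2)^2 ≤ 0.0005*(Real.sqrt T*Real.sqrt x) := by
    rw [← Real.sqrt_mul T0]
    have : (l*w^2)^2/0.0005 ≤ Real.sqrt (T*x) := by
      apply Real.le_sqrt_of_sq_le
      have e5 : ((l*w^2)^2/0.0005)^2 = 4000000*((l*w^3)^3*(l*x)) := by
        have : (l*w^3)^3*(l*x) = l^4*w^8*(x*w) := by ring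
        rw [this, xw]; ring
      rw [e5]
      have a3 : (l*w^3)^3 ≤ 0.01^3 := by gcongr
      have : (l*w^3)^3*(l*x) ≤ 0.01^3*(l*x) := by gcongr
      nlinarith [mul_nonneg l0 x0.le, mul_le_mul_of_nonneg_right hlT x0.le]
    rw [div_le_iff₀ (by norm_num)] at this
    linarith
  have w2 : w^2 ≤ 0.01 := by nlinarith
  have w3 : w^3 ≤ 0.001 := by nlinarith
  have w4 : w^4 ≤ 0.0001 := by nlinarith
  have w6 : (w^3)^2 ≤ 0.001^2 := by gcongr
  nlinarith [sq_nonneg (l*w^2 - w^3)]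

lemma zero_sum (hχ : χ.IsPrimitive) {x δ T : ℝ} (hx : 1 ≤ x) (hT : 100 ≤ T) (hd : 4 * Real.pi^2 * |δ| ≤ T)
    (hG : ∀ ρ : ℂ, χ.LFunction ρ = 0 → 0 < ρ.re → ρ.re < 1 → |ρ.im| ≤ T → ρ.re = 1/2)
    (hs : Summable (fun ρ => mul' (Xi χ) ρ * (x^ρ.re * ‖mellin (gg δ) ρ‖))) :
    ∑' ρ, mul' (Xi χ) ρ * (x^ρ.re * ‖mellin (gg δ) ρ‖) ≤ Real.sqrt x * (0.842 * Real.sqrt T * (Real.log (q * T) + 2)) +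
      x * (T * Real.log (q*T/(2*Real.pi)) * (3.5*Real.exp (-0.1598*T)+0.64*Real.exp (-0.426*T^2/(2*Real.pi*|δ|)^2))) := by
  have x0 : 0 < x := by linarith
  have mn : ∀ ρ, 0 ≤ mul' (Xi χ) ρ := fun ρ => by unfold mul'; positivity
  refine hs.tsum_le_of_sum_le fun S => ?_
  rw [← Finset.sum_filter_add_sum_filter_not S (fun ρ => |ρ.im| ≤ T)]
  have hL : ∀ ρ ∈ S.filter (fun ρ => |ρ.im| ≤ T), mul' (Xi χ) ρ ≠ 0 → ρ.re = 1/2 ∧ |ρ.im| ≤ T := by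
    intro ρ h hm
    have h2 := (Finset.mem_filter.1 h).2
    obtain ⟨a, b, c⟩ := Xi_zero_L hχ ρ (XiLike.zero_of_mul ρ hm)
    exact ⟨hG ρ c a b h2, h2⟩
  refine add_le_add ?_ ?_
  · refine le_trans ?_ (mul_le_mul_of_nonneg_left (low_final hχ hT hd _ hL) (Real.sqrt_nonneg x))
    rw [Finset.mul_sum]
    refine Finset.sum_le_sum fun ρ h => le_of_eq ?_
    by_cases hm : mul' (Xi χ) ρ = 0
    · simp [hm]
    rw [(hL ρ h hm).1, ← Real.sqrt_eq_rpow]; ring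
  · refine le_trans ?_ (mul_le_mul_of_nonneg_left (tail_final hχ hT hd (S.filter (fun ρ => ¬ |ρ.im| ≤ T)) (fun ρ h _ => not_le.1 (Finset.mem_filter.1 h).2)) x0.le)
    rw [Finset.mul_sum]
    refine Finset.sum_le_sum fun ρ h => ?_
    by_cases hm : mul' (Xi χ) ρ = 0
    · simp [hm]
    have b := (Xi_zero_L hχ ρ (XiLike.zero_of_mul ρ hm)).2.1
    have : x^ρ.re ≤ x := by
      calc _ ≤ x^(1:ℝ) := Real.rpow_le_rpow_of_exponent_le hx b.le
        _ = x := Real.rpow_one x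
    have := mn ρ
    calc _ ≤ mul' (Xi χ) ρ * (x * ‖mellin (gg δ) ρ‖) := by gcongr
      _ = _ := by ring

set_option maxHeartbeats 1000000 in
lemma core (hχ : χ.IsPrimitive) {x δ T : ℝ} (hx : 1 ≤ x) (hT : 100 ≤ T) (hd : 4 * Real.pi^2 * |δ| ≤ T)
    (hG : ∀ ρ : ℂ, χ.LFunction ρ = 0 → 0 < ρ.re → ρ.re < 1 → |ρ.im| ≤ T → ρ.re = 1/2) :
    ‖(∑' n : ℕ, (ArithmeticFunction.vonMangoldt n : ℂ) * χ (n : ZMod q) * fx x δ n) -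
      (if q = 1 then (∫ t in Ioi (0:ℝ), gg δ t) * x else 0)‖ ≤
      x * (T * Real.log (q*T/(2*Real.pi)) * (3.5*Real.exp (-0.1598*T)+0.64*Real.exp (-0.426*T^2/(2*Real.pi*|δ|)^2))) +
      (1.22 * Real.sqrt T * Real.log (q * T) + 5.053 * Real.sqrt T + 1.423 * Real.log q + 37.19) * Real.sqrt x := by
  have x0 : 0 < x := by linarith
  have T0 : 0 < T := by linarith
  have pp := Real.pi_pos
  have p4 := Real.pi_lt_d2
  have p3 := Real.pi_gt_three
  have hq1 : (1:ℝ) ≤ q := by exact_mod_cast Nat.pos_of_ne_zero (NeZero.ne q)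
  have q0 : (0:ℝ) < q := by linarith
  have lq : 0 ≤ Real.log q := Real.log_nonneg hq1
  have l100 : 4 ≤ Real.log 100 ∧ Real.log 100 ≤ 5 := by
    have h1 := Real.exp_one_lt_d9
    have h2 := Real.exp_one_gt_d9
    constructor
    · rw [Real.le_log_iff_exp_le (by norm_num), show (4:ℝ) = ((4:ℕ):ℝ)*1 by norm_num, Real.exp_nat_mul]
      calc _ ≤ (2.72:ℝ)^4 := by gcongr; linarith
        _ ≤ _ := by norm_num
    · rw [Real.log_le_iff_le_exp (by norm_num), show (5:ℝ) = ((5:ℕ):ℝ)*1 by norm_num, Real.exp_nat_mul]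
      calc (100:ℝ) ≤ (2.71:ℝ)^5 := by norm_num
        _ ≤ _ := by gcongr; linarith
  have lT : 4 ≤ Real.log T := l100.1.trans (Real.log_le_log (by norm_num) hT)
  have lqT : Real.log (q*T) = Real.log q + Real.log T := Real.log_mul q0.ne' T0.ne'
  have lq100 : Real.log (q*100) = Real.log q + Real.log 100 := Real.log_mul q0.ne' (by norm_num)
  have L0 : 0 ≤ Real.log (q*T/(2*Real.pi)) := by
    apply Real.log_nonneg
    rw [le_div_iff₀ (by positivity)]; nlinarith
  set A := x * (T * Real.log (q*T/(2*Real.pi)) * (3.5*Real.exp (-0.1598*T)+0.64*Real.exp (-0.426*T^2/(2*Real.pi*|δ|)^2))) with hA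
  have A0 : 0 ≤ A := by positivity
  have rT : 10 ≤ Real.sqrt T := by apply Real.le_sqrt_of_sq_le; linarith
  set r := Real.sqrt T with hr
  set s := Real.sqrt x with hs
  have s0 : 0 < s := Real.sqrt_pos.2 x0
  have ss : s^2 = x := Real.sq_sqrt x0.le
  have rr : r^2 = T := Real.sq_sqrt T0.le
  set Lq := Real.log q with hLq
  rw [lqT]
  by_cases hc : 1.33*x^2+4.2*x ≤ (9.93*r + 37)*s
  · refine (triv_bd x0 δ).trans (hc.trans ?_)
    have : (9.93*r+37) ≤ 1.22*r*(Lq+Real.log T)+5.053*r+1.423*Lq+37.19 := by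
      nlinarith [mul_nonneg (by linarith : 0 ≤ r) lq, mul_le_mul_of_nonneg_left lT (by linarith : 0 ≤ r)]
    have := mul_le_mul_of_nonneg_right this s0.le
    linarith
  · push Not at hc
    have hs1 : 1 ≤ s := by rw [hs]; exact Real.one_le_sqrt.2 hx
    have hx10 : 10 ≤ x := by
      by_contra hlt
      push Not at hlt
      have s32 : s < 3.17 := by nlinarith
      have : 136*s ≤ (9.93*r+37)*s := by gcongr; linarith
      have e1 : 1.33*x^2+4.2*x = s*(1.33*s^3+4.2*s) := by rw [← ss]; ring
      have e2 : 1.33*s^3+4.2*s ≤ 1.33*3.17^3+4.2*3.17 := by gcongr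
      have : s*(1.33*s^3+4.2*s) ≤ s*136 := by
        refine mul_le_mul_of_nonneg_left (e2.trans (by norm_num)) s0.le
      linarith
    have hl : 2*Real.pi*|δ| ≤ x^3/100 := by
      have h1 : 9.93*r*s < 1.75*x^2 := by nlinarith
      have h2 : (9.93*r*s)^2 < (1.75*x^2)^2 := by gcongr
      have e1 : (9.93*r*s)^2 = 98.6049*T*x := by rw [← rr, ← ss]; ring
      have e2 : (1.75*x^2)^2 = 3.0625*x^3*x := by ring
      rw [e1, e2] at h2
      have h3 := lt_of_mul_lt_mul_right h2 x0.le
      have h5 : 6*(2*Real.pi*|δ|) ≤ T := by nlinarith [mul_nonneg pp.le (abs_nonneg δ)]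
      have : 0 < x^3 := by positivity
      linarith
    obtain ⟨hsum, hb⟩ := small_terms hχ hx10 hl
    have hz := zero_sum hχ hx hT hd hG hsum
    have hM := MM_le hx10 hl hd
    rw [lqT] at hz
    rw [lq100] at hb
    refine hb.trans ?_
    have M2 : MM x δ * (Lq + Real.log 100 + 2) ≤ (0.06+0.001*(r*s))*(Lq+7) := by
      have := MM_nonneg x0 δ
      exact mul_le_mul hM (by linarith [l100.2]) (by linarith [l100.1]) (by positivity)
    have hs3 : 3 ≤ s := by rw [hs]; apply Real.le_sqrt_of_sq_le; linarith
    have y1 : 30 ≤ r*s := by nlinarith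
    have f1 : 0 ≤ (r*s)*Lq := by positivity
    have f2 : 0 ≤ (r*s)*Real.log T := by positivity
    have f3 : Lq ≤ s*Lq := by nlinarith
    have : Real.sqrt x * (0.842 * r * (Lq + Real.log T + 2)) = 0.842*((r*s)*Lq) + 0.842*((r*s)*Real.log T) + 1.684*(r*s) := by rw [← hs]; ring
    rw [this] at hz
    have e3 : (1.22*r*(Lq+Real.log T)+5.053*r+1.423*Lq+37.19)*s = 1.22*((r*s)*Lq)+1.22*((r*s)*Real.log T)+5.053*(r*s)+1.423*(s*Lq)+37.19*s := by ring
    rw [e3]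
    have e4 : (0.06+0.001*(r*s))*(Lq+7) = 0.06*Lq+0.42+0.001*((r*s)*Lq)+0.007*(r*s) := by ring
    rw [e4] at M2
    linarith
end

/-- **Proposition 4.8**: major-arc estimate for `η(t) = t² e^{-t²/2}`, conditional on
a partial verification of GRH up to height `T₀`. -/
theorem tsq_gaussian_major_arc_conditional
    (x : ℝ) (hx : 1 ≤ x) (δ : ℝ)
    (q : ℕ) [NeZero q] (χ : DirichletCharacter ℂ q) (hχ : χ.IsPrimitive)
    (T₀ : ℝ) (hT₀ : max (4 * Real.pi^2 * |δ|) 100 ≤ T₀)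
    (hGRH : ∀ ρ : ℂ, χ.LFunction ρ = 0 → 0 < ρ.re → ρ.re < 1 → |ρ.im| ≤ T₀ →
      ρ.re = 1/2) :
    ∃ E : ℂ,
      (∑' n : ℕ, (ArithmeticFunction.vonMangoldt n : ℂ) * χ (n : ZMod q)
          * e2pi (δ * n / x) * (etaSq (n / x) : ℂ))
        = (if q = 1 then
            (∫ t in Set.Ioi (0:ℝ), e2pi (δ * t) * (etaSq t : ℂ)) * x
          else 0) + E * x ∧
      ‖E‖ ≤ T₀ * Real.log (q * T₀ / (2 * Real.pi))
              * (3.5 * Real.exp (-0.1598 * T₀)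
                + 0.64 * Real.exp (-0.1065 * T₀^2 / (Real.pi * δ)^2))
            + (1.22 * Real.sqrt T₀ * Real.log (q * T₀) + 5.053 * Real.sqrt T₀
                + 1.423 * Real.log q + 37.19) * x ^ (-(1:ℝ)/2)
            + (3 + 11 * |δ|) * x⁻¹
            + (Real.log q + 6) * (1 + 6 * |δ|) * x ^ (-(3:ℝ)/2) := by
  have x0 : 0 < x := by linarith
  have hc := core hχ hx ((le_max_right _ _).trans hT₀) ((le_max_left _ _).trans hT₀) hGRH
  have hq1 : (1:ℝ) ≤ q := by exact_mod_cast Nat.pos_of_ne_zero (NeZero.ne q)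
  have lq : 0 ≤ Real.log q := Real.log_nonneg hq1
  have e1 : ∀ n : ℕ, (ArithmeticFunction.vonMangoldt n : ℂ) * χ (n : ZMod q) * e2pi (δ * n / x) * (etaSq (n / x) : ℂ) =
      (ArithmeticFunction.vonMangoldt n : ℂ) * χ (n : ZMod q) * fx x δ n := by
    intro n; rw [fx, gg, mul_assoc, mul_div_assoc]
  simp_rw [e1]
  set D := (∑' n : ℕ, (ArithmeticFunction.vonMangoldt n : ℂ) * χ (n : ZMod q) * fx x δ n) -
      (if q = 1 then (∫ t in Ioi (0:ℝ), gg δ t) * x else 0) with hD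
  have xc : (x:ℂ) ≠ 0 := by exact_mod_cast x0.ne'
  refine ⟨D / x, ?_, ?_⟩
  · rw [div_mul_cancel₀ _ xc, hD]
    simp only [gg]
    ring
  · rw [norm_div, Complex.norm_real, Real.norm_of_nonneg x0.le, div_le_iff₀ x0]
    have e2 : -0.426*T₀^2/(2*Real.pi*|δ|)^2 = -0.1065*T₀^2/(Real.pi*δ)^2 := by
      rw [show (2*Real.pi*|δ|)^2 = 4*(Real.pi*δ)^2 by rw [mul_pow, sq_abs]; ring, div_mul_eq_div_div]
      congr 1; ring
    rw [e2] at hc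
    have e3 : x^(-(1:ℝ)/2) * x = Real.sqrt x := by
      rw [Real.sqrt_eq_rpow]
      nth_rewrite 2 [← Real.rpow_one x]
      rw [← Real.rpow_add x0]; norm_num
    have n1 : 0 ≤ (3+11*|δ|)*x⁻¹*x := by positivity
    have n2 : 0 ≤ (Real.log q+6)*(1+6*|δ|)*x^(-(3:ℝ)/2)*x := by positivity
    rw [← e3] at hc
    linarith
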